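/- Let d ≥ 5 be an integer. Denote by T(e) the number of members of a general pencil of plane curves of degree e over ℂ that admit a tritangent line (a line tangent to the curve at three pairwise distinct points). Then T(d) = T(d−2) + 10d⁴ − 112d³ + 350d² − 56d − 720. -/

import Mathlib

noncomputable section

/-- The restriction of the form `F` to the line through `[v]` and `[w]`,
parametrized by `t ↦ v + t • w`, as a polynomial in `t`. -/
def linePoly (F : MvPolynomial (Fin 3) ℂ) (v w : Fin 3 → ℂ) : Polynomial ℂ :=
  MvPolynomial.aeval (fun i => Polynomial.C (v i) + Polynomial.X * Polynomial.C (w i)) F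

/-- The line through the two (projectively distinct) points `[v]`, `[w]` has contact
order at least `m` with the curve `{F = 0}` at the point `[v]`. -/
def ContactLE (F : MvPolynomial (Fin 3) ℂ) (v w : Fin 3 → ℂ) (m : ℕ) : Prop :=
  (Polynomial.X : Polynomial ℂ) ^ m ∣ linePoly F v w

/-- The member of the pencil spanned by `F` and `G` corresponding to `c ∈ ℙ¹`. -/
def pencilMember (F G : MvPolynomial (Fin 3) ℂ) (c : Projectivization ℂ (Fin 2 → ℂ)) :
    MvPolynomial (Fin 3) ℂ :=
  c.rep 0 • F + c.rep 1 • G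

/-- The coefficient vector of a pair of forms. -/
def coeffs2 (F G : MvPolynomial (Fin 3) ℂ) : (Fin 3 →₀ ℕ) ⊕ (Fin 3 →₀ ℕ) → ℂ :=
  Sum.elim (fun m => MvPolynomial.coeff m F) (fun m => MvPolynomial.coeff m G)

/-- The set of members of the pencil spanned by `F` and `G` admitting a tritangent line,
i.e. a line tangent (contact order at least 2) to the member at three pairwise distinct
points. -/
def tritangentMembers (F G : MvPolynomial (Fin 3) ℂ) :
    Set (Projectivization ℂ (Fin 2 → ℂ)) :=
  {c | ∃ v w u : Fin 3 → ℂ, LinearIndependent ℂ ![v, w] ∧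
    u ∈ Submodule.span ℂ ({v, w} : Set (Fin 3 → ℂ)) ∧
    LinearIndependent ℂ ![v, u] ∧ LinearIndependent ℂ ![w, u] ∧
    ContactLE (pencilMember F G c) v w 2 ∧ ContactLE (pencilMember F G c) w v 2 ∧
    ContactLE (pencilMember F G c) u v 2}

/-- `T e = N`: for a general pencil of degree-`e` plane curves, the number of members
admitting a tritangent line is `N`. -/
def TritangentCountEq (e N : ℕ) : Prop :=
  ∃ Q : MvPolynomial ((Fin 3 →₀ ℕ) ⊕ (Fin 3 →₀ ℕ)) ℂ,
    (∃ F G : MvPolynomial (Fin 3) ℂ, F.IsHomogeneous e ∧ G.IsHomogeneous e ∧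
        LinearIndependent ℂ ![F, G] ∧ MvPolynomial.eval (coeffs2 F G) Q ≠ 0) ∧
    ∀ F G : MvPolynomial (Fin 3) ℂ, F.IsHomogeneous e → G.IsHomogeneous e →
      LinearIndependent ℂ ![F, G] → MvPolynomial.eval (coeffs2 F G) Q ≠ 0 →
        (tritangentMembers F G).Finite ∧ (tritangentMembers F G).ncard = N

section Mod1
namespace TT
open MvPolynomial

section Step
set_option linter.unusedSectionVars false
variable {A ι : Type} [CommRing A] [IsDomain A] [IsNoetherianRing A] [Finite ι]

/-- Rank additivity for the image of a submodule under a linear map. -/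
lemma rk_map {M N : Type} [AddCommGroup M] [Module A M] [AddCommGroup N] [Module A N]
    (f : M →ₗ[A] N) (S : Submodule A M) [Module.Finite A S] :
    Module.finrank A (S.map f) + Module.finrank A (S ⊓ LinearMap.ker f : Submodule A M)
      = Module.finrank A S := by
  have h := Submodule.finrank_quotient_add_finrank (LinearMap.ker (f.domRestrict S))
  rw [(f.domRestrict S).quotKerEquivRange.finrank_eq, LinearMap.range_domRestrict] at h
  rw [← h]
  congr 1
  rw [LinearMap.ker_domRestrict]
  have e := Submodule.equivSubtypeMap S ((LinearMap.ker f).comap S.subtype)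
  rw [Submodule.map_comap_subtype] at e
  exact e.finrank_eq.symm

variable {k : ℕ} (w : ι → (Fin k → ℕ))

/-- graded pieces of an ideal -/
def grP (P : Ideal (MvPolynomial ι A)) (m : Fin k → ℕ) : Submodule A (MvPolynomial ι A) :=
  P.restrictScalars A ⊓ weightedHomogeneousSubmodule A w m

/-- Hilbert function -/
def hilb (P : Ideal (MvPolynomial ι A)) (m : Fin k → ℕ) : ℤ :=
  (Module.finrank A (weightedHomogeneousSubmodule A w m) : ℤ) - Module.finrank A (grP w P m)

def HomogI (P : Ideal (MvPolynomial ι A)) : Prop :=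
  ∀ f ∈ P, ∀ m, weightedHomogeneousComponent w m f ∈ P

variable {w}

lemma comp_mul {s y : MvPolynomial ι A} {n m : Fin k → ℕ} (hs : IsWeightedHomogeneous w s n) :
    weightedHomogeneousComponent w (n + m) (s * y) = s * weightedHomogeneousComponent w m y := by
  classical
  conv_lhs => rw [← sum_weightedHomogeneousComponent w y]
  rw [finsum_eq_sum _ (weightedHomogeneousComponent_finsupp y), Finset.mul_sum, map_sum]
  rw [Finset.sum_eq_single m]
  · apply IsWeightedHomogeneous.weightedHomogeneousComponent_same
    exact hs.mul (weightedHomogeneousComponent_isWeightedHomogeneous _ _)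
  · intro b _ hb
    apply IsWeightedHomogeneous.weightedHomogeneousComponent_ne (m := n + b)
    · exact hs.mul (weightedHomogeneousComponent_isWeightedHomogeneous _ _)
    · intro h; exact hb (add_left_cancel h).symm
  · intro h
    have h' : weightedHomogeneousComponent w m y = 0 := by
      by_contra h2
      exact h ((Set.Finite.mem_toFinset _).2 h2)
    rw [h']; simp

lemma comp_mul' {s y : MvPolynomial ι A} {n m : Fin k → ℕ} (hs : IsWeightedHomogeneous w s n)
    (h : ¬ n ≤ m) :
    weightedHomogeneousComponent w m (y * s) = 0 := by
  classical
  conv_lhs => rw [← sum_weightedHomogeneousComponent w y]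
  rw [finsum_eq_sum _ (weightedHomogeneousComponent_finsupp y), Finset.sum_mul, map_sum]
  apply Finset.sum_eq_zero
  intro b _
  apply IsWeightedHomogeneous.weightedHomogeneousComponent_ne (m := b + n)
  · exact (weightedHomogeneousComponent_isWeightedHomogeneous _ _).mul hs
  · rintro rfl; exact h le_add_self

/-- existence of finitely many homogeneous generators. -/
lemma exists_homog_gens {P : Ideal (MvPolynomial ι A)} (hP : HomogI w P) :
    ∃ S : Finset (MvPolynomial ι A), (∀ f ∈ S, f ∈ P ∧ ∃ n, IsWeightedHomogeneous w f n) ∧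
      Ideal.span (S : Set (MvPolynomial ι A)) = P := by
  classical
  obtain ⟨S0, hS0⟩ := (inferInstance : IsNoetherian (MvPolynomial ι A) (MvPolynomial ι A)).noetherian P
  let S := S0.biUnion fun f => (weightedHomogeneousComponent_finsupp (w := w) f).toFinset.image
    (fun m => weightedHomogeneousComponent w m f)
  have hS0P : ∀ f ∈ S0, f ∈ P := fun f hf => hS0 ▸ Submodule.subset_span hf
  refine ⟨S, ?_, ?_⟩
  · intro g hg
    simp only [S, Finset.mem_biUnion, Finset.mem_image] at hg
    obtain ⟨f, hf, m, _, rfl⟩ := hg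
    exact ⟨hP f (hS0P f hf) m, m, weightedHomogeneousComponent_isWeightedHomogeneous _ _⟩
  · apply le_antisymm
    · rw [Ideal.span_le]
      intro g hg
      simp only [S, Finset.coe_biUnion, Set.mem_iUnion, Finset.mem_coe, Finset.mem_image] at hg
      obtain ⟨f, hf, m, _, rfl⟩ := hg
      exact hP f (hS0P f hf) m
    · conv_lhs => rw [← hS0]
      rw [Submodule.span_le]
      intro f hf
      rw [← sum_weightedHomogeneousComponent w f, finsum_eq_sum _ (weightedHomogeneousComponent_finsupp f)]
      apply Ideal.sum_mem
      intro m hm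
      apply Ideal.subset_span
      simp only [S, Finset.coe_biUnion, Set.mem_iUnion, Finset.mem_coe, Finset.mem_image]
      exact ⟨f, hf, m, hm, rfl⟩

theorem hilb_step (hW : ∀ m, Module.Finite A (weightedHomogeneousSubmodule A w m))
    {P P' : Ideal (MvPolynomial ι A)} (hPP : P ≤ P') [P.IsPrime] (hP : HomogI w P) (hP' : HomogI w P')
    {s t : MvPolynomial ι A} {ds dt : Fin k → ℕ}
    (hs : IsWeightedHomogeneous w s ds) (ht : IsWeightedHomogeneous w t dt)
    (hsP : s ∉ P) (htP : t ∉ P)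
    (hA : ∀ f ∈ P', ∃ M : Fin k → ℕ, ∀ n ≥ M, ∀ y, IsWeightedHomogeneous w y n →
      ∃ z, y * (s * f) - t * z ∈ P)
    (hB : ∃ M : Fin k → ℕ, ∀ n ≥ M, ∀ y, IsWeightedHomogeneous w y n →
      ∃ z ∈ P', y * t - s * z ∈ P) :
    ∃ M : Fin k → ℕ, ∀ n ≥ M, hilb w P (n + dt) = hilb w P' (n + dt) + hilb w P (n + ds) := by
  classical
  obtain ⟨S, hS, hSP⟩ := exists_homog_gens hP'
  have hA' : ∃ M : Fin k → ℕ, ∀ n ≥ M, ∀ f ∈ grP w P' n, ∃ z, s * f - t * z ∈ P := by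
    have h1 : ∀ f : MvPolynomial ι A, ∃ M : Fin k → ℕ, f ∈ S → ∃ n, IsWeightedHomogeneous w f n ∧ n ≤ M ∧
        ∀ m, n + m ≥ M → ∀ y, IsWeightedHomogeneous w y m → ∃ z, s * (y * f) - t * z ∈ P := by
      intro f
      by_cases hf : f ∈ S
      · obtain ⟨hfP, n, hn⟩ := hS f hf
        obtain ⟨M, hM⟩ := hA f hfP
        refine ⟨n + M, fun _ => ⟨n, hn, le_self_add, fun m hm y hy => ?_⟩⟩
        obtain ⟨z, hz⟩ := hM m (le_of_add_le_add_left hm) y hy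
        exact ⟨z, by convert hz using 2; ring⟩
      · exact ⟨0, fun h => absurd h hf⟩
    choose M hM using h1
    refine ⟨∑ f ∈ S, M f, fun N hN f hf => ?_⟩
    have hf1 : f ∈ Ideal.span (S : Set (MvPolynomial ι A)) := by rw [hSP]; exact hf.1
    rw [Submodule.mem_span_finset] at hf1
    obtain ⟨c, -, hc⟩ := hf1
    have hf2 : f = ∑ a ∈ S, weightedHomogeneousComponent w N (c a * a) := by
      rw [← map_sum]
      have := hf.2
      rw [SetLike.mem_coe, mem_weightedHomogeneousSubmodule] at this
      rw [← this.weightedHomogeneousComponent_same, ← hc]; simp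
    have h3 : ∀ a, ∃ z, a ∈ S → s * (weightedHomogeneousComponent w N (c a * a)) - t * z ∈ P := by
      intro a
      by_cases ha : a ∈ S
      · obtain ⟨n, hn, hnM, h4⟩ := hM a ha
        have hMN : M a ≤ N := (Finset.single_le_sum (fun _ _ => zero_le) ha).trans hN
        obtain ⟨m, rfl⟩ := le_iff_exists_add.1 (hnM.trans hMN)
        obtain ⟨z, hz⟩ := h4 m hMN (weightedHomogeneousComponent w m (c a))
          (weightedHomogeneousComponent_isWeightedHomogeneous _ _)
        refine ⟨z, fun _ => ?_⟩
        rw [mul_comm (c a), comp_mul hn, mul_comm a]; exact hz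
      · exact ⟨0, fun h => absurd h ha⟩
    choose z hz using h3
    refine ⟨∑ a ∈ S, z a, ?_⟩
    conv in s * f => rw [hf2]
    rw [Finset.mul_sum, Finset.mul_sum, ← Finset.sum_sub_distrib]
    exact Ideal.sum_mem _ fun a ha => hz a ha
  obtain ⟨M1, hM1⟩ := hA'
  obtain ⟨M2, hM2⟩ := hB
  refine ⟨M1 + M2, fun n hn => ?_⟩
  have hn1 : n + dt ≥ M1 := (le_self_add.trans hn).trans le_self_add
  have hn2 : n + ds ≥ M2 := (le_add_self.trans hn).trans le_self_add
  let π : MvPolynomial ι A →ₗ[A] (MvPolynomial ι A ⧸ P) := (Ideal.Quotient.mkₐ A P).toLinearMap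
  let fs : MvPolynomial ι A →ₗ[A] (MvPolynomial ι A ⧸ P) := π ∘ₗ LinearMap.mulLeft A s
  let ft : MvPolynomial ι A →ₗ[A] (MvPolynomial ι A ⧸ P) := π ∘ₗ LinearMap.mulLeft A t
  have hfs : ∀ x, fs x = Ideal.Quotient.mk P (s * x) := fun x => rfl
  have hft : ∀ x, ft x = Ideal.Quotient.mk P (t * x) := fun x => rfl
  have hker : ∀ u (f : MvPolynomial ι A →ₗ[A] (MvPolynomial ι A ⧸ P)),
      (∀ x, f x = Ideal.Quotient.mk P (u * x)) → u ∉ P → LinearMap.ker f = P.restrictScalars A := by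
    intro u f hf hu
    ext x
    rw [LinearMap.mem_ker, hf, Ideal.Quotient.eq_zero_iff_mem, Submodule.restrictScalars_mem]
    exact ⟨fun h => (Ideal.IsPrime.mem_or_mem ‹_› h).resolve_left hu, fun h => P.mul_mem_left _ h⟩
  have hmap : (grP w P' (n + dt)).map fs = (weightedHomogeneousSubmodule A w (n + ds)).map ft := by
    apply le_antisymm
    · rintro _ ⟨f, hf, rfl⟩
      obtain ⟨z, hz⟩ := hM1 _ hn1 f hf
      refine ⟨weightedHomogeneousComponent w (n + ds) z, weightedHomogeneousComponent_mem _ _ _, ?_⟩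
      rw [hfs, hft, eq_comm, Ideal.Quotient.eq]
      have h5 := hP _ hz (ds + (n + dt))
      have h6 := hf.2
      rw [SetLike.mem_coe, mem_weightedHomogeneousSubmodule] at h6
      rw [map_sub, comp_mul hs, h6.weightedHomogeneousComponent_same,
        show ds + (n + dt) = dt + (n + ds) by abel, comp_mul ht] at h5
      exact h5
    · rintro _ ⟨y, hy, rfl⟩
      obtain ⟨z, hz, hzP⟩ := hM2 _ hn2 y hy
      refine ⟨weightedHomogeneousComponent w (n + dt) z, ⟨hP' z hz _,
        weightedHomogeneousComponent_mem _ _ _⟩, ?_⟩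
      rw [hfs, hft, eq_comm, Ideal.Quotient.eq]
      have h5 := hP _ hzP (ds + (n + dt))
      rw [SetLike.mem_coe, mem_weightedHomogeneousSubmodule] at hy
      rw [map_sub, comp_mul hs, mul_comm y,
        show ds + (n + dt) = dt + (n + ds) by abel, comp_mul ht, hy.weightedHomogeneousComponent_same] at h5
      exact h5
  have hfin : ∀ (Q : Ideal (MvPolynomial ι A)) m, Module.Finite A (grP w Q m) := by
    intro Q m
    have := hW m
    have := isNoetherian_of_isNoetherianRing_of_finite A (weightedHomogeneousSubmodule A w m)
    have h7 : IsNoetherian A (grP w Q m) :=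
      isNoetherian_of_le (inf_le_right : grP w Q m ≤ weightedHomogeneousSubmodule A w m)
    exact Module.IsNoetherian.finite A _
  have := hfin P' (n + dt)
  have := hW (n + ds)
  have r1 := rk_map fs (grP w P' (n + dt))
  have r2 := rk_map ft (weightedHomogeneousSubmodule A w (n + ds))
  rw [hker s fs hfs hsP, hmap] at r1
  rw [hker t ft hft htP] at r2
  have e1 : grP w P' (n + dt) ⊓ P.restrictScalars A = grP w P (n + dt) := by
    unfold grP
    rw [inf_right_comm, inf_of_le_right (a := P'.restrictScalars A)]
    exact hPP
  have e2 : weightedHomogeneousSubmodule A w (n + ds) ⊓ P.restrictScalars A = grP w P (n + ds) := by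
    unfold grP
    rw [inf_comm]
  rw [e1] at r1
  rw [e2] at r2
  unfold hilb
  omega
end Step
end TT
end Mod1

section Mod2
namespace TT
open MvPolynomial

lemma nonDom {α β : Type} [Fintype α] [Fintype β] (n : α → MvPolynomial β ℂ)
    (h : Fintype.card β < Fintype.card α) :
    ∃ Q : MvPolynomial α ℂ, Q ≠ 0 ∧ ∀ z : β → ℂ, eval (fun i => eval z (n i)) Q = 0 := by
  have h1 : ¬ AlgebraicIndependent ℂ n := by
    intro hn
    have := hn.cardinalMk_le_trdeg
    rw [MvPolynomial.trdeg_of_isDomain] at this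
    simp only [Cardinal.mk_fintype, Cardinal.lift_natCast, Nat.cast_le] at this
    omega
  rw [algebraicIndependent_iff] at h1
  push Not at h1
  obtain ⟨Q, hQ, hQ0⟩ := h1
  refine ⟨Q, hQ0, fun z => ?_⟩
  have := congrArg (eval z) hQ
  rw [map_zero] at this
  rw [← this]
  rw [← MvPolynomial.coe_aeval_eq_eval, ← MvPolynomial.coe_aeval_eq_eval]
  show _ = (MvPolynomial.aeval z) _
  rw [← AlgHom.comp_apply, MvPolynomial.comp_aeval]
  rfl

lemma exists_minor {E : Type} [Fintype E] {r : ℕ} (M : Matrix (Fin r) E ℂ)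
    (hM : Function.Surjective M.mulVec) :
    ∃ e : Fin r → E, Function.Injective e ∧ (M.submatrix id e).det ≠ 0 := by
  classical
  obtain ⟨κ, a, ha, hspan, hli⟩ := exists_linearIndependent' ℂ M.col
  have htop : Submodule.span ℂ (Set.range M.col) = ⊤ := by
    rw [← Matrix.range_mulVecLin, LinearMap.range_eq_top]
    exact hM
  rw [htop] at hspan
  let b := Module.Basis.mk hli hspan.ge
  have : Finite κ := Module.Finite.finite_basis b
  have : Fintype κ := Fintype.ofFinite κ
  have hc : Fintype.card κ = Fintype.card (Fin r) := by
    have := Module.finrank_eq_card_basis b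
    simp at this
    simp [this]
  let eq := Fintype.equivOfCardEq hc
  refine ⟨a ∘ eq.symm, ha.comp eq.symm.injective, ?_⟩
  have h2 : LinearIndependent ℂ (M.submatrix id (a ∘ eq.symm)).col := by
    exact (hli.comp eq.symm eq.symm.injective)
  rw [Matrix.linearIndependent_cols_iff_isUnit, Matrix.isUnit_iff_isUnit_det] at h2
  exact h2.ne_zero

lemma linNonDom {E Z : Type} [Fintype E] [Fintype Z] {r : ℕ} (M : Matrix (Fin r) E (MvPolynomial Z ℂ))
    (hr : Fintype.card Z + 1 < r) :
    ∃ Q : MvPolynomial (E ⊕ E) ℂ, Q ≠ 0 ∧ ∀ (F G : E → ℂ) (c : ℂ) (z : Z → ℂ),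
      Function.Surjective (M.map (eval z)).mulVec → (M.map (eval z)).mulVec (F + c • G) = 0 →
      eval (Sum.elim F G) Q = 0 := by
  classical
  have key : ∀ e : Fin r → E, ∃ Q : MvPolynomial (E ⊕ E) ℂ, Q ≠ 0 ∧ (Function.Injective e →
      ∀ (F G : E → ℂ) (c : ℂ) (z : Z → ℂ), ((M.map (eval z)).submatrix id e).det ≠ 0 →
      (M.map (eval z)).mulVec (F + c • G) = 0 → eval (Sum.elim F G) Q = 0) := by
    intro e
    by_cases he : Function.Injective e
    swap
    · exact ⟨1, one_ne_zero, fun h => absurd h he⟩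
    let β := (Z ⊕ Unit) ⊕ (E ⊕ {m // m ∉ Set.range e})
    let ρ : MvPolynomial Z ℂ →ₐ[ℂ] MvPolynomial β ℂ := rename (fun z => Sum.inl (Sum.inl z))
    let N : Matrix (Fin r) E (MvPolynomial β ℂ) := M.map ρ
    let D : MvPolynomial β ℂ := (N.submatrix id e).det
    let h : E → MvPolynomial β ℂ := fun m => if hm : m ∈ Set.range e then 0 else X (Sum.inr (Sum.inr ⟨m, hm⟩))
    let H : E → MvPolynomial β ℂ := fun m => if hm : m ∈ Set.range e then
      - ((N.submatrix id e).adjugate.mulVec (N.mulVec h)) hm.choose else D * h m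
    let g : E → MvPolynomial β ℂ := fun m => X (Sum.inr (Sum.inl m))
    let n : E ⊕ E → MvPolynomial β ℂ := Sum.elim (fun m => H m - X (Sum.inl (Sum.inr ())) * g m) g
    have hcard : Fintype.card β < Fintype.card (E ⊕ E) := by
      have h1 : Fintype.card {m // m ∉ Set.range e} = Fintype.card E - r := by
        rw [Fintype.card_subtype_compl]
        congr 1
        have := Fintype.card_congr (Equiv.ofInjective e he)
        rw [Fintype.card_fin] at this
        refine Eq.trans ?_ this.symm
        exact Fintype.card_congr (Equiv.refl _)
      have h2 : r ≤ Fintype.card E := by simpa using Fintype.card_le_of_injective e he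
      simp only [β, Fintype.card_sum, h1, Fintype.card_unit]
      omega
    obtain ⟨Q, hQ, hQz⟩ := nonDom n hcard
    refine ⟨Q, hQ, fun _ F G c z hdet hFG => ?_⟩
    set Mz := M.map (eval z) with hMz
    set Dz := (Mz.submatrix id e).det with hDz
    let pt : β → ℂ := Sum.elim (Sum.elim z (fun _ => c)) (Sum.elim G (fun m => (F m.1 + c * G m.1) / Dz))
    have hN : N.map (eval pt) = Mz := by
      ext i j
      simp only [N, ρ, Matrix.map_apply, hMz, eval_rename]
      rfl
    have hD : eval pt D = Dz := by
      simp only [D, hDz]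
      rw [RingHom.map_det, ← hN]
      rfl
    have hhm : ∀ m, m ∉ Set.range e → eval pt (h m) = (F m + c * G m) / Dz := by
      intro m hm
      simp only [h, hm, dif_neg, not_false_eq_true, eval_X, pt, Sum.elim_inr]
    have hh0 : ∀ m, m ∈ Set.range e → eval pt (h m) = 0 := by
      intro m hm
      simp only [h, hm, dif_pos, map_zero]
    have hH : ∀ m, eval pt (H m) = F m + c * G m := by
      intro m
      by_cases hm : m ∈ Set.range e
      · simp only [H, hm, dif_pos]
        set i := hm.choose with hi
        have him : e i = m := hm.choose_spec
        have e1 : eval pt ((N.submatrix id e).adjugate.mulVec (N.mulVec h) i) =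
            ((Mz.submatrix id e).adjugate.mulVec (Mz.mulVec (fun m => eval pt (h m)))) i := by
          rw [← hN]
          have a1 := RingHom.map_mulVec (eval pt) (N.submatrix id e).adjugate (N.mulVec h) i
          rw [a1]
          have a2 : (N.submatrix id e).adjugate.map (eval pt) =
              ((N.map (eval pt)).submatrix id e).adjugate := by
            rw [← RingHom.mapMatrix_apply, RingHom.map_adjugate]; rfl
          have a3 : (eval pt) ∘ N.mulVec h = (N.map (eval pt)).mulVec fun m => eval pt (h m) := by
            ext k; exact RingHom.map_mulVec (eval pt) N h k
          rw [a2, a3]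
        rw [map_neg, e1]
        have e2 : Mz.mulVec (fun m => eval pt (h m)) =
            - (1 / Dz) • (Mz.submatrix id e).mulVec (fun k => F (e k) + c * G (e k)) := by
          ext k
          have e3 := congrFun hFG k
          simp only [Matrix.mulVec, dotProduct, Pi.zero_apply, Pi.add_apply, Pi.smul_apply, smul_eq_mul] at e3
          simp only [Matrix.mulVec, dotProduct, Pi.smul_apply, Matrix.submatrix_apply, id, smul_eq_mul]
          have e4 : ∑ x, Mz k (e x) * (F (e x) + c * G (e x)) =
              ∑ m ∈ Finset.univ.filter (fun m => m ∈ Set.range e), Mz k m * (F m + c * G m) := by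
            rw [← Finset.sum_image (s := Finset.univ) (g := e) (f := fun m => Mz k m * (F m + c * G m))
              (fun a _ b _ h => he h)]
            apply Finset.sum_congr _ (fun _ _ => rfl)
            ext m; simp
          have e5 : ∑ m, Mz k m * eval pt (h m) =
              ∑ m ∈ Finset.univ.filter (fun m => ¬ m ∈ Set.range e), Mz k m * ((F m + c * G m) / Dz) := by
            rw [← Finset.sum_filter_add_sum_filter_not Finset.univ (fun m => m ∈ Set.range e)
              (fun m => Mz k m * eval pt (h m))]
            rw [Finset.sum_eq_zero, zero_add]
            · apply Finset.sum_congr rfl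
              intro m hm
              rw [hhm m (Finset.mem_filter.1 hm).2]
            · intro m hm
              rw [hh0 m (Finset.mem_filter.1 hm).2, mul_zero]
          rw [e4, e5]
          rw [← Finset.sum_filter_add_sum_filter_not Finset.univ (fun m => m ∈ Set.range e)] at e3
          have e6 : ∑ m ∈ Finset.univ.filter (fun m => ¬ m ∈ Set.range e), Mz k m * ((F m + c * G m) / Dz) =
            (1 / Dz) * ∑ m ∈ Finset.univ.filter (fun m => ¬ m ∈ Set.range e), Mz k m * (F m + c * G m) := by
            rw [Finset.mul_sum]
            apply Finset.sum_congr rfl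
            intros; ring
          rw [e6]
          linear_combination (1 / Dz) * e3
        rw [e2, Matrix.mulVec_smul, Matrix.mulVec_mulVec, Matrix.adjugate_mul, Matrix.smul_mulVec,
          Matrix.one_mulVec, ← hDz]
        simp only [Pi.smul_apply, smul_eq_mul, him]
        field_simp
      · simp only [H, hm, dif_neg, not_false_eq_true, map_mul, hD, hhm]
        field_simp
    have hfin : (fun i => eval pt (n i)) = Sum.elim F G := by
      ext i
      rcases i with m | m
      · simp only [n, Sum.elim_inl, map_sub, map_mul, hH, eval_X, g, pt, Sum.elim_inr]
        ring
      · simp only [n, Sum.elim_inr, g, eval_X, pt, Sum.elim_inl]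
    rw [← hfin]
    exact hQz pt
  choose Q hQ0 hQ using key
  refine ⟨∏ e, Q e, Finset.prod_ne_zero_iff.2 fun e _ => hQ0 e, fun F G c z hs h0 => ?_⟩
  obtain ⟨e, he, hdet⟩ := exists_minor _ hs
  rw [map_prod]
  exact Finset.prod_eq_zero (Finset.mem_univ e) (hQ e he F G c z hdet h0)
end TT
end Mod2

section Mod3
namespace TT
open Polynomial

lemma clear_den {A K : Type} [CommRing A] [IsDomain A] [Field K] [Algebra A K] [IsFractionRing A K]
    (f : K[X]) : ∃ a : A, a ≠ 0 ∧ ∃ g : A[X], g.map (algebraMap A K) = C (algebraMap A K a) * f := by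
  obtain ⟨b, hb0, hb⟩ := IsLocalization.integerNormalization_spec (nonZeroDivisors A) f
  refine ⟨b, nonZeroDivisors.ne_zero hb0, _, hb.trans ?_⟩
  rw [← Polynomial.smul_eq_C_mul]
  ext i
  simp [Algebra.smul_def]

lemma isAlg_of_finrank {A B : Type} [CommRing A] [IsDomain A] [CommRing B] [IsDomain B] [Algebra A B]
    (h0 : 0 < Module.finrank A B) : Algebra.IsAlgebraic A B := by
  constructor
  intro b
  by_contra hb
  have hli : LinearIndependent A (fun i : ℕ => b ^ i) := by
    have h1 := (Polynomial.basisMonomials A).linearIndependent.map' (aeval b).toLinearMap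
      (LinearMap.ker_eq_bot.mpr (transcendental_iff_injective.mp hb))
    have h2 : (fun i : ℕ => b ^ i) = (aeval b).toLinearMap ∘ (Polynomial.basisMonomials A) := by
      ext i
      simp
    rw [h2]
    exact h1
  have := hli.aleph0_le_rank
  have h3 : Module.finrank A B = 0 := by
    rw [Module.finrank, Cardinal.toNat_eq_zero]; exact Or.inr this
  omega

lemma S1 {A B : Type} [CommRing A] [IsDomain A] [CharZero A] [CommRing B] [IsDomain B] [Algebra A B]
    [FaithfulSMul A B] {n : ℕ} (hn : Module.finrank A B = n) (h0 : 0 < n) :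
    (∀ b : B, b ≠ 0 → ∃ a : A, a ≠ 0 ∧ b ∣ algebraMap A B a) ∧
    ∃ θ : B, ∃ M : A[X], M.natDegree = n ∧ M ≠ 0 ∧ aeval θ M = 0 ∧
      (∀ f : A[X], aeval θ f = 0 → ∃ a : A, a ≠ 0 ∧ M ∣ C a * f) ∧
      (∀ b : B, ∃ a : A, a ≠ 0 ∧ ∃ G : A[X], aeval θ G = algebraMap A B a * b) ∧
      ∃ a : A, a ≠ 0 ∧ ∃ α β : A[X], α * M + β * derivative M = C a := by
  have halg : Algebra.IsAlgebraic A B := isAlg_of_finrank (by omega)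
  have hdvd : ∀ b : B, b ≠ 0 → ∃ a : A, a ≠ 0 ∧ b ∣ algebraMap A B a := fun b hb =>
    (Algebra.IsAlgebraic.isAlgebraic b).exists_nonzero_dvd (mem_nonZeroDivisors_of_ne_zero hb)
  refine ⟨hdvd, ?_⟩
  let K := FractionRing A
  let L := FractionRing B
  let _ : Algebra K L := FractionRing.liftAlgebra A L
  have := FractionRing.isScalarTower_liftAlgebra A L
  have hfr : Module.finrank K L = n := by
    rw [IsFractionRing.finrank_eq A K B L, hn]
  have : FiniteDimensional K L := FiniteDimensional.of_finrank_pos (by omega)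
  have : CharZero K := by
    exact charZero_of_injective_algebraMap (IsFractionRing.injective A K)
  have hKi := IsFractionRing.injective A K
  have hLi := IsFractionRing.injective B L
  have hAB : ∀ a : A, algebraMap K L (algebraMap A K a) = algebraMap B L (algebraMap A B a) := by
    intro a
    rw [← IsScalarTower.algebraMap_apply, ← IsScalarTower.algebraMap_apply]
  obtain ⟨ε, hε⟩ := Field.exists_primitive_element K L
  obtain ⟨θ, a0, ha0, hθ⟩ : ∃ θ : B, ∃ a : A, a ≠ 0 ∧ algebraMap B L θ = algebraMap K L (algebraMap A K a) * ε := by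
    obtain ⟨x, y, hy, hxy⟩ := IsFractionRing.div_surjective (A := B) ε
    obtain ⟨a, ha, y', hy'⟩ := hdvd y (nonZeroDivisors.ne_zero hy)
    refine ⟨x * y', a, ha, ?_⟩
    rw [hAB, hy', ← hxy]
    have : algebraMap B L y ≠ 0 := by
      simpa using nonZeroDivisors.ne_zero hy
    rw [map_mul, map_mul, mul_comm, mul_assoc, mul_left_comm, mul_div_cancel₀ _ this, mul_comm]
  have hprim : IntermediateField.adjoin K {algebraMap B L θ} = ⊤ := by
    rw [eq_top_iff, ← hε, IntermediateField.adjoin_simple_le_iff]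
    have h1 := IntermediateField.mem_adjoin_simple_self K (algebraMap B L θ)
    have h2 : ε = algebraMap K L (algebraMap A K a0)⁻¹ * algebraMap B L θ := by
      have : algebraMap K L (algebraMap A K a0) ≠ 0 := by simpa using ha0
      rw [hθ, map_inv₀, inv_mul_cancel_left₀ this]
    rw [h2]
    exact mul_mem (IntermediateField.algebraMap_mem _ _) h1
  set t := algebraMap B L θ with ht
  set μ := minpoly K t
  have hInt : IsIntegral K t := Algebra.IsIntegral.isIntegral t
  have hdeg : μ.natDegree = n := by
    rw [← hfr]; exact (Field.primitive_element_iff_minpoly_natDegree_eq K t).mp hprim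
  obtain ⟨m, hm, M, hM⟩ := clear_den (A := A) μ
  have hmK : algebraMap A K m ≠ 0 := by simpa using hm
  have haev : ∀ f : A[X], algebraMap B L (aeval θ f) = aeval t (f.map (algebraMap A K)) := by
    intro f
    rw [ht, Polynomial.aeval_map_algebraMap, Polynomial.aeval_algebraMap_apply]
  have hmapinj := Polynomial.map_injective (algebraMap A K) hKi
  refine ⟨θ, M, ?_, ?_, ?_, ?_, ?_, ?_⟩
  · rw [← Polynomial.natDegree_map_eq_of_injective hKi, hM, Polynomial.natDegree_C_mul hmK, hdeg]
  · rintro rfl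
    simp at hM
    rcases hM with h | h
    · exact hm h
    · exact minpoly.ne_zero hInt h
  · apply hLi
    rw [haev, hM, map_mul, minpoly.aeval]; simp
  · intro f hf
    have h1 : aeval t (f.map (algebraMap A K)) = 0 := by rw [← haev, hf, map_zero]
    obtain ⟨h, hh⟩ := minpoly.dvd K t h1
    obtain ⟨c, hc, h', hh'⟩ := clear_den (A := A) h
    refine ⟨m * c, mul_ne_zero hm hc, h', hmapinj ?_⟩
    rw [Polynomial.map_mul, Polynomial.map_mul, hM, hh', hh, Polynomial.map_C, map_mul, map_mul]
    ring
  · intro b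
    have : algebraMap B L b ∈ (IntermediateField.adjoin K {t}).toSubalgebra := by rw [hprim]; trivial
    rw [IntermediateField.adjoin_simple_toSubalgebra_of_isAlgebraic hInt.isAlgebraic,
      Algebra.adjoin_singleton_eq_range_aeval] at this
    obtain ⟨f, hf⟩ := this
    obtain ⟨c, hc, G, hG⟩ := clear_den (A := A) f
    refine ⟨c, hc, G, hLi ?_⟩
    have hf' : aeval t f = algebraMap B L b := hf
    rw [haev, hG, map_mul, map_mul, hf', Polynomial.aeval_C, hAB]
  · have hsep : μ.Separable := (minpoly.irreducible hInt).separable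
    obtain ⟨α, β, hαβ⟩ := hsep
    obtain ⟨a, ha, α', hα⟩ := clear_den (A := A) α
    obtain ⟨b, hb, β', hβ⟩ := clear_den (A := A) β
    refine ⟨m * a * b, by simp [hm, ha, hb], C b * α', C a * β', hmapinj ?_⟩
    simp only [Polynomial.map_add, Polynomial.map_mul, hα, hβ, hM, ← Polynomial.derivative_map,
      Polynomial.map_C, map_mul, Polynomial.derivative_C_mul]
    linear_combination (C (algebraMap A K m) * C (algebraMap A K a) * C (algebraMap A K b)) * hαβ

/-- Generic fibres of a generically finite polynomial map. -/
theorem spread {σ κ : Type} [Finite σ] [Finite κ]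
    (η : MvPolynomial σ ℂ →ₐ[ℂ] MvPolynomial κ ℂ) (hinj : Function.Injective η) {n : ℕ} (h0 : 0 < n)
    (hn : @Module.finrank (MvPolynomial σ ℂ) (MvPolynomial κ ℂ) _ _ η.toRingHom.toModule = n)
    (D : MvPolynomial κ ℂ) (hD : D ≠ 0) :
    ∃ Q : MvPolynomial σ ℂ, Q ≠ 0 ∧ ∀ τ : σ → ℂ, MvPolynomial.eval τ Q ≠ 0 →
      {z : κ → ℂ | ∀ s, MvPolynomial.eval z (η (MvPolynomial.X s)) = τ s}.Finite ∧
      {z : κ → ℂ | ∀ s, MvPolynomial.eval z (η (MvPolynomial.X s)) = τ s}.ncard = n ∧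
      ∀ z : κ → ℂ, (∀ s, MvPolynomial.eval z (η (MvPolynomial.X s)) = τ s) →
        MvPolynomial.eval z D ≠ 0 := by
  classical
  cases nonempty_fintype σ
  cases nonempty_fintype κ
  let _ : Algebra (MvPolynomial σ ℂ) (MvPolynomial κ ℂ) := η.toRingHom.toAlgebra
  have hη : ∀ a, algebraMap (MvPolynomial σ ℂ) (MvPolynomial κ ℂ) a = η a := fun a => rfl
  have : FaithfulSMul (MvPolynomial σ ℂ) (MvPolynomial κ ℂ) :=
    (faithfulSMul_iff_algebraMap_injective _ _).mpr hinj
  obtain ⟨hdvd, θ, M, hMn, hM0, hMθ, hMf, hG, e, he, α, β, hαβ⟩ :=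
    S1 (A := MvPolynomial σ ℂ) (B := MvPolynomial κ ℂ) hn h0
  obtain ⟨q1, hq1, D', hD'⟩ := hdvd D hD
  choose ai hai Gi hGi using fun i : κ => hG (MvPolynomial.X i)
  let a := ∏ i, ai i
  have ha : a ≠ 0 := Finset.prod_ne_zero_iff.mpr fun i _ => hai i
  -- numerators over the common denominator
  have hGc : ∀ i, ∃ G : (MvPolynomial σ ℂ)[X], aeval θ G = η a * MvPolynomial.X i := by
    intro i
    refine ⟨C (∏ j ∈ Finset.univ.erase i, ai j) * Gi i, ?_⟩
    rw [map_mul, hGi, Polynomial.aeval_C, hη, hη, ← mul_assoc, ← map_mul, mul_comm (∏ j ∈ _, _),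
      Finset.mul_prod_erase _ _ (Finset.mem_univ i)]
  choose G hG' using hGc
  -- evaluation of A-polynomials at (τ, ρ)
  let ev : (σ → ℂ) → ℂ → (MvPolynomial σ ℂ)[X] →+* ℂ := fun τ ρ =>
    Polynomial.eval₂RingHom (MvPolynomial.eval τ) ρ
  have hhom : ∀ b : MvPolynomial κ ℂ, ∃ N : ℕ, ∃ H : (MvPolynomial σ ℂ)[X],
      aeval θ H = η a ^ N * b ∧ ∀ τ ρ (z : κ → ℂ), (∀ i, ev τ ρ (G i) = MvPolynomial.eval τ a * z i) →
        ev τ ρ H = MvPolynomial.eval τ a ^ N * MvPolynomial.eval z b := by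
    intro b
    induction b using MvPolynomial.induction_on with
    | C c =>
      refine ⟨0, C (MvPolynomial.C c), ?_, ?_⟩
      · rw [Polynomial.aeval_C, hη]; simp [MvPolynomial.algHom_C, ← MvPolynomial.algebraMap_eq]
      · intro τ ρ z hz
        simp [ev]
    | add p q hp hq =>
      obtain ⟨N, H, h1, h2⟩ := hp
      obtain ⟨N', H', h1', h2'⟩ := hq
      refine ⟨N + N', C a ^ N' * H + C a ^ N * H', ?_, ?_⟩
      · simp only [map_add, map_mul, map_pow, h1, h1', Polynomial.aeval_C, hη]; ring
      · intro τ ρ z hz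
        have : ev τ ρ (C a) = MvPolynomial.eval τ a := by simp [ev]
        simp only [map_add, map_mul, map_pow, h2 τ ρ z hz, h2' τ ρ z hz, this]; ring
    | mul_X p i hp =>
      obtain ⟨N, H, h1, h2⟩ := hp
      refine ⟨N + 1, H * G i, ?_, ?_⟩
      · rw [map_mul, h1, hG']; ring
      · intro τ ρ z hz
        rw [map_mul, h2 τ ρ z hz, hz, map_mul, MvPolynomial.eval_X]; ring
  -- relation at roots
  have hrel : ∀ b b' : MvPolynomial κ ℂ, ∀ g : (MvPolynomial σ ℂ)[X], aeval θ g = b →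
      ∃ q : MvPolynomial σ ℂ, q ≠ 0 ∧ ∀ τ ρ (z : κ → ℂ), MvPolynomial.eval τ q ≠ 0 → ev τ ρ M = 0 →
        (∀ i, ev τ ρ (G i) = MvPolynomial.eval τ a * z i) → MvPolynomial.eval z b = ev τ ρ g := by
    intro b _ g hg
    obtain ⟨N, H, h1, h2⟩ := hhom b
    obtain ⟨q, hq, k, hk⟩ := hMf (H - C a ^ N * g) (by
      rw [map_sub, map_mul, map_pow, h1, hg, Polynomial.aeval_C, hη, sub_self])
    refine ⟨q * a, mul_ne_zero hq ha, fun τ ρ z hqτ hM hz => ?_⟩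
    rw [map_mul] at hqτ
    have h3 := congrArg (ev τ ρ) hk
    have hC : ∀ x, ev τ ρ (C x) = MvPolynomial.eval τ x := by intro x; simp [ev]
    rw [map_mul, map_mul, hM, zero_mul, hC, map_sub, map_mul, map_pow, hC, h2 τ ρ z hz, ← mul_sub] at h3
    have h4 := (mul_eq_zero.mp h3).resolve_left (left_ne_zero_of_mul hqτ)
    have h5 := (mul_eq_zero.mp h4).resolve_left (pow_ne_zero _ (right_ne_zero_of_mul hqτ))
    exact sub_eq_zero.mp h5
  choose qk hqk hrelk using fun k : σ => hrel (η (MvPolynomial.X k)) 0 (C (MvPolynomial.X k))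
    (by rw [Polynomial.aeval_C, hη])
  obtain ⟨qθ, hqθ, hrelθ⟩ := hrel θ 0 Polynomial.X (Polynomial.aeval_X θ)
  refine ⟨q1 * a * (∏ k, qk k) * qθ * e * M.leadingCoeff, ?_, ?_⟩
  · have : ∏ k, qk k ≠ 0 := Finset.prod_ne_zero_iff.mpr fun i _ => hqk i
    have := Polynomial.leadingCoeff_ne_zero.mpr hM0
    simp only [ne_eq, mul_eq_zero, not_or]
    tauto
  intro τ hτ
  simp only [map_mul, map_prod, ne_eq, mul_eq_zero, not_or, Finset.prod_eq_zero_iff, not_exists,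
    not_and] at hτ
  obtain ⟨⟨⟨⟨⟨hτ1, hτa⟩, hτk⟩, hτθ⟩, hτe⟩, hτM⟩ := hτ
  let Mτ : ℂ[X] := M.map (MvPolynomial.eval τ)
  have hevM : ∀ ρ, ev τ ρ M = Mτ.eval ρ := fun ρ => by simp [ev, Mτ, Polynomial.eval_map]
  have hMτd : Mτ.natDegree = n := by
    rw [← hMn]; exact Polynomial.natDegree_map_of_leadingCoeff_ne_zero _ hτM
  have hMτ0 : Mτ ≠ 0 := by rintro h; rw [h] at hMτd; simp at hMτd; omega
  have hsep : Mτ.Separable := by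
    refine ⟨C ((MvPolynomial.eval τ e)⁻¹) * α.map (MvPolynomial.eval τ),
      C ((MvPolynomial.eval τ e)⁻¹) * β.map (MvPolynomial.eval τ), ?_⟩
    have h := congrArg (Polynomial.map (MvPolynomial.eval τ)) hαβ
    simp only [Polynomial.map_add, Polynomial.map_mul, Polynomial.map_C, ← Polynomial.derivative_map] at h
    rw [mul_assoc, mul_assoc, ← mul_add, h, ← C_mul, inv_mul_cancel₀ hτe, C_1]
  have hcard : Mτ.roots.toFinset.card = n := by
    rw [Multiset.toFinset_card_of_nodup (Polynomial.nodup_roots hsep),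
      ← (IsAlgClosed.splits Mτ).natDegree_eq_card_roots, hMτd]
  -- a fibre point gives a hom
  have hfib : ∀ z : κ → ℂ, (∀ s, MvPolynomial.eval z (η (MvPolynomial.X s)) = τ s) →
      (∀ x, MvPolynomial.eval z (η x) = MvPolynomial.eval τ x) ∧
      ∀ g : (MvPolynomial σ ℂ)[X], ev τ (MvPolynomial.eval z θ) g = MvPolynomial.eval z (aeval θ g) := by
    intro z hz
    have h1 : ∀ x, MvPolynomial.eval z (η x) = MvPolynomial.eval τ x := by
      intro x
      have : ((MvPolynomial.aeval z : MvPolynomial κ ℂ →ₐ[ℂ] ℂ).comp η) = MvPolynomial.aeval τ := by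
        apply MvPolynomial.algHom_ext
        intro i
        simpa [MvPolynomial.aeval_eq_eval] using hz i
      simpa [MvPolynomial.aeval_eq_eval] using congrArg (fun f => f x) this
    refine ⟨h1, fun g => ?_⟩
    simp only [ev, Polynomial.coe_eval₂RingHom, Polynomial.aeval_def]
    rw [Polynomial.hom_eval₂]
    congr 1
    ext x
    · simp [hη]
    · simp [hη, hz]
  have hbij : Set.BijOn (fun z => MvPolynomial.eval z θ)
      {z : κ → ℂ | ∀ s, MvPolynomial.eval z (η (MvPolynomial.X s)) = τ s} (Mτ.roots.toFinset : Set ℂ) := by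
    refine ⟨?_, ?_, ?_⟩
    · intro z hz
      simp only [Finset.mem_coe, Multiset.mem_toFinset, Polynomial.mem_roots hMτ0, Polynomial.IsRoot]
      rw [← hevM, (hfib z hz).2, hMθ, map_zero]
    · intro z hz z' hz' hzz
      simp only at hzz
      funext i
      have e1 := (hfib z hz).2 (G i)
      have e2 := (hfib z' hz').2 (G i)
      rw [hG', map_mul, MvPolynomial.eval_X, (hfib _ ‹_›).1] at e1 e2
      rw [hzz, e2] at e1
      exact (mul_left_cancel₀ hτa e1).symm
    · intro ρ hρ
      simp only [Finset.mem_coe, Multiset.mem_toFinset, Polynomial.mem_roots hMτ0, Polynomial.IsRoot] at hρ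
      rw [← hevM] at hρ
      let z : κ → ℂ := fun i => (MvPolynomial.eval τ a)⁻¹ * ev τ ρ (G i)
      have hz : ∀ i, ev τ ρ (G i) = MvPolynomial.eval τ a * z i := fun i => by
        simp only [z]; rw [mul_inv_cancel_left₀ hτa]
      refine ⟨z, fun s => ?_, ?_⟩
      · rw [hrelk s τ ρ z (hτk s (Finset.mem_univ s)) hρ hz]; simp [ev]
      · simp only
        rw [hrelθ τ ρ z hτθ hρ hz]; simp [ev]
  refine ⟨?_, ?_, ?_⟩
  · exact hbij.finite_iff_finite.mpr (Finset.finite_toSet _)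
  · rw [← hcard, ← Set.ncard_coe_finset, ← hbij.image_eq, hbij.injOn.ncard_image]
  · intro z hz h
    have := (hfib z hz).1 q1
    rw [← hη, hD', map_mul, h, zero_mul] at this
    exact hτ1 this.symm
end TT
end Mod3

section Mod4
namespace TT
open MvPolynomial

/-- exponents of degree `d` -/
abbrev E (d : ℕ) : Type := ↥(Finset.finsuppAntidiag (Finset.univ : Finset (Fin 3)) d)

lemma mem_E {d : ℕ} {m : Fin 3 →₀ ℕ} :
    m ∈ Finset.finsuppAntidiag (Finset.univ : Finset (Fin 3)) d ↔ m 0 + m 1 + m 2 = d := by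
  simp [Finset.mem_finsuppAntidiag, Fin.sum_univ_three]

section form
variable {S S' : Type} [CommRing S] [CommRing S'] {d : ℕ}

def form (f : E d → S) : MvPolynomial (Fin 3) S := ∑ m : E d, monomial m.1 (f m)

lemma form_map (φ : S →+* S') (f : E d → S) : MvPolynomial.map φ (form f) = form (fun m => φ (f m)) := by
  simp [form, map_monomial]

lemma form_add (f g : E d → S) : form (f + g) = form f + form g := by
  simp [form, Finset.sum_add_distrib]

lemma form_smul (c : S) (f : E d → S) : form (c • f) = c • form f := by
  simp [form, Finset.smul_sum, smul_monomial]

lemma form_homog (f : E d → S) : (form f).IsHomogeneous d := by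
  apply IsHomogeneous.sum
  intro m _
  apply isHomogeneous_monomial
  have := mem_E.mp m.2
  simp [Finsupp.degree_eq_sum, Fin.sum_univ_three, this]

lemma coeff_form (f : E d → S) (m : E d) : coeff m.1 (form f) = f m := by
  classical
  rw [form, coeff_sum, Finset.sum_eq_single m]
  · simp
  · intro b _ hb
    rw [coeff_monomial, if_neg]
    exact fun h => hb (Subtype.ext h)
  · simp

lemma form_coeff {F : MvPolynomial (Fin 3) S} (hF : F.IsHomogeneous d) :
    form (fun m : E d => coeff m.1 F) = F := by
  classical
  ext m
  by_cases hm : m ∈ Finset.finsuppAntidiag (Finset.univ : Finset (Fin 3)) d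
  · exact coeff_form (fun m : E d => coeff m.1 F) ⟨m, hm⟩
  · have h : Finsupp.degree m ≠ d := by
      intro h; apply hm; rw [mem_E, ← h]; simp [Finsupp.degree_eq_sum, Fin.sum_univ_three]
    rw [(form_homog _).coeff_eq_zero h, hF.coeff_eq_zero h]

/-- directional derivative -/
def DD (F : MvPolynomial (Fin 3) S) (v w : Fin 3 → S) : S := ∑ i, w i * eval v (pderiv i F)

lemma DD_C (c : S) (v w : Fin 3 → S) : DD (C c) v w = 0 := by simp [DD]
lemma DD_X (i : Fin 3) (v w : Fin 3 → S) : DD (X i) v w = w i := by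
  classical
  simp [DD, pderiv_X, Pi.single_apply]
lemma DD_add (F G : MvPolynomial (Fin 3) S) (v w : Fin 3 → S) :
    DD (F + G) v w = DD F v w + DD G v w := by
  simp [DD, mul_add, Finset.sum_add_distrib]
lemma DD_mul (F G : MvPolynomial (Fin 3) S) (v w : Fin 3 → S) :
    DD (F * G) v w = DD F v w * eval v G + eval v F * DD G v w := by
  simp only [DD, Derivation.leibniz, smul_eq_mul, map_add, map_mul, Finset.sum_mul, Finset.mul_sum,
    ← Finset.sum_add_distrib]
  refine Finset.sum_congr rfl fun i _ => by ring
lemma DD_smul (c : S) (F : MvPolynomial (Fin 3) S) (v w : Fin 3 → S) :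
    DD (c • F) v w = c * DD F v w := by
  rw [smul_eq_C_mul, DD_mul, DD_C]; simp
lemma DD_w_add (F : MvPolynomial (Fin 3) S) (v w w' : Fin 3 → S) :
    DD F v (w + w') = DD F v w + DD F v w' := by
  simp [DD, add_mul, Finset.sum_add_distrib]
lemma DD_w_smul (F : MvPolynomial (Fin 3) S) (c : S) (v w : Fin 3 → S) :
    DD F v (c • w) = c * DD F v w := by
  simp [DD, mul_assoc, Finset.mul_sum]
lemma DD_euler {F : MvPolynomial (Fin 3) S} (hF : F.IsHomogeneous d) (v : Fin 3 → S) :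
    DD F v v = d * eval v F := by
  have := congrArg (eval v) hF.sum_X_mul_pderiv
  simpa [DD] using this

lemma eval_scale {F : MvPolynomial (Fin 3) S} (hF : F.IsHomogeneous d) (c : S) (v : Fin 3 → S) :
    eval (c • v) F = c ^ d * eval v F := by
  rw [eval_eq, eval_eq, Finset.mul_sum]
  refine Finset.sum_congr rfl fun m hm => ?_
  have h : Finsupp.degree m = d := by
    by_contra h; exact (mem_support_iff.mp hm) (hF.coeff_eq_zero h)
  rw [← h, Finsupp.degree_eq_sum, ← Finset.prod_pow_eq_pow_sum]
  simp only [Pi.smul_apply, smul_eq_mul, mul_pow, Finset.prod_mul_distrib]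
  have : ∀ g : Fin 3 → S, ∏ i ∈ m.support, g i ^ m i = ∏ i, g i ^ m i := fun g => by
    apply Finset.prod_subset (Finset.subset_univ _)
    intro x _ hx
    rw [Finsupp.notMem_support_iff.mp hx, pow_zero]
  rw [this (fun _ => c)]
  ring

lemma DD_scale {F : MvPolynomial (Fin 3) S} (hF : F.IsHomogeneous d) (c : S) (v w : Fin 3 → S) :
    DD F (c • v) w = c ^ (d - 1) * DD F v w := by
  simp only [DD, Finset.mul_sum]
  refine Finset.sum_congr rfl fun i _ => ?_
  rw [eval_scale (hF.pderiv (i := i))]; ring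

/-- restriction to the line `y = a x + b`, `z = 1` -/
def restr (a b : S) : MvPolynomial (Fin 3) S →ₐ[S] Polynomial S :=
  aeval ![Polynomial.X, Polynomial.C a * Polynomial.X + Polynomial.C b, 1]

lemma restr_map (φ : S →+* S') (a b : S) (F : MvPolynomial (Fin 3) S) :
    (restr a b F).map φ = restr (φ a) (φ b) (MvPolynomial.map φ F) := by
  induction F using MvPolynomial.induction_on with
  | C c => simp [restr]
  | add p q hp hq => simp [hp, hq]
  | mul_X p i hp =>
    rw [map_mul, Polynomial.map_mul, hp, map_mul, map_mul]
    congr 1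
    fin_cases i <;> simp [restr]

lemma restr_eval (a b x : S) (F : MvPolynomial (Fin 3) S) :
    (restr a b F).eval x = eval ![x, a * x + b, 1] F := by
  induction F using MvPolynomial.induction_on with
  | C c => simp [restr]
  | add p q hp hq => simp [hp, hq]
  | mul_X p i hp =>
    rw [map_mul, Polynomial.eval_mul, hp, map_mul]
    congr 1
    fin_cases i <;> simp [restr]

lemma restr_deriv (a b x : S) (F : MvPolynomial (Fin 3) S) :
    (restr a b F).derivative.eval x = DD F ![x, a * x + b, 1] ![1, a, 0] := by
  induction F using MvPolynomial.induction_on with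
  | C c => simp [restr, DD_C]
  | add p q hp hq => simp [hp, hq, DD_add]
  | mul_X p i hp =>
    rw [map_mul, Polynomial.derivative_mul, Polynomial.eval_add, Polynomial.eval_mul,
      Polynomial.eval_mul, hp, DD_mul, restr_eval, restr_eval, DD_X]
    congr 2
    fin_cases i <;> simp [restr]

lemma restr_degree {F : MvPolynomial (Fin 3) S} (hF : F.IsHomogeneous d) (a b : S) :
    (restr a b F).natDegree ≤ d := by
  rw [restr, aeval_def, eval₂_eq]
  apply Polynomial.natDegree_sum_le_of_forall_le
  intro m hm
  have h : Finsupp.degree m = d := by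
    by_contra h; exact (mem_support_iff.mp hm) (hF.coeff_eq_zero h)
  refine (Polynomial.natDegree_C_mul_le _ _).trans ((Polynomial.natDegree_prod_le _ _).trans ?_)
  rw [← h, Finsupp.degree]
  refine Finset.sum_le_sum fun i _ => ?_
  refine (Polynomial.natDegree_pow_le).trans ?_
  conv_rhs => rw [← mul_one (m i)]
  refine Nat.mul_le_mul_left _ ?_
  fin_cases i
  · simpa using Polynomial.natDegree_X_le
  · exact Polynomial.natDegree_linear_le
  · simp

/-- chain rule for a linear substitution -/
lemma DD_subst (L : Fin 3 → MvPolynomial (Fin 3) S) (v w v' w' : Fin 3 → S)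
    (hv : ∀ i, eval v' (L i) = v i) (hw : ∀ i, DD (L i) v' w' = w i) (F : MvPolynomial (Fin 3) S) :
    eval v' (bind₁ L F) = eval v F ∧ DD (bind₁ L F) v' w' = DD F v w := by
  induction F using MvPolynomial.induction_on with
  | C c => simp [DD_C]
  | add p q hp hq => simp [hp.1, hq.1, hp.2, hq.2, DD_add]
  | mul_X p i hp =>
    simp only [map_mul, bind₁_X_right, hp.1, hv, eval_X, DD_mul, hp.2, hw, DD_X, and_self]

end form
end TT
end Mod4

section Mod5
namespace TT
open MvPolynomial

abbrev E' (d : ℕ) : Type := {m : E d // m.1 1 ≠ 0}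
/-- chart parameters -/
abbrev Z9 (d : ℕ) : Type := Fin 6 ⊕ (Fin (d - 5) ⊕ (E' d ⊕ E d))
/-- homogeneous coordinates -/
abbrev I : Type := (Fin 4 × Fin 3) ⊕ Fin 2
/-- coefficients -/
abbrev Sg (d : ℕ) : Type := E d ⊕ E d

section chart
variable {S S' : Type} [CommRing S] [CommRing S'] {d : ℕ}

def pa (z : Z9 d → S) : S := z (Sum.inl 0)
def pb (z : Z9 d → S) : S := z (Sum.inl 1)
def pc (z : Z9 d → S) : S := z (Sum.inl 2)
def px (z : Z9 d → S) (k : Fin 3) : S := z (Sum.inl (Fin.natAdd 3 k))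
def pG (z : Z9 d → S) : E d → S := fun m => z (Sum.inr (Sum.inr (Sum.inr m)))

lemma pa_map (φ : S →+* S') (z : Z9 d → S) : pa (φ ∘ z) = φ (pa z) := rfl
lemma pb_map (φ : S →+* S') (z : Z9 d → S) : pb (φ ∘ z) = φ (pb z) := rfl
lemma pc_map (φ : S →+* S') (z : Z9 d → S) : pc (φ ∘ z) = φ (pc z) := rfl
lemma px_map (φ : S →+* S') (z : Z9 d → S) (k : Fin 3) : px (φ ∘ z) k = φ (px z k) := rfl
lemma pG_map (φ : S →+* S') (z : Z9 d → S) : pG (φ ∘ z) = fun m => φ (pG z m) := rfl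

def Bpoly (z : Z9 d → S) : Polynomial S :=
  ∑ k : Fin (d - 5), Polynomial.C (z (Sum.inr (Sum.inl k))) * Polynomial.X ^ (k : ℕ)

def nestP (x : Fin 3 → S) (u : Fin 9 → S) (B : Polynomial S) : Polynomial S :=
  Polynomial.C (u 3) + (Polynomial.X - Polynomial.C (x 0)) * (Polynomial.C (u 4) + (Polynomial.X - Polynomial.C (x 0)) * (Polynomial.C (u 5) + (Polynomial.X - Polynomial.C (x 1)) * (Polynomial.C (u 6) +
    (Polynomial.X - Polynomial.C (x 1)) * (Polynomial.C (u 7) + (Polynomial.X - Polynomial.C (x 2)) * (Polynomial.C (u 8) + (Polynomial.X - Polynomial.C (x 2)) * B)))))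

def nest (z : Z9 d → S) (u : Fin 9 → S) : Polynomial S := nestP (px z) u (Bpoly z)

def nonpure (z : Z9 d → S) : E d → S := fun m =>
  if h : m.1 1 = 0 then 0 else z (Sum.inr (Sum.inr (Sum.inl ⟨m, h⟩)))

def defect (z : Z9 d → S) (u : Fin 9 → S) : Polynomial S :=
  nest z u - restr (pa z) (pb z) (form (nonpure z) + pc z • form (pG z))

def Fco (z : Z9 d → S) (u : Fin 9 → S) : E d → S := fun m =>
  if m.1 1 = 0 then (defect z u).coeff (m.1 0) else nonpure z m

def co (z : Z9 d → S) (u : Fin 9 → S) : Sg d → S := Sum.elim (Fco z u) (pG z)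

def vecs (z : Z9 d → S) (T : Fin 5 → S) (u : Fin 9 → S) : Fin 4 → Fin 3 → S :=
  ![T 0 • ![-pa z, 1, -pb z],
    T 1 • ![px z 0, pa z * px z 0 + pb z + u 0, 1],
    T 2 • ![px z 1, pa z * px z 1 + pb z + u 1, 1],
    T 3 • ![px z 2, pa z * px z 2 + pb z + u 2, 1]]

def pt (z : Z9 d → S) (T : Fin 5 → S) (u : Fin 9 → S) : I → S :=
  Sum.elim (fun kj => vecs z T u kj.1 kj.2) ![T 4, T 4 * pc z]

lemma Bpoly_map (φ : S →+* S') (z : Z9 d → S) : (Bpoly z).map φ = Bpoly (φ ∘ z) := by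
  simp [Bpoly, Polynomial.map_sum]

lemma nest_map (φ : S →+* S') (z : Z9 d → S) (u : Fin 9 → S) :
    (nest z u).map φ = nest (φ ∘ z) (φ ∘ u) := by
  simp [nest, nestP, Bpoly_map, px_map]

lemma nonpure_map (φ : S →+* S') (z : Z9 d → S) (m : E d) :
    φ (nonpure z m) = nonpure (φ ∘ z) m := by
  unfold nonpure; split_ifs <;> simp

lemma defect_map (φ : S →+* S') (z : Z9 d → S) (u : Fin 9 → S) :
    (defect z u).map φ = defect (φ ∘ z) (φ ∘ u) := by
  have h : MvPolynomial.map φ (form (nonpure z) + pc z • form (pG z)) =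
      form (nonpure (φ ∘ z)) + pc (φ ∘ z) • form (pG (φ ∘ z)) := by
    rw [map_add, smul_eq_C_mul, map_mul, map_C, form_map, form_map, smul_eq_C_mul]
    simp only [nonpure_map, Function.comp_apply, pc_map, pG_map]
  rw [defect, Polynomial.map_sub, nest_map, restr_map, h]
  rfl

lemma Fco_map (φ : S →+* S') (z : Z9 d → S) (u : Fin 9 → S) (m : E d) :
    φ (Fco z u m) = Fco (φ ∘ z) (φ ∘ u) m := by
  unfold Fco
  split_ifs
  · rw [← defect_map, Polynomial.coeff_map]
  · exact nonpure_map φ z m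

lemma co_map (φ : S →+* S') (z : Z9 d → S) (u : Fin 9 → S) (m : Sg d) :
    φ (co z u m) = co (φ ∘ z) (φ ∘ u) m := by
  rcases m with m | m
  · exact Fco_map φ z u m
  · rfl

lemma pt_map (φ : S →+* S') (z : Z9 d → S) (T : Fin 5 → S) (u : Fin 9 → S) (i : I) :
    φ (pt z T u i) = pt (φ ∘ z) (φ ∘ T) (φ ∘ u) i := by
  rcases i with ⟨k, j⟩ | i
  · fin_cases k <;> fin_cases j <;> simp [pt, vecs, pa_map, pb_map, px_map]
  · fin_cases i <;> simp [pt, pc_map]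

lemma restr_pure (Q : Polynomial S) (hQ : Q.natDegree ≤ d) (a b : S) :
    restr a b (form (fun m : E d => if m.1 1 = 0 then Q.coeff (m.1 0) else 0)) = Q := by
  classical
  conv_rhs => rw [Q.as_sum_range' (d + 1) (by omega)]
  simp only [form, map_sum]
  rw [← Finset.sum_subset (s₁ := Finset.univ.filter fun m : E d => m.1 1 = 0) (Finset.subset_univ _)]
  · refine Finset.sum_bij' (fun m _ => m.1 0)
      (fun k hk => ⟨Finsupp.single 0 k + Finsupp.single 2 (d - k), by
        rw [mem_E]; simp at hk; simp; omega⟩) ?_ ?_ ?_ ?_ ?_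
    · intro m hm
      have := mem_E.mp m.2
      simp; omega
    · intro k hk; simp
    · intro m hm
      have := mem_E.mp m.2
      simp only [Finset.mem_filter, Finset.mem_univ, true_and] at hm
      ext i
      fin_cases i <;> simp <;> omega
    · intro k hk; simp
    · intro m hm
      simp only [Finset.mem_filter, Finset.mem_univ, true_and] at hm
      simp only [hm, if_true]
      rw [restr, aeval_monomial, Finsupp.prod_fintype _ _ (by simp)]
      simp [Fin.prod_univ_three, hm, Polynomial.C_mul_X_pow_eq_monomial]
  · intro m _ hm
    simp only [Finset.mem_filter, Finset.mem_univ, true_and] at hm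
    simp [hm]

lemma nest_degree (hd : 6 ≤ d) (z : Z9 d → S) (u : Fin 9 → S) : (nest z u).natDegree ≤ d := by
  have hB : (Bpoly z).natDegree ≤ d - 6 := by
    apply Polynomial.natDegree_sum_le_of_forall_le
    intro k _
    refine (Polynomial.natDegree_C_mul_X_pow_le _ _).trans ?_
    omega
  have step : ∀ (c x : S) (Q : Polynomial S) (n : ℕ), Q.natDegree ≤ n →
      (Polynomial.C c + (Polynomial.X - Polynomial.C x) * Q).natDegree ≤ n + 1 := by
    intro c x Q n hQ
    refine (Polynomial.natDegree_add_le _ _).trans (max_le (by simp) ?_)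
    refine Polynomial.natDegree_mul_le.trans ?_
    have := Polynomial.natDegree_X_sub_C_le x
    omega
  have := step (u 3) (px z 0) _ _ (step (u 4) (px z 0) _ _ (step (u 5) (px z 1) _ _
    (step (u 6) (px z 1) _ _ (step (u 7) (px z 2) _ _ (step (u 8) (px z 2) _ _ hB)))))
  unfold nest nestP
  omega

lemma restr_Fco (hd : 6 ≤ d) (z : Z9 d → S) (u : Fin 9 → S) :
    restr (pa z) (pb z) (form (Fco z u) + pc z • form (pG z)) = nest z u := by
  have hdef : (defect z u).natDegree ≤ d := by
    refine (Polynomial.natDegree_sub_le _ _).trans (max_le (nest_degree hd z u) ?_)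
    apply restr_degree
    exact (form_homog _).add (by rw [← form_smul]; exact form_homog _)
  have h1 : form (Fco z u) = form (nonpure z) +
      form (fun m : E d => if m.1 1 = 0 then (defect z u).coeff (m.1 0) else 0) := by
    rw [← form_add]
    congr 1
    funext m
    simp only [Fco, Pi.add_apply]
    by_cases h : m.1 1 = 0
    · simp [h, nonpure]
    · simp [h]
  have h2 : form (Fco z u) + pc z • form (pG z) = (form (nonpure z) + pc z • form (pG z)) +
      form (fun m : E d => if m.1 1 = 0 then (defect z u).coeff (m.1 0) else 0) := by
    rw [h1]; ring
  rw [h2, map_add, restr_pure _ hdef]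
  simp [defect]

end chart
end TT
end Mod5

section Mod6
namespace TT
open MvPolynomial

section vals
variable {S S' : Type} [CommRing S] [CommRing S'] {d : ℕ}

def vec (y : I → S) (k : Fin 4) : Fin 3 → S := fun i => y (Sum.inl (k, i))
def Fc (y : I → S) (τ : Sg d → S) : MvPolynomial (Fin 3) S :=
  y (Sum.inr 0) • form (fun m => τ (Sum.inl m)) + y (Sum.inr 1) • form (fun m => τ (Sum.inr m))
def cr (p q : Fin 3 → S) : S := p 2 * q 0 - p 0 * q 2
def wv (l : Fin 3 → S) : Fin 3 → S := ![l 1, -l 0, 0]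
def dot (l p : Fin 3 → S) : S := l 0 * p 0 + l 1 * p 1 + l 2 * p 2

def sval (y : I → S) : Fin 9 → S :=
  ![1, 1, 1, 1, vec y 1 2, cr (vec y 1) (vec y 2) ^ 2, vec y 2 2 * cr (vec y 1) (vec y 2) ^ 2,
    cr (vec y 1) (vec y 3) ^ 2 * cr (vec y 2) (vec y 3) ^ 2,
    vec y 3 2 * (cr (vec y 1) (vec y 3) ^ 2 * cr (vec y 2) (vec y 3) ^ 2)]

def tval (y : I → S) (τ : Sg d → S) : Fin 9 → S :=
  ![dot (vec y 0) (vec y 1), dot (vec y 0) (vec y 2), dot (vec y 0) (vec y 3),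
    eval (vec y 1) (Fc y τ), DD (Fc y τ) (vec y 1) (wv (vec y 0)),
    eval (vec y 2) (Fc y τ) * vec y 0 1 ^ 2, DD (Fc y τ) (vec y 2) (wv (vec y 0)) * vec y 0 1 ^ 2,
    eval (vec y 3) (Fc y τ) * vec y 0 1 ^ 4, DD (Fc y τ) (vec y 3) (wv (vec y 0)) * vec y 0 1 ^ 4]

lemma sval_map (φ : S →+* S') (y : I → S) (j : Fin 9) : φ (sval y j) = sval (φ ∘ y) j := by
  fin_cases j <;> simp [sval, cr, vec]

lemma Fc_map (φ : S →+* S') (y : I → S) (τ : Sg d → S) :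
    MvPolynomial.map φ (Fc y τ) = Fc (φ ∘ y) (φ ∘ τ) := by
  simp [Fc, smul_eq_C_mul, form_map]

lemma eval_map' (φ : S →+* S') (v : Fin 3 → S) (F : MvPolynomial (Fin 3) S) :
    φ (eval v F) = eval (φ ∘ v) (MvPolynomial.map φ F) := by
  rw [eval_map, eval₂_comp]

lemma DD_map (φ : S →+* S') (v w : Fin 3 → S) (F : MvPolynomial (Fin 3) S) :
    φ (DD F v w) = DD (MvPolynomial.map φ F) (φ ∘ v) (φ ∘ w) := by
  simp only [DD, map_sum, map_mul, eval_map', pderiv_map, Function.comp_apply]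

lemma tval_map (φ : S →+* S') (y : I → S) (τ : Sg d → S) (j : Fin 9) :
    φ (tval y τ j) = tval (φ ∘ y) (φ ∘ τ) j := by
  have h1 : ∀ k, φ ∘ vec y k = vec (φ ∘ y) k := fun k => rfl
  have h2 : ∀ k i, φ (vec y k i) = vec (φ ∘ y) k i := fun k i => rfl
  have h3 : ∀ k, φ ∘ wv (vec y k) = wv (vec (φ ∘ y) k) := by
    intro k; funext i; fin_cases i <;> simp [wv, vec]
  fin_cases j <;> simp [tval, eval_map', DD_map, Fc_map, h1, h2, h3, dot]

/-- monomials relating `t` and `s` -/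
def mL (T : Fin 5 → S) : Fin 9 → S :=
  ![1, 1, 1, 1, 1, T 1 ^ 2, T 1 ^ 2, T 1 ^ 2 * T 2 ^ 2, T 1 ^ 2 * T 2 ^ 2]
def mR (d : ℕ) (T : Fin 5 → S) : Fin 9 → S :=
  ![T 0 * T 1, T 0 * T 2, T 0 * T 3, T 4 * T 1 ^ d, T 4 * T 1 ^ (d - 2) * T 0,
    T 4 * T 2 ^ (d - 2) * T 0 ^ 2, T 4 * T 2 ^ (d - 4) * T 0 ^ 3, T 4 * T 3 ^ (d - 4) * T 0 ^ 4,
    T 4 * T 3 ^ (d - 6) * T 0 ^ 5]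

lemma rel (hd : 6 ≤ d) (z : Z9 d → S) (T : Fin 5 → S) (u : Fin 9 → S) (j : Fin 9)
    (hu : ∀ i < j, u i = 0) :
    tval (pt z T u) (co z u) j * mL T j = sval (pt z T u) j * u j * mR d T j := by
  have hF : Fc (pt z T u) (co z u) = T 4 • (form (Fco z u) + pc z • form (pG z)) := by
    simp [Fc, pt, co, smul_add, smul_smul]
  set H := form (Fco z u) + pc z • form (pG z) with hH
  have hHh : H.IsHomogeneous d :=
    (form_homog _).add (by rw [← form_smul]; exact form_homog _)
  have hr : restr (pa z) (pb z) H = nest z u := restr_Fco hd z u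
  have hw : wv (vec (pt z T u) 0) = T 0 • ![1, pa z, 0] := by
    funext i; fin_cases i <;> simp [wv, vec, pt, vecs]
  have hl1 : vec (pt z T u) 0 1 = T 0 := by simp [vec, pt, vecs]
  have ev : ∀ (k : Fin 3) (c : S), eval (c • ![px z k, pa z * px z k + pb z, 1])
      (Fc (pt z T u) (co z u)) = T 4 * (c ^ d * (nest z u).eval (px z k)) := by
    intro k c
    rw [hF, smul_eval, eval_scale hHh, ← restr_eval, hr]
  have dv : ∀ (k : Fin 3) (c : S), DD (Fc (pt z T u) (co z u)) (c • ![px z k, pa z * px z k + pb z, 1])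
      (wv (vec (pt z T u) 0)) = T 4 * (T 0 * (c ^ (d - 1) * (nest z u).derivative.eval (px z k))) := by
    intro k c
    rw [hF, hw, DD_smul, DD_w_smul, DD_scale hHh, ← restr_deriv, hr]
  have v1 : u 0 = 0 → vec (pt z T u) 1 = T 1 • ![px z 0, pa z * px z 0 + pb z, 1] := by
    intro h; funext i; fin_cases i <;> simp [vec, pt, vecs, h]
  have v2 : u 1 = 0 → vec (pt z T u) 2 = T 2 • ![px z 1, pa z * px z 1 + pb z, 1] := by
    intro h; funext i; fin_cases i <;> simp [vec, pt, vecs, h]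
  have v3 : u 2 = 0 → vec (pt z T u) 3 = T 3 • ![px z 2, pa z * px z 2 + pb z, 1] := by
    intro h; funext i; fin_cases i <;> simp [vec, pt, vecs, h]
  have ev1 := fun h => (congrArg (fun v => eval v (Fc (pt z T u) (co z u))) (v1 h)).trans (ev 0 (T 1))
  have ev2 := fun h => (congrArg (fun v => eval v (Fc (pt z T u) (co z u))) (v2 h)).trans (ev 1 (T 2))
  have ev3 := fun h => (congrArg (fun v => eval v (Fc (pt z T u) (co z u))) (v3 h)).trans (ev 2 (T 3))
  have dv1 := fun h => (congrArg (fun v => DD (Fc (pt z T u) (co z u)) v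
    (wv (vec (pt z T u) 0))) (v1 h)).trans (dv 0 (T 1))
  have dv2 := fun h => (congrArg (fun v => DD (Fc (pt z T u) (co z u)) v
    (wv (vec (pt z T u) 0))) (v2 h)).trans (dv 1 (T 2))
  have dv3 := fun h => (congrArg (fun v => DD (Fc (pt z T u) (co z u)) v
    (wv (vec (pt z T u) 0))) (v3 h)).trans (dv 2 (T 3))
  have c10 : vec (pt z T u) 1 0 = T 1 * px z 0 := by simp [vec, pt, vecs]
  have c12 : vec (pt z T u) 1 2 = T 1 := by simp [vec, pt, vecs]
  have c20 : vec (pt z T u) 2 0 = T 2 * px z 1 := by simp [vec, pt, vecs]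
  have c22 : vec (pt z T u) 2 2 = T 2 := by simp [vec, pt, vecs]
  have c30 : vec (pt z T u) 3 0 = T 3 * px z 2 := by simp [vec, pt, vecs]
  have c32 : vec (pt z T u) 3 2 = T 3 := by simp [vec, pt, vecs]
  obtain ⟨e, rfl⟩ : ∃ e, d = e + 6 := ⟨d - 6, by omega⟩
  have s1 : e + 6 - 1 = e + 5 := by omega
  have s2 : e + 6 - 2 = e + 4 := by omega
  have s4 : e + 6 - 4 = e + 2 := by omega
  have s6 : e + 6 - 6 = e := by omega
  fin_cases j
  · simp [tval, sval, mL, mR, dot, vec, pt, vecs]; ring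
  · simp [tval, sval, mL, mR, dot, vec, pt, vecs]; ring
  · simp [tval, sval, mL, mR, dot, vec, pt, vecs]; ring
  · have h0 := hu 0 (by decide)
    simp only [tval, sval, mL, mR]
    simp [ev1 h0, c10, c12, c20, c22, c30, c32, nest, nestP]
    ring
  · have h0 := hu 0 (by decide)
    simp only [tval, sval, mL, mR]
    simp [dv1 h0, c10, c12, c20, c22, c30, c32, nest, nestP, s1, s2]
    ring
  · have h0 := hu 0 (by decide)
    have h1 := hu 1 (by decide)
    have h3 := hu 3 (by decide)
    have h4 := hu 4 (by decide)
    simp only [tval, sval, mL, mR]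
    simp [ev2 h1, c10, c12, c20, c22, c30, c32, nest, nestP, s1, s2, hl1, cr, h3, h4]
    ring
  · have h0 := hu 0 (by decide)
    have h1 := hu 1 (by decide)
    have h3 := hu 3 (by decide)
    have h4 := hu 4 (by decide)
    have h5 := hu 5 (by decide)
    simp only [tval, sval, mL, mR]
    simp [dv2 h1, c10, c12, c20, c22, c30, c32, nest, nestP, s1, s4, hl1, cr, h3, h4, h5]
    ring
  · have h0 := hu 0 (by decide)
    have h1 := hu 1 (by decide)
    have h2 := hu 2 (by decide)
    have h3 := hu 3 (by decide)
    have h4 := hu 4 (by decide)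
    have h5 := hu 5 (by decide)
    have h6 := hu 6 (by decide)
    simp only [tval, sval, mL, mR]
    simp [ev3 h2, c10, c12, c20, c22, c30, c32, nest, nestP, s1, s4, hl1, cr, h3, h4, h5, h6]
    ring
  · have h0 := hu 0 (by decide)
    have h1 := hu 1 (by decide)
    have h2 := hu 2 (by decide)
    have h3 := hu 3 (by decide)
    have h4 := hu 4 (by decide)
    have h5 := hu 5 (by decide)
    have h6 := hu 6 (by decide)
    have h7 := hu 7 (by decide)
    simp only [tval, sval, mL, mR]
    simp [dv3 h2, c10, c12, c20, c22, c30, c32, nest, nestP, s1, s6, hl1, cr, h3, h4, h5, h6, h7]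
    ring

lemma Fco_unique (z : Z9 d → S) (u : Fin 9 → S) (F : E d → S)
    (hr : restr (pa z) (pb z) (form F + pc z • form (pG z)) = nest z u)
    (hn : ∀ m : E' d, z (Sum.inr (Sum.inr (Sum.inl m))) = F m.1) : Fco z u = F := by
  classical
  let Q : Polynomial S := ∑ k ∈ (Finset.range (d + 1)).attach,
    Polynomial.C (F ⟨Finsupp.single 0 k.1 + Finsupp.single 2 (d - k.1), by
      have := Finset.mem_range.mp k.2; rw [mem_E]; simp; omega⟩) * Polynomial.X ^ k.1
  have hQc : ∀ m : E d, m.1 1 = 0 → Q.coeff (m.1 0) = F m := by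
    intro m hm
    have hm' := mem_E.mp m.2
    simp only [Q, Polynomial.finsetSum_coeff, Polynomial.coeff_C_mul, Polynomial.coeff_X_pow]
    rw [Finset.sum_eq_single ⟨m.1 0, by simp; omega⟩]
    · simp only [if_true, mul_one]
      congr 1
      ext i
      fin_cases i <;> simp <;> omega
    · intro k _ hk
      rw [if_neg, mul_zero]
      intro h; exact hk (Subtype.ext h.symm)
    · simp
  have hQd : Q.natDegree ≤ d := by
    apply Polynomial.natDegree_sum_le_of_forall_le
    intro k _
    refine (Polynomial.natDegree_C_mul_X_pow_le _ _).trans ?_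
    have := Finset.mem_range.mp k.2; omega
  have hF : form F = form (nonpure z) + form (fun m : E d => if m.1 1 = 0 then Q.coeff (m.1 0) else 0) := by
    rw [← form_add]
    congr 1
    funext m
    simp only [Pi.add_apply, nonpure]
    by_cases h : m.1 1 = 0
    · simp [h, hQc m h]
    · simp [h, hn ⟨m, h⟩]
  have hdef : defect z u = Q := by
    rw [defect, ← hr, hF, add_right_comm, map_add _ _ (form fun m => _), restr_pure _ hQd]
    ring
  funext m
  unfold Fco
  split_ifs with h
  · rw [hdef, hQc m h]
  · simp [nonpure, h, hn ⟨m, h⟩]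

end vals

lemma peel (Q : Polynomial ℂ) (x : ℂ) {n : ℕ} (hQ : Q.natDegree ≤ n) :
    ∃ (u : ℂ) (Q' : Polynomial ℂ), Q = Polynomial.C u + (Polynomial.X - Polynomial.C x) * Q' ∧
      Q'.natDegree ≤ n - 1 := by
  refine ⟨Q.eval x, Q /ₘ (Polynomial.X - Polynomial.C x), ?_, ?_⟩
  · rw [← Polynomial.modByMonic_X_sub_C_eq_C_eval, Polynomial.modByMonic_add_div]
  · rw [Polynomial.natDegree_divByMonic _ (Polynomial.monic_X_sub_C x), Polynomial.natDegree_X_sub_C]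
    omega

variable {d : ℕ}
lemma chart_surj (hd : 6 ≤ d) (y : I → ℂ) (τ : Sg d → ℂ) (h0 : vec y 0 1 ≠ 0)
    (h1 : vec y 1 2 ≠ 0) (h2 : vec y 2 2 ≠ 0) (h3 : vec y 3 2 ≠ 0) (h4 : y (Sum.inr 0) ≠ 0) :
    ∃ z T u, pt z T u = y ∧ co z u = τ := by
  let a := -vec y 0 0 / vec y 0 1
  let b := -vec y 0 2 / vec y 0 1
  let c := y (Sum.inr 1) / y (Sum.inr 0)
  let x : Fin 3 → ℂ := fun k => vec y k.succ 0 / vec y k.succ 2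
  let F : E d → ℂ := fun m => τ (Sum.inl m)
  let G : E d → ℂ := fun m => τ (Sum.inr m)
  have hdeg : (restr a b (form F + c • form G)).natDegree ≤ d := by
    apply restr_degree
    exact (form_homog _).add (by rw [← form_smul]; exact form_homog _)
  obtain ⟨u3, Q3, e3, d3⟩ := peel _ (x 0) hdeg
  obtain ⟨u4, Q4, e4, d4⟩ := peel _ (x 0) d3
  obtain ⟨u5, Q5, e5, d5⟩ := peel _ (x 1) d4
  obtain ⟨u6, Q6, e6, d6⟩ := peel _ (x 1) d5
  obtain ⟨u7, Q7, e7, d7⟩ := peel _ (x 2) d6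
  obtain ⟨u8, Q8, e8, d8⟩ := peel _ (x 2) d7
  let z : Z9 d → ℂ := Sum.elim ![a, b, c, x 0, x 1, x 2]
    (Sum.elim (fun k => Q8.coeff k) (Sum.elim (fun m => F m.1) G))
  let T : Fin 5 → ℂ := ![vec y 0 1, vec y 1 2, vec y 2 2, vec y 3 2, y (Sum.inr 0)]
  let uu : Fin 3 → ℂ := fun k => vec y k.succ 1 / vec y k.succ 2 - a * x k - b
  let u : Fin 9 → ℂ := ![uu 0, uu 1, uu 2, u3, u4, u5, u6, u7, u8]
  have hB : Bpoly z = Q8 := by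
    conv_rhs => rw [Q8.as_sum_range_C_mul_X_pow' (n := d - 5) (by omega)]
    rw [Finset.sum_range]
    rfl
  have hn : nest z u = restr a b (form F + c • form G) := by
    rw [e3, e4, e5, e6, e7, e8, nest, hB]
    simp [nestP, u, z, px]
  refine ⟨z, T, u, ?_, ?_⟩
  · funext i
    rcases i with ⟨k, j⟩ | i
    · fin_cases k <;> fin_cases j <;>
        simp [pt, vecs, T, z, pa, pb, px, u, uu, a, b, x] <;> (try field_simp) <;> (try simp [vec])
    · fin_cases i <;> simp [pt, T, pc, z, c] <;> (try field_simp)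
  · have := Fco_unique z u F hn.symm (fun m => rfl)
    funext m
    rcases m with m | m
    · exact congrFun this m
    · rfl
end TT
end Mod6

section Mod7
namespace TT
open MvPolynomial

section act
variable {S S' : Type} [CommRing S] [CommRing S'] {d : ℕ}

def actl (g : Fin 4 → S) (l : Fin 3 → S) : Fin 3 → S :=
  ![l 0 - g 0 * l 2, l 1 - g 2 * l 0 + (g 0 * g 2 - g 1) * l 2, l 2]
def actp (g : Fin 4 → S) (p : Fin 3 → S) : Fin 3 → S :=
  ![p 0 + g 2 * p 1, p 1, p 2 + g 0 * p 0 + g 1 * p 1]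
def actY (g : Fin 4 → S) (y : I → S) : I → S :=
  Sum.elim (fun kj => (![actl g (vec y 0), actp g (vec y 1), actp g (vec y 2), actp g (vec y 3)] :
    Fin 4 → Fin 3 → S) kj.1 kj.2) ![y (Sum.inr 0) + g 3 * y (Sum.inr 1), y (Sum.inr 1)]
def subL (g : Fin 4 → S) : Fin 3 → MvPolynomial (Fin 3) S :=
  ![X 0 - C (g 2) * X 1, X 1, X 2 - C (g 0) * X 0 + C (g 0 * g 2 - g 1) * X 1]
def actT (g : Fin 4 → S) (τ : Sg d → S) : Sg d → S :=
  Sum.elim (fun m => coeff m.1 (bind₁ (subL g) (form fun m : E d => τ (Sum.inl m))))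
    (fun m => coeff m.1 (bind₁ (subL g) (form fun m : E d => τ (Sum.inr m) - g 3 * τ (Sum.inl m))))
def ginv (g : Fin 4 → S) : Fin 4 → S := ![-g 0, g 0 * g 2 - g 1, -g 2, -g 3]

lemma vec_actY0 (g : Fin 4 → S) (y : I → S) : vec (actY g y) 0 = actl g (vec y 0) := rfl
lemma vec_actY1 (g : Fin 4 → S) (y : I → S) : vec (actY g y) 1 = actp g (vec y 1) := rfl
lemma vec_actY2 (g : Fin 4 → S) (y : I → S) : vec (actY g y) 2 = actp g (vec y 2) := rfl
lemma vec_actY3 (g : Fin 4 → S) (y : I → S) : vec (actY g y) 3 = actp g (vec y 3) := rfl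

lemma actY_map (φ : S →+* S') (g : Fin 4 → S) (y : I → S) (i : I) :
    φ (actY g y i) = actY (φ ∘ g) (φ ∘ y) i := by
  rcases i with ⟨k, j⟩ | i
  · fin_cases k <;> fin_cases j <;> simp [actY, actl, actp, vec]
  · fin_cases i <;> simp [actY]

lemma subL_map (φ : S →+* S') (g : Fin 4 → S) (i : Fin 3) :
    MvPolynomial.map φ (subL g i) = subL (φ ∘ g) i := by
  fin_cases i <;> simp [subL]

lemma actT_map (φ : S →+* S') (g : Fin 4 → S) (τ : Sg d → S) (m : Sg d) :
    φ (actT g τ m) = actT (φ ∘ g) (φ ∘ τ) m := by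
  rcases m with m | m <;>
  · simp only [actT, Sum.elim_inl, Sum.elim_inr]
    rw [← coeff_map, map_bind₁, form_map]
    simp [subL_map]

lemma subL_homog (g : Fin 4 → S) (i : Fin 3) : (subL g i).IsHomogeneous 1 := by
  have hX := fun i : Fin 3 => isHomogeneous_X S i
  fin_cases i
  · exact (hX 0).sub (by simpa using (isHomogeneous_C _ (g 2)).mul (hX 1))
  · exact hX 1
  · exact ((hX 2).sub (by simpa using (isHomogeneous_C _ (g 0)).mul (hX 0))).add
      (by simpa using (isHomogeneous_C (Fin 3) (g 0 * g 2 - g 1)).mul (hX 1))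

lemma bind_homog (g : Fin 4 → S) {F : MvPolynomial (Fin 3) S} (hF : F.IsHomogeneous d) :
    (bind₁ (subL g) F).IsHomogeneous d := by
  have := hF.aeval (subL g) (fun i => subL_homog g i)
  simpa using this

lemma form_actT_inl (g : Fin 4 → S) (τ : Sg d → S) :
    form (fun m => actT g τ (Sum.inl m)) = bind₁ (subL g) (form fun m : E d => τ (Sum.inl m)) :=
  form_coeff (bind_homog g (form_homog _))

lemma form_actT_inr (g : Fin 4 → S) (τ : Sg d → S) :
    form (fun m => actT g τ (Sum.inr m)) = bind₁ (subL g) (form (fun m : E d => τ (Sum.inr m))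
      - g 3 • form (fun m : E d => τ (Sum.inl m))) := by
  have h : (form fun m : E d => τ (Sum.inr m) - g 3 * τ (Sum.inl m)) =
     form (fun m : E d => τ (Sum.inr m)) - g 3 • form (fun m : E d => τ (Sum.inl m)) := by
    rw [eq_sub_iff_add_eq, ← form_smul, ← form_add]
    congr 1; funext m; simp
  rw [← h]
  exact form_coeff (bind_homog g (form_homog _))

lemma Fc_act (g : Fin 4 → S) (y : I → S) (τ : Sg d → S) :
    Fc (actY g y) (actT g τ) = bind₁ (subL g) (Fc y τ) := by
  simp only [Fc, form_actT_inl, form_actT_inr, actY, Sum.elim_inr]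
  simp [smul_sub, smul_smul, add_smul]
  module

lemma actY_inv (g : Fin 4 → S) (y : I → S) : actY (ginv g) (actY g y) = y := by
  funext i
  rcases i with ⟨k, j⟩ | i
  · fin_cases k <;> fin_cases j <;> simp [actY, actl, actp, vec, ginv] <;> ring
  · fin_cases i <;> simp [actY, ginv]

lemma ginv_ginv (g : Fin 4 → S) : ginv (ginv g) = g := by
  funext i; fin_cases i <;> simp [ginv]

lemma subL_inv (g : Fin 4 → S) (F : MvPolynomial (Fin 3) S) :
    bind₁ (subL (ginv g)) (bind₁ (subL g) F) = F := by
  rw [bind₁_bind₁]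
  have h : (fun i => bind₁ (subL (ginv g)) (subL g i)) = X := by
    funext i
    fin_cases i <;> simp [subL, ginv, bind₁_C_right] <;> ring
  rw [h, bind₁_X_left]; rfl

lemma actT_inv (g : Fin 4 → S) (τ : Sg d → S) : actT (ginv g) (actT g τ) = τ := by
  have h1 : form (fun m => actT (ginv g) (actT g τ) (Sum.inl m)) = form (fun m : E d => τ (Sum.inl m)) := by
    rw [form_actT_inl, form_actT_inl, subL_inv]
  have h2 : form (fun m => actT (ginv g) (actT g τ) (Sum.inr m)) = form (fun m : E d => τ (Sum.inr m)) := by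
    rw [form_actT_inr, form_actT_inl, form_actT_inr, map_sub, map_smul, subL_inv, subL_inv]
    simp [ginv]
  funext m
  rcases m with m | m
  · have := congrArg (coeff m.1) h1; rwa [coeff_form, coeff_form] at this
  · have := congrArg (coeff m.1) h2; rwa [coeff_form, coeff_form] at this

lemma Fc_homog (y : I → S) (τ : Sg d → S) : (Fc y τ).IsHomogeneous d := by
  unfold Fc
  rw [← form_smul, ← form_smul, ← form_add]
  exact form_homog _

lemma dot_act (g : Fin 4 → S) (l p : Fin 3 → S) : dot (actl g l) (actp g p) = dot l p := by
  simp [dot, actl, actp]; ring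

lemma cr_act (g : Fin 4 → S) (l p q : Fin 3 → S) (hp : dot l p = 0) (hq : dot l q = 0) :
    cr p q * actl g l 1 = cr (actp g p) (actp g q) * l 1 := by
  simp only [dot] at hp hq
  simp [cr, actl, actp]
  linear_combination (g 2 * q 2 + (g 0 * g 2 - g 1) * q 0) * hp - (g 2 * p 2 + (g 0 * g 2 - g 1) * p 0) * hq

lemma subL_eval (g : Fin 4 → S) (p : Fin 3 → S) (i : Fin 3) : eval (actp g p) (subL g i) = p i := by
  fin_cases i <;> simp [subL, actp]; ring

def omg (g : Fin 4 → S) (w : Fin 3 → S) : Fin 3 → S :=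
  ![w 0 - g 2 * w 1, w 1, w 2 - g 0 * w 0 + (g 0 * g 2 - g 1) * w 1]

lemma subL_DD (g : Fin 4 → S) (p w : Fin 3 → S) (i : Fin 3) : DD (subL g i) p w = omg g w i := by
  have hs : ∀ F G : MvPolynomial (Fin 3) S, DD (F - G) p w = DD F p w - DD G p w := by
    intro F G
    rw [eq_sub_iff_add_eq, ← DD_add, sub_add_cancel]
  fin_cases i <;> simp [subL, omg, hs, DD_add, DD_mul, DD_X, DD_C]

lemma eval_act (g : Fin 4 → S) (y : I → S) (τ : Sg d → S) (p : Fin 3 → S) :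
    eval (actp g p) (Fc (actY g y) (actT g τ)) = eval p (Fc y τ) := by
  rw [Fc_act]
  exact (DD_subst (subL g) p (omg g 0) _ 0 (subL_eval g p) (subL_DD g _ _) _).1

lemma DD_act (g : Fin 4 → S) (y : I → S) (τ : Sg d → S) (p l : Fin 3 → S)
    (h0 : dot l p = 0) (h1 : eval p (Fc y τ) = 0) :
    DD (Fc y τ) p (wv l) * actp g p 2 =
      p 2 * DD (Fc (actY g y) (actT g τ)) (actp g p) (wv (actl g l)) := by
  rw [Fc_act, (DD_subst (subL g) p (omg g (wv (actl g l))) _ _ (subL_eval g p) (subL_DD g _ _) _).2]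
  have hv : p 2 • omg g (wv (actl g l)) = omg g (wv (actl g l)) 2 • p + actp g p 2 • wv l := by
    simp only [dot] at h0
    funext i
    fin_cases i
    · simp [omg, wv, actl, actp]; linear_combination -g 1 * h0
    · simp [omg, wv, actl, actp]; linear_combination g 0 * h0
    · simp [omg, wv, actl, actp]; ring
  have := congrArg (DD (Fc y τ) p) hv
  rw [DD_w_smul, DD_w_add, DD_w_smul, DD_w_smul, DD_euler (Fc_homog y τ), h1] at this
  rw [this]; ring

end act

lemma cross {d : ℕ} (g : Fin 4 → ℂ) (y : I → ℂ) (τ : Sg d → ℂ) (h0 : vec y 0 1 ≠ 0) (j : Fin 9)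
    (ht : ∀ i < j, tval y τ i = 0) :
    tval y τ j * sval (actY g y) j = sval y j * tval (actY g y) (actT g τ) j := by
  have t0 : 0 < j → dot (vec y 0) (vec y 1) = 0 := ht 0
  have t1 : 1 < j → dot (vec y 0) (vec y 2) = 0 := ht 1
  have t2 : 2 < j → dot (vec y 0) (vec y 3) = 0 := ht 2
  have t3 : 3 < j → eval (vec y 1) (Fc y τ) = 0 := ht 3
  have t5 : 5 < j → eval (vec y 2) (Fc y τ) = 0 := fun h => by
    have : eval (vec y 2) (Fc y τ) * vec y 0 1 ^ 2 = 0 := ht 5 h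
    simpa [h0] using this
  have t7 : 7 < j → eval (vec y 3) (Fc y τ) = 0 := fun h => by
    have : eval (vec y 3) (Fc y τ) * vec y 0 1 ^ 4 = 0 := ht 7 h
    simpa [h0] using this
  simp only [tval, sval, vec_actY0, vec_actY1, vec_actY2, vec_actY3, dot_act, eval_act]
  fin_cases j
  · simp
  · simp
  · simp
  · simp
  · simpa using DD_act g y τ (vec y 1) (vec y 0) (t0 (by decide)) (t3 (by decide))
  · have c := cr_act g _ _ _ (t0 (by decide)) (t1 (by decide))
    simp
    linear_combination (-(eval (vec y 2) (Fc y τ)) *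
      (cr (vec y 1) (vec y 2) * actl g (vec y 0) 1 + cr (actp g (vec y 1)) (actp g (vec y 2)) * vec y 0 1)) * c
  · have c := cr_act g _ _ _ (t0 (by decide)) (t1 (by decide))
    have e := DD_act g y τ (vec y 2) (vec y 0) (t1 (by decide)) (t5 (by decide))
    simp
    generalize DD (Fc (actY g y) (actT g τ)) (actp g (vec y 2)) (wv (actl g (vec y 0))) = D' at *
    generalize DD (Fc y τ) (vec y 2) (wv (vec y 0)) = D at *
    have c2 : (cr (vec y 1) (vec y 2) * actl g (vec y 0) 1) ^ 2 =
      (cr (actp g (vec y 1)) (actp g (vec y 2)) * vec y 0 1) ^ 2 := by rw [c]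
    linear_combination (vec y 0 1 ^ 2 * cr (actp g (vec y 1)) (actp g (vec y 2)) ^ 2) * e
      - (vec y 2 2 * D') * c2
  · have c := cr_act g _ _ _ (t0 (by decide)) (t2 (by decide))
    have c' := cr_act g _ _ _ (t1 (by decide)) (t2 (by decide))
    simp
    have c2 : (cr (vec y 1) (vec y 3) * actl g (vec y 0) 1) ^ 2 * (cr (vec y 2) (vec y 3) * actl g (vec y 0) 1) ^ 2 =
      (cr (actp g (vec y 1)) (actp g (vec y 3)) * vec y 0 1) ^ 2 *
      (cr (actp g (vec y 2)) (actp g (vec y 3)) * vec y 0 1) ^ 2 := by rw [c, c']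
    linear_combination (-(eval (vec y 3) (Fc y τ))) * c2
  · have c := cr_act g _ _ _ (t0 (by decide)) (t2 (by decide))
    have c' := cr_act g _ _ _ (t1 (by decide)) (t2 (by decide))
    have e := DD_act g y τ (vec y 3) (vec y 0) (t2 (by decide)) (t7 (by decide))
    simp
    generalize DD (Fc (actY g y) (actT g τ)) (actp g (vec y 3)) (wv (actl g (vec y 0))) = D' at *
    generalize DD (Fc y τ) (vec y 3) (wv (vec y 0)) = D at *
    have c2 : (cr (vec y 1) (vec y 3) * actl g (vec y 0) 1) ^ 2 * (cr (vec y 2) (vec y 3) * actl g (vec y 0) 1) ^ 2 =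
      (cr (actp g (vec y 1)) (actp g (vec y 3)) * vec y 0 1) ^ 2 *
      (cr (actp g (vec y 2)) (actp g (vec y 3)) * vec y 0 1) ^ 2 := by rw [c, c']
    linear_combination (vec y 0 1 ^ 4 * (cr (actp g (vec y 1)) (actp g (vec y 3)) ^ 2 *
      cr (actp g (vec y 2)) (actp g (vec y 3)) ^ 2)) * e - (vec y 3 2 * D') * c2
end TT
end Mod7

section Mod8
namespace TT
open MvPolynomial

/-- coefficient ring -/
abbrev A (d : ℕ) : Type := MvPolynomial (Sg d) ℂ
/-- multigraded ring -/
abbrev R (d : ℕ) : Type := MvPolynomial I (A d)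
/-- chart ring -/
abbrev VK (d : ℕ) : Type := Z9 d ⊕ (Fin 5 ⊕ Fin 9)
abbrev K (d : ℕ) : Type := MvPolynomial (VK d) ℂ

variable {d : ℕ}

def ev (y : I → ℂ) (τ : Sg d → ℂ) : R d →+* ℂ := eval₂Hom (eval τ) y

lemma ev_X (y : I → ℂ) (τ : Sg d → ℂ) (i : I) : ev y τ (X i) = y i := by simp [ev]
lemma ev_CX (y : I → ℂ) (τ : Sg d → ℂ) (i : Sg d) : ev y τ (C (X i)) = τ i := by simp [ev]
lemma ev_CC (y : I → ℂ) (τ : Sg d → ℂ) (c : ℂ) : ev y τ (C (C c)) = c := by simp [ev]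

lemma ev_ext {w : R d} (h : ∀ y τ, ev y τ w = 0) : w = 0 := by
  ext m : 1
  rw [coeff_zero]
  apply MvPolynomial.funext
  intro τ
  have : MvPolynomial.map (eval τ) w = 0 := by
    apply MvPolynomial.funext
    intro y
    rw [eval_map, map_zero]
    exact h y τ
  rw [← coeff_map, this, coeff_zero, map_zero]

def zK : Z9 d → K d := fun i => X (Sum.inl i)
def TK : Fin 5 → K d := fun i => X (Sum.inr (Sum.inl i))
def uK (j : ℕ) : Fin 9 → K d := fun i => if (i : ℕ) < j then 0 else X (Sum.inr (Sum.inr i))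

def evK (z : Z9 d → ℂ) (T : Fin 5 → ℂ) (u : Fin 9 → ℂ) : K d →+* ℂ :=
  eval (Sum.elim z (Sum.elim T u))

def tr (j : ℕ) (u : Fin 9 → ℂ) : Fin 9 → ℂ := fun i => if (i : ℕ) < j then 0 else u i

lemma evK_z (z : Z9 d → ℂ) (T : Fin 5 → ℂ) (u : Fin 9 → ℂ) : evK z T u ∘ zK = z := by
  funext i; simp [evK, zK]
lemma evK_T (z : Z9 d → ℂ) (T : Fin 5 → ℂ) (u : Fin 9 → ℂ) : evK z T u ∘ TK = T := by
  funext i; simp [evK, TK]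
lemma evK_u (z : Z9 d → ℂ) (T : Fin 5 → ℂ) (u : Fin 9 → ℂ) (j : ℕ) : evK z T u ∘ uK j = tr j u := by
  funext i; simp only [Function.comp_apply, uK, tr]; split_ifs <;> simp [evK]

def Th (d j : ℕ) : R d →+* K d :=
  eval₂Hom (eval₂Hom (C : ℂ →+* K d) (co zK (uK j))) (pt zK TK (uK j))

lemma evK_Th (j : ℕ) (z : Z9 d → ℂ) (T : Fin 5 → ℂ) (u : Fin 9 → ℂ) (w : R d) :
    evK z T u (Th d j w) = ev (pt z T (tr j u)) (co z (tr j u)) w := by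
  have : (evK z T u).comp (Th d j) = ev (pt z T (tr j u)) (co z (tr j u)) := by
    apply MvPolynomial.ringHom_ext
    · intro r
      simp only [Th, ev, RingHom.comp_apply, coe_eval₂Hom, eval₂_C]
      induction r using MvPolynomial.induction_on with
      | C c => simp [evK]
      | add p q hp hq => simp only [eval₂_add, map_add, hp, hq]
      | mul_X p i hp =>
        simp only [eval₂_mul, map_mul, hp, eval₂_X, eval_X]
        rw [co_map, evK_z, evK_u]
    · intro i
      simp only [Th, ev, RingHom.comp_apply, coe_eval₂Hom, eval₂_X]
      rw [pt_map, evK_z, evK_T, evK_u]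
  rw [← this]; rfl

/-- the ideals of the strata -/
def P (d j : ℕ) : Ideal (R d) := RingHom.ker (Th d j)

instance (j : ℕ) : (P d j).IsPrime := RingHom.ker_isPrime _

lemma K_ext {p : K d} (h : ∀ z T u, evK z T u p = 0) : p = 0 := by
  apply MvPolynomial.funext
  intro x
  rw [map_zero, ← h (fun i => x (Sum.inl i)) (fun i => x (Sum.inr (Sum.inl i))) (fun i => x (Sum.inr (Sum.inr i)))]
  unfold evK
  congr 2
  funext i
  rcases i with i | i | i <;> rfl

lemma tr_eq {j : ℕ} {u : Fin 9 → ℂ} (h : ∀ i : Fin 9, (i : ℕ) < j → u i = 0) : tr j u = u := by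
  funext i; unfold tr; split_ifs with h1
  · exact (h i h1).symm
  · rfl

lemma mem_P {j : ℕ} {w : R d} : w ∈ P d j ↔ ∀ z T u, (∀ i : Fin 9, (i : ℕ) < j → u i = 0) →
    ev (pt z T u) (co z u) w = 0 := by
  constructor
  · intro h z T u hu
    have := evK_Th j z T u w
    rw [tr_eq hu] at this
    rw [← this, show Th d j w = 0 from h, map_zero]
  · intro h
    apply K_ext
    intro z T u
    rw [evK_Th]
    apply h
    intro i hi
    simp [tr, hi]

lemma mem_P_of {j : ℕ} {v w : R d} (hv : v ∉ P d j) (h : ∀ z T u, (∀ i : Fin 9, (i : ℕ) < j → u i = 0) →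
    ev (pt z T u) (co z u) v ≠ 0 → ev (pt z T u) (co z u) w = 0) : w ∈ P d j := by
  have : v * w ∈ P d j := by
    rw [mem_P]
    intro z T u hu
    rw [map_mul]
    by_cases hh : ev (pt z T u) (co z u) v = 0
    · rw [hh, zero_mul]
    · rw [h z T u hu hh, mul_zero]
  exact ((inferInstance : (P d j).IsPrime).mem_or_mem this).resolve_left hv

lemma P_mono (j : ℕ) : P d j ≤ P d (j + 1) := by
  intro w hw
  rw [mem_P] at hw ⊢
  exact fun z T u hu => hw z T u fun i hi => hu i (by omega)

/-- product of chart denominators -/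
def bb (d : ℕ) : R d := X (Sum.inl (0, 1)) * X (Sum.inl (1, 2)) * X (Sum.inl (2, 2)) * X (Sum.inl (3, 2)) *
  X (Sum.inr 0)

def sX (d : ℕ) (j : Fin 9) : R d := sval X j
def tX (d : ℕ) (j : Fin 9) : R d := tval X (fun i => C (X i)) j

lemma ev_sX (y : I → ℂ) (τ : Sg d → ℂ) (j : Fin 9) : ev y τ (sX d j) = sval y j := by
  rw [sX, sval_map]; congr 1; funext i; simp [ev]
lemma ev_tX (y : I → ℂ) (τ : Sg d → ℂ) (j : Fin 9) : ev y τ (tX d j) = tval y τ j := by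
  rw [tX, tval_map]; congr 1 <;> funext i <;> simp [ev]

lemma ev_bb (y : I → ℂ) (τ : Sg d → ℂ) : ev y τ (bb d) =
    vec y 0 1 * vec y 1 2 * vec y 2 2 * vec y 3 2 * y (Sum.inr 0) := by
  simp [bb, ev_X, vec]

lemma bb_pt (z : Z9 d → ℂ) (T : Fin 5 → ℂ) (u : Fin 9 → ℂ) (τ : Sg d → ℂ) :
    ev (pt z T u) τ (bb d) = ∏ i, T i := by
  rw [ev_bb]
  simp [vec, pt, vecs, Fin.prod_univ_five]

lemma P_zero (hd : 6 ≤ d) : P d 0 = ⊥ := by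
  rw [eq_bot_iff]
  intro w hw
  rw [mem_P] at hw
  have hb : bb d ≠ 0 := by simp [bb, X_ne_zero]
  have : bb d * w = 0 := by
    apply ev_ext
    intro y τ
    rw [map_mul]
    by_cases h : ev y τ (bb d) = 0
    · rw [h, zero_mul]
    · rw [ev_bb] at h
      simp only [mul_ne_zero_iff] at h
      obtain ⟨z, T, u, h1, h2⟩ := chart_surj hd y τ h.1.1.1.1 h.1.1.1.2 h.1.1.2 h.1.2 h.2
      rw [← h1, ← h2, hw z T u (by simp), mul_zero]
  exact (mul_eq_zero.mp this).resolve_left hb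

/-! group action -/
def Ph (d : ℕ) (g : Fin 4 → ℂ) : R d →+* R d :=
  eval₂Hom (eval₂Hom ((C : A d →+* R d).comp (C : ℂ →+* A d)) (actT (fun i => C (C (g i))) (fun i => C (X i))))
    (actY (fun i => C (C (g i))) X)

lemma ev_Ph (g : Fin 4 → ℂ) (y : I → ℂ) (τ : Sg d → ℂ) (w : R d) :
    ev y τ (Ph d g w) = ev (actY g y) (actT g τ) w := by
  have hg : (ev y τ) ∘ (fun i => C (C (g i))) = g := by funext i; simp [ev]
  have hy : (ev y τ) ∘ (X : I → R d) = y := by funext i; simp [ev]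
  have ht : (ev y τ) ∘ (fun i => C (X i)) = τ := by funext i; simp [ev]
  have : (ev y τ).comp (Ph d g) = ev (actY g y) (actT g τ) := by
    apply MvPolynomial.ringHom_ext
    · intro r
      simp only [Ph, RingHom.comp_apply, coe_eval₂Hom, eval₂_C]
      conv_rhs => simp only [ev, coe_eval₂Hom, eval₂_C]
      induction r using MvPolynomial.induction_on with
      | C c => simp [ev]
      | add p q hp hq => simp only [eval₂_add, map_add, hp, hq]
      | mul_X p i hp =>
        simp only [eval₂_mul, map_mul, hp, eval₂_X, eval_X]
        rw [actT_map, hg, ht]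
    · intro i
      simp only [Ph, RingHom.comp_apply, coe_eval₂Hom, eval₂_X]
      rw [actY_map, hg, hy]; simp [ev]
  rw [← this]; rfl

lemma Ph_inv (g : Fin 4 → ℂ) (w : R d) : Ph d g (Ph d (ginv g) w) = w := by
  rw [← sub_eq_zero]
  apply ev_ext
  intro y τ
  rw [map_sub, ev_Ph, ev_Ph, actY_inv, actT_inv, sub_self]

end TT
end Mod8

section Mod9
namespace TT
open MvPolynomial
variable {d : ℕ}

def TT0 (d : ℕ) : K d := ∏ i, TK i

/-- elements liftable up to a power of the denominator -/
def US (d : ℕ) : Subring (K d) where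
  carrier := {y | ∃ N : ℕ, ∃ Y, Th d 0 Y = TT0 d ^ N * y}
  one_mem' := ⟨0, 1, by simp⟩
  zero_mem' := ⟨0, 0, by simp⟩
  mul_mem' := by
    rintro a b ⟨N, Y, h⟩ ⟨N', Y', h'⟩
    exact ⟨N + N', Y * Y', by rw [map_mul, h, h']; ring⟩
  add_mem' := by
    rintro a b ⟨N, Y, h⟩ ⟨N', Y', h'⟩
    refine ⟨N + N', (bb d) ^ N' * Y + (bb d) ^ N * Y', ?_⟩
    have hb : Th d 0 (bb d) = TT0 d := by
      simp [Th, bb, TT0, Fin.prod_univ_five, pt, vecs]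
    rw [map_add, map_mul, map_mul, map_pow, map_pow, hb, h, h']; ring
  neg_mem' := by
    rintro a ⟨N, Y, h⟩
    exact ⟨N, -Y, by rw [map_neg, h]; ring⟩

lemma US_Th (Y : R d) : Th d 0 Y ∈ US d := ⟨0, Y, by simp⟩

lemma US_div {y c : K d} (hc : ∃ e, c * e = TT0 d ∧ e ∈ US d) (h : c * y ∈ US d) : y ∈ US d := by
  obtain ⟨e, he, he'⟩ := hc
  obtain ⟨N, Y, h1⟩ := (US d).mul_mem he' h
  exact ⟨N + 1, Y, by rw [h1, pow_succ, ← he]; ring⟩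

lemma uK0 : (uK 0 : Fin 9 → K d) = fun i => X (Sum.inr (Sum.inr i)) := by
  funext i; simp [uK]

lemma Th_X (i : I) : Th d 0 (X i) = pt zK TK (uK 0) i := by simp [Th]
lemma Th_CX (i : Sg d) : Th d 0 (C (X i)) = co zK (uK 0) i := by simp [Th]
lemma Th_CC (c : ℂ) : Th d 0 (C (C c)) = C c := by simp [Th]

lemma US_T (i : Fin 5) : (TK i : K d) ∈ US d := by
  fin_cases i
  · have := US_Th (d := d) (X (Sum.inl (0,1))); rw [Th_X] at this; simpa [pt, vecs] using this
  · have := US_Th (d := d) (X (Sum.inl (1,2))); rw [Th_X] at this; simpa [pt, vecs] using this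
  · have := US_Th (d := d) (X (Sum.inl (2,2))); rw [Th_X] at this; simpa [pt, vecs] using this
  · have := US_Th (d := d) (X (Sum.inl (3,2))); rw [Th_X] at this; simpa [pt, vecs] using this
  · have := US_Th (d := d) (X (Sum.inr 0)); rw [Th_X] at this; simpa [pt, vecs] using this

lemma US_divT (i : Fin 5) {y : K d} (h : TK i * y ∈ US d) : y ∈ US d := by
  refine US_div ⟨∏ j ∈ Finset.univ.erase i, TK j, ?_, ?_⟩ h
  · exact Finset.mul_prod_erase _ _ (Finset.mem_univ i)
  · exact (US d).prod_mem fun j _ => US_T j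

lemma US_a : pa zK ∈ US d := by
  apply US_divT 0
  have := US_Th (d := d) (-X (Sum.inl (0,0))); rw [map_neg, Th_X] at this; simpa [pt, vecs] using this
lemma US_b : pb zK ∈ US d := by
  apply US_divT 0
  have := US_Th (d := d) (-X (Sum.inl (0,2))); rw [map_neg, Th_X] at this; simpa [pt, vecs] using this
lemma US_c : pc zK ∈ US d := by
  apply US_divT 4
  have := US_Th (d := d) (X (Sum.inr 1)); rw [Th_X] at this; simpa [pt, vecs] using this
lemma US_x (k : Fin 3) : px zK k ∈ US d := by
  fin_cases k
  · apply US_divT 1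
    have := US_Th (d := d) (X (Sum.inl (1,0))); rw [Th_X] at this; simpa [pt, vecs] using this
  · apply US_divT 2
    have := US_Th (d := d) (X (Sum.inl (2,0))); rw [Th_X] at this; simpa [pt, vecs] using this
  · apply US_divT 3
    have := US_Th (d := d) (X (Sum.inl (3,0))); rw [Th_X] at this; simpa [pt, vecs] using this
lemma US_add' {a b : K d} (ha : a ∈ US d) (h : a + b ∈ US d) : b ∈ US d := by
  have := (US d).sub_mem h ha; simpa using this
lemma US_u0 : uK 0 0 ∈ US d := by
  apply US_add' ((US d).add_mem ((US d).mul_mem US_a (US_x 0)) US_b)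
  apply US_divT 1
  have := US_Th (d := d) (X (Sum.inl (1,1))); rw [Th_X] at this; simpa [pt, vecs] using this
lemma US_u1 : uK 0 1 ∈ US d := by
  apply US_add' ((US d).add_mem ((US d).mul_mem US_a (US_x 1)) US_b)
  apply US_divT 2
  have := US_Th (d := d) (X (Sum.inl (2,1))); rw [Th_X] at this; simpa [pt, vecs] using this
lemma US_u2 : uK 0 2 ∈ US d := by
  apply US_add' ((US d).add_mem ((US d).mul_mem US_a (US_x 2)) US_b)
  apply US_divT 3
  have := US_Th (d := d) (X (Sum.inl (3,1))); rw [Th_X] at this; simpa [pt, vecs] using this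
lemma US_G (m : E d) : pG zK m ∈ US d := by
  have := US_Th (d := d) (C (X (Sum.inr m))); rw [Th_CX] at this; simpa [co] using this
lemma US_F (m : E d) : Fco zK (uK 0) m ∈ US d := by
  have := US_Th (d := d) (C (X (Sum.inl m))); rw [Th_CX] at this; simpa [co] using this

/-- polynomials with coefficients in a subring -/
def PolyIn {S : Type} [CommRing S] (U : Subring S) (Q : Polynomial S) : Prop :=
  ∃ Q' : Polynomial U, Q'.map U.subtype = Q

lemma PolyIn.peel {S : Type} [CommRing S] {U : Subring S} {u x : S} {h : Polynomial S} (hx : x ∈ U)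
    (hQ : PolyIn U (Polynomial.C u + (Polynomial.X - Polynomial.C x) * h)) : u ∈ U ∧ PolyIn U h := by
  obtain ⟨Q', hQ'⟩ := hQ
  obtain ⟨x, rfl⟩ : ∃ x' : U, U.subtype x' = x := ⟨⟨x, hx⟩, rfl⟩
  have h1 := congrArg (Polynomial.eval (U.subtype x)) hQ'
  rw [Polynomial.eval_map_apply] at h1
  simp only [Polynomial.eval_add, Polynomial.eval_mul, Polynomial.eval_C, Polynomial.eval_sub, Polynomial.eval_X,
    sub_self, zero_mul, add_zero] at h1
  refine ⟨h1 ▸ (Q'.eval x).2, Q' /ₘ (Polynomial.X - Polynomial.C x), ?_⟩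
  have h2 := congrArg (Polynomial.map U.subtype) (Polynomial.modByMonic_add_div Q' (Polynomial.X - Polynomial.C x))
  rw [Polynomial.modByMonic_X_sub_C_eq_C_eval, hQ'] at h2
  simp only [Polynomial.map_add, Polynomial.map_mul, Polynomial.map_sub, Polynomial.map_X, Polynomial.map_C, h1] at h2
  have h3 := add_left_cancel h2
  exact (Polynomial.monic_X_sub_C _).isRegular.left h3

lemma US_nest (hd : 6 ≤ d) : PolyIn (US d) (nest zK (uK 0)) := by
  rw [← restr_Fco hd]
  refine ⟨restr ⟨_, US_a⟩ ⟨_, US_b⟩ (form (fun m => ⟨_, US_F m⟩) + (⟨_, US_c⟩ : US d) • form (fun m => ⟨_, US_G m⟩)), ?_⟩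
  rw [restr_map, map_add, smul_eq_C_mul, map_mul, map_C, form_map, form_map, smul_eq_C_mul]
  rfl

lemma US_top (hd : 6 ≤ d) (y : K d) : y ∈ US d := by
  obtain ⟨h3, p⟩ := (US_nest hd).peel (US_x 0)
  obtain ⟨h4, p⟩ := p.peel (US_x 0)
  obtain ⟨h5, p⟩ := p.peel (US_x 1)
  obtain ⟨h6, p⟩ := p.peel (US_x 1)
  obtain ⟨h7, p⟩ := p.peel (US_x 2)
  obtain ⟨h8, p⟩ := p.peel (US_x 2)
  have hu : ∀ i, (X (Sum.inr (Sum.inr i)) : K d) ∈ US d := by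
    intro i
    have := uK0 (d := d)
    have h : uK 0 i ∈ US d := by
      fin_cases i
      exacts [US_u0, US_u1, US_u2, h3, h4, h5, h6, h7, h8]
    rwa [this] at h
  have hB : ∀ k, (zK (Sum.inr (Sum.inl k)) : K d) ∈ US d := by
    intro k
    obtain ⟨Q', hQ'⟩ := p
    have := congrArg (fun q => Polynomial.coeff q k) hQ'
    simp only [Polynomial.coeff_map, Bpoly, Polynomial.finsetSum_coeff, Polynomial.coeff_C_mul, Polynomial.coeff_X_pow] at this
    rw [Finset.sum_eq_single k (fun b _ hb => by rw [if_neg (fun h => hb (Fin.ext h.symm)), mul_zero]) (by simp)] at this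
    simp at this
    rw [← this]; exact (Q'.coeff k).2
  induction y using MvPolynomial.induction_on with
  | C c => rw [← Th_CC]; exact US_Th _
  | add p q hp hq => exact (US d).add_mem hp hq
  | mul_X p i hp =>
    refine (US d).mul_mem hp ?_
    rcases i with (i | i | i | i) | i | i
    · fin_cases i
      exacts [US_a, US_b, US_c, US_x 0, US_x 1, US_x 2]
    · exact hB i
    · have := US_F i.1
      simp only [Fco, i.2, if_false, nonpure] at this
      exact this
    · exact US_G i
    · exact US_T i
    · exact hu i

lemma lift_K (hd : 6 ≤ d) (y : K d) : ∃ N : ℕ, ∃ Y : R d, ∀ z T u,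
    ev (pt z T u) (co z u) Y = (∏ i, T i) ^ N * evK z T u y := by
  obtain ⟨N, Y, h⟩ := US_top hd y
  refine ⟨N, Y, fun z T u => ?_⟩
  have := evK_Th 0 z T u Y
  rw [tr_eq (by simp)] at this
  rw [← this, h, map_mul, map_pow]
  congr 2
  simp [TT0, evK, TK]

lemma X_dvd_of {σ : Type} [DecidableEq σ] (i : σ) (p : MvPolynomial σ ℂ)
    (h : ∀ x : σ → ℂ, x i = 0 → eval x p = 0) : X i ∣ p := by
  have h1 : aeval (fun j => if j = i then (0 : MvPolynomial σ ℂ) else X j) p = 0 := by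
    apply MvPolynomial.funext
    intro x
    have h0 := h (fun j => if j = i then 0 else x j) (by simp)
    rw [map_zero, ← h0, aeval_def, eval₂_comp_left (eval x)]
    rw [eval, coe_eval₂Hom]
    congr 1
    · ext c; simp
    · funext j; simp only [Function.comp_apply]; split_ifs <;> simp
  have h2 : ∀ q : MvPolynomial σ ℂ, X i ∣ q - aeval (fun j => if j = i then (0 : MvPolynomial σ ℂ) else X j) q := by
    intro q
    induction q using MvPolynomial.induction_on with
    | C c => simp
    | add p q hp hq =>
      rw [map_add, add_sub_add_comm]; exact dvd_add hp hq
    | mul_X p j hp =>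
      rw [map_mul, aeval_X]
      split_ifs with hj
      · subst hj; simp
      · rw [← sub_mul]; exact hp.mul_right _
  have := h2 p
  rwa [h1, sub_zero] at this

lemma dvd_pow_T {S : Type} [CommRing S] {t x y : S} (hx : ∃ k, x ∣ t ^ k) (hy : ∃ k, y ∣ t ^ k) :
    ∃ k, x * y ∣ t ^ k := by
  obtain ⟨k, hk⟩ := hx; obtain ⟨l, hl⟩ := hy
  exact ⟨k + l, by rw [pow_add]; exact mul_dvd_mul hk hl⟩

lemma dvd_pow_T' {S : Type} [CommRing S] (T : Fin 5 → S) (i : Fin 5) (n : ℕ) :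
    ∃ k, T i ^ n ∣ (∏ i, T i) ^ k := ⟨n, pow_dvd_pow_of_dvd (Finset.dvd_prod_of_mem _ (Finset.mem_univ i)) n⟩
lemma dvd_pow_T'' {S : Type} [CommRing S] (T : Fin 5 → S) (i : Fin 5) :
    ∃ k, T i ∣ (∏ i, T i) ^ k := ⟨1, by rw [pow_one]; exact (Finset.dvd_prod_of_mem _ (Finset.mem_univ i))⟩

lemma mL_dvd {S : Type} [CommRing S] (T : Fin 5 → S) (j : Fin 9) : ∃ k, mL T j ∣ (∏ i, T i) ^ k := by
  have h1 : ∃ k, (1 : S) ∣ (∏ i, T i) ^ k := ⟨0, by simp⟩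
  fin_cases j
  exacts [h1, h1, h1, h1, h1, dvd_pow_T' T 1 2, dvd_pow_T' T 1 2, dvd_pow_T (dvd_pow_T' T 1 2) (dvd_pow_T' T 2 2),
    dvd_pow_T (dvd_pow_T' T 1 2) (dvd_pow_T' T 2 2)]

lemma mR_dvd {S : Type} [CommRing S] (T : Fin 5 → S) (j : Fin 9) : ∃ k, mR d T j ∣ (∏ i, T i) ^ k := by
  have h1 : ∃ k, (1 : S) ∣ (∏ i, T i) ^ k := ⟨0, by simp⟩
  fin_cases j
  exacts [dvd_pow_T (dvd_pow_T'' T 0) (dvd_pow_T'' T 1), dvd_pow_T (dvd_pow_T'' T 0) (dvd_pow_T'' T 2),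
    dvd_pow_T (dvd_pow_T'' T 0) (dvd_pow_T'' T 3), dvd_pow_T (dvd_pow_T'' T 4) (dvd_pow_T' T 1 _),
    dvd_pow_T (dvd_pow_T (dvd_pow_T'' T 4) (dvd_pow_T' T 1 _)) (dvd_pow_T'' T 0),
    dvd_pow_T (dvd_pow_T (dvd_pow_T'' T 4) (dvd_pow_T' T 2 _)) (dvd_pow_T' T 0 _),
    dvd_pow_T (dvd_pow_T (dvd_pow_T'' T 4) (dvd_pow_T' T 2 _)) (dvd_pow_T' T 0 _),
    dvd_pow_T (dvd_pow_T (dvd_pow_T'' T 4) (dvd_pow_T' T 3 _)) (dvd_pow_T' T 0 _),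
    dvd_pow_T (dvd_pow_T (dvd_pow_T'' T 4) (dvd_pow_T' T 3 _)) (dvd_pow_T' T 0 _)]

lemma mL_map {S S' : Type} [CommRing S] [CommRing S'] (φ : S →+* S') (T : Fin 5 → S) (j : Fin 9) :
    φ (mL T j) = mL (φ ∘ T) j := by
  fin_cases j <;> simp [mL]
lemma mR_map {S S' : Type} [CommRing S] [CommRing S'] (φ : S →+* S') (T : Fin 5 → S) (j : Fin 9) :
    φ (mR d T j) = mR d (φ ∘ T) j := by
  fin_cases j <;> simp [mR]

lemma evK_u' (z : Z9 d → ℂ) (T : Fin 5 → ℂ) (u : Fin 9 → ℂ) (i : Fin 9) :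
    evK z T u (X (Sum.inr (Sum.inr i))) = u i := by simp [evK]
lemma evK_TT0 (z : Z9 d → ℂ) (T : Fin 5 → ℂ) (u : Fin 9 → ℂ) : evK z T u (TT0 d) = ∏ i, T i := by
  simp [TT0, evK, TK]

lemma locA (hd : 6 ≤ d) (j : Fin 9) {w : R d} (hw : w ∈ P d (j + 1)) :
    ∃ N : ℕ, ∃ Y, bb d ^ N * (sX d j * w) - tX d j * Y ∈ P d j := by
  classical
  obtain ⟨c, hc⟩ : X (Sum.inr (Sum.inr j)) ∣ Th d j w := by
    apply X_dvd_of
    intro x hx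
    have h1 := evK_Th j (fun i => x (Sum.inl i)) (fun i => x (Sum.inr (Sum.inl i)))
      (fun i => x (Sum.inr (Sum.inr i))) w
    rw [mem_P.mp hw] at h1
    · convert h1 using 2
      unfold evK; congr 1
      funext i; rcases i with i | i | i <;> rfl
    · intro i hi
      simp only [tr]
      split_ifs with h
      · rfl
      · have : i = j := by apply Fin.ext; omega
        rw [this]; exact hx
  obtain ⟨k, e, he⟩ := mR_dvd (d := d) (TK : Fin 5 → K d) j
  obtain ⟨N, Y, hY⟩ := lift_K hd (mL TK j * e * c)
  refine ⟨N + k, Y, ?_⟩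
  rw [mem_P]
  intro z T u hu
  have h1 := evK_Th j z T u w
  rw [tr_eq hu, hc, map_mul, evK_u'] at h1
  have h2 := congrArg (evK z T u) he
  rw [map_pow, map_mul, mR_map, evK_T] at h2
  change evK z T u (TT0 d) ^ k = _ at h2
  rw [evK_TT0] at h2
  have h3 := rel hd z T u j (fun i hi => hu i hi)
  simp only [map_sub, map_mul, map_pow, bb_pt, ev_sX, ev_tX, hY, mL_map, evK_T]
  rw [← h1, pow_add, h2]
  linear_combination (-(∏ i, T i) ^ N * evK z T u e * evK z T u c) * h3

lemma locB (hd : 6 ≤ d) (j : Fin 9) :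
    ∃ N : ℕ, ∃ Y ∈ P d (j + 1), bb d ^ N * tX d j - sX d j * Y ∈ P d j := by
  obtain ⟨k, e, he⟩ := mL_dvd (TK : Fin 5 → K d) j
  obtain ⟨N, Y, hY⟩ := lift_K hd (mR d TK j * e * X (Sum.inr (Sum.inr j)))
  refine ⟨N + k, Y, ?_, ?_⟩
  · rw [mem_P]
    intro z T u hu
    rw [hY, map_mul, evK_u', hu j (by omega)]; ring
  rw [mem_P]
  intro z T u hu
  have h2 := congrArg (evK z T u) he
  rw [map_pow, map_mul, mL_map, evK_T] at h2
  change evK z T u (TT0 d) ^ k = _ at h2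
  rw [evK_TT0] at h2
  have h3 := rel hd z T u j (fun i hi => hu i hi)
  simp only [map_sub, map_mul, map_pow, bb_pt, ev_sX, ev_tX, hY, mR_map, evK_T, evK_u']
  rw [pow_add, h2]
  linear_combination ((∏ i, T i) ^ N * evK z T u e) * h3

end TT
end Mod9

section Mod10
namespace TT
open MvPolynomial
variable {d : ℕ}

/-- open condition -/
def EE (d : ℕ) : R d := bb d * ∏ j, sX d j

def zpt (d : ℕ) (x : Fin 3 → ℂ) : Z9 d → ℂ := Sum.elim ![0, 0, 0, x 0, x 1, x 2] 0

lemma exists_x (α : ℂ) : ∃ x : Fin 3 → ℂ, x 0 ≠ x 1 ∧ x 0 ≠ x 2 ∧ x 1 ≠ x 2 ∧ ∀ i, 1 + α * x i ≠ 0 := by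
  by_cases h : α = 0
  · refine ⟨![0, 1, 2], by simp, by simp, ?_, by simp [h]⟩
    change (1 : ℂ) ≠ 2
    norm_num
  · refine ⟨![0, 1 / α, 2 / α], by simp [h, eq_comm], ?_, ?_, ?_⟩
    · change (0 : ℂ) ≠ 2 / α
      exact (div_ne_zero two_ne_zero h).symm
    · simp; field_simp; norm_num
    · intro i; fin_cases i
      · simp
      · simp; field_simp; norm_num
      · simp; field_simp; norm_num

lemma EE_pt (g : Fin 4 → ℂ) : ∃ z : Z9 d → ℂ, ∀ u : Fin 9 → ℂ, u 0 = 0 → u 1 = 0 → u 2 = 0 →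
    (∏ j, sval (pt z 1 u) j ≠ 0) ∧ ∀ τ, ev (actY g (pt z 1 u)) τ (EE d) ≠ 0 := by
  obtain ⟨x, h1, h2, h3, hx⟩ := exists_x (g 0)
  refine ⟨zpt d x, fun u hu0 hu1 hu2 => ?_⟩
  have px0 : px (zpt d x) 0 = x 0 := rfl
  have px1 : px (zpt d x) 1 = x 1 := rfl
  have px2 : px (zpt d x) 2 = x 2 := rfl
  have pa0 : pa (zpt d x) = 0 := rfl
  have pb0 : pb (zpt d x) = 0 := rfl
  have pc0 : pc (zpt d x) = 0 := rfl
  have e1 : x 1 - x 0 ≠ 0 := sub_ne_zero.mpr h1.symm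
  have e2 : x 2 - x 0 ≠ 0 := sub_ne_zero.mpr h2.symm
  have e3 : x 2 - x 1 ≠ 0 := sub_ne_zero.mpr h3.symm
  have k1 : (1 + g 0 * x 0) * x 1 - x 0 * (1 + g 0 * x 1) ≠ 0 := by convert e1 using 1; ring
  have k2 : (1 + g 0 * x 0) * x 2 - x 0 * (1 + g 0 * x 2) ≠ 0 := by convert e2 using 1; ring
  have k3 : (1 + g 0 * x 1) * x 2 - x 1 * (1 + g 0 * x 2) ≠ 0 := by convert e3 using 1; ring
  constructor
  · rw [Finset.prod_ne_zero_iff]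
    intro j _
    fin_cases j <;> simp [sval, vec, pt, vecs, cr, px0, px1, px2, pa0, pb0, pc0, e1, e2, e3]
  · intro τ
    rw [EE, map_mul, ev_bb, map_prod, mul_ne_zero_iff, Finset.prod_ne_zero_iff]
    constructor
    · simp [vec, pt, vecs, actY, actl, actp, px0, px1, px2, pa0, pb0, pc0, hx, hu0, hu1, hu2]
    · intro j _
      rw [ev_sX]
      fin_cases j <;> simp [sval, vec, pt, vecs, actY, actl, actp, cr, px0, px1, px2, pa0, pb0, pc0, hx, hu0, hu1, hu2, k1, k2, k3]

lemma PhEE_not (j : ℕ) (g : Fin 4 → ℂ) : Ph d g (EE d) ∉ P d j := by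
  intro h
  rw [mem_P] at h
  obtain ⟨z, hz⟩ := EE_pt (d := d) g
  have := h z 1 0 (by simp)
  rw [ev_Ph] at this
  exact (hz 0 rfl rfl rfl).2 _ this

lemma act_zero (y : I → ℂ) : actY 0 y = y := by
  funext i
  rcases i with ⟨k, i⟩ | i
  · fin_cases k <;> fin_cases i <;> simp [actY, actl, actp, vec]
  · fin_cases i <;> simp [actY]

lemma EE_not (j : ℕ) : EE d ∉ P d j := by
  intro h
  rw [mem_P] at h
  obtain ⟨z, hz⟩ := EE_pt (d := d) 0
  have h1 := h z 1 0 (by simp)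
  have := (hz 0 rfl rfl rfl).2
  rw [act_zero] at this
  exact this _ h1

lemma bb_not (j : ℕ) : bb d ∉ P d j := fun h => EE_not j (Ideal.mul_mem_right _ _ h)
lemma Phbb_not (j : ℕ) (g : Fin 4 → ℂ) : Ph d g (bb d) ∉ P d j := fun h =>
  PhEE_not j g (by rw [EE, map_mul]; exact Ideal.mul_mem_right _ _ h)
lemma sX_not (i : Fin 9) (j : ℕ) : sX d i ∉ P d j := fun h => EE_not j (by
  rw [EE, Finset.prod_eq_mul_prod_sdiff_singleton_of_mem (Finset.mem_univ i)]
  exact Ideal.mul_mem_left _ _ (Ideal.mul_mem_right _ _ h))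
lemma PhsX_not (i : Fin 9) (j : ℕ) (g : Fin 4 → ℂ) : Ph d g (sX d i) ∉ P d j := fun h => PhEE_not j g (by
  rw [EE, Finset.prod_eq_mul_prod_sdiff_singleton_of_mem (Finset.mem_univ i), map_mul, map_mul]
  exact Ideal.mul_mem_left _ _ (Ideal.mul_mem_right _ _ h))

lemma mL_ne {T : Fin 5 → ℂ} (hT : ∏ i, T i ≠ 0) (j : Fin 9) : mL T j ≠ 0 := by
  obtain ⟨k, e, he⟩ := mL_dvd T j
  intro h
  rw [h, zero_mul] at he
  exact pow_ne_zero k hT he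
lemma mR_ne {T : Fin 5 → ℂ} (hT : ∏ i, T i ≠ 0) (j : Fin 9) : mR d T j ≠ 0 := by
  obtain ⟨k, e, he⟩ := mR_dvd (d := d) T j
  intro h
  rw [h, zero_mul] at he
  exact pow_ne_zero k hT he

lemma tX_not (hd : 6 ≤ d) (j : Fin 9) : tX d j ∉ P d j := by
  intro h
  rw [mem_P] at h
  obtain ⟨z, hz⟩ := EE_pt (d := d) 0
  by_cases hj : 3 ≤ (j : ℕ)
  · have h1 := h z 1 (Pi.single j 1) (fun i hi => Pi.single_eq_of_ne (fun h => by rw [h] at hi; omega) _)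
    have h2 := rel hd z 1 (Pi.single j 1) j (fun i hi => Pi.single_eq_of_ne (fun h => by rw [h] at hi; exact lt_irrefl _ hi) _)
    rw [ev_tX] at h1
    rw [h1, zero_mul, Pi.single_eq_same, mul_one] at h2
    have h3 := (hz (Pi.single j 1) (Pi.single_eq_of_ne (fun h => by rw [← h] at hj; simp at hj) _)
      (Pi.single_eq_of_ne (fun h => by rw [← h] at hj; simp at hj) _)
      (Pi.single_eq_of_ne (fun h => by rw [← h] at hj; simp at hj) _)).1
    rw [Finset.prod_ne_zero_iff] at h3
    exact mul_ne_zero (h3 j (Finset.mem_univ _)) (mR_ne (by simp) j) h2.symm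
  · have h1 := h z 1 (Pi.single j 1) (fun i hi => Pi.single_eq_of_ne (fun h => by rw [h] at hi; omega) _)
    have h2 := rel hd z 1 (Pi.single j 1) j (fun i hi => Pi.single_eq_of_ne (fun h => by rw [h] at hi; exact lt_irrefl _ hi) _)
    rw [ev_tX] at h1
    rw [h1, zero_mul, Pi.single_eq_same, mul_one] at h2
    have h3 : sval (pt z 1 (Pi.single j 1)) j = 1 := by
      fin_cases j <;> first | rfl | (exfalso; simp at hj)
    rw [h3, one_mul] at h2
    exact mR_ne (by simp) j h2.symm

lemma tval_zero (hd : 6 ≤ d) {z : Z9 d → ℂ} {T : Fin 5 → ℂ} {u : Fin 9 → ℂ} {j : ℕ}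
    (hu : ∀ i : Fin 9, (i : ℕ) < j → u i = 0)
    (hT : ∏ i, T i ≠ 0) (i : Fin 9) (hi : (i : ℕ) < j) : tval (pt z T u) (co z u) i = 0 := by
  have := rel hd z T u i (fun k hk => hu k (lt_trans hk hi))
  rw [hu i hi, mul_zero, zero_mul] at this
  exact (mul_eq_zero.mp this).resolve_right (mL_ne hT i)

lemma Ph_P (hd : 6 ≤ d) (j : ℕ) (g : Fin 4 → ℂ) {w : R d} (hw : w ∈ P d j) : Ph d g w ∈ P d j := by
  have hv : EE d * Ph d g (EE d) ∉ P d j := fun h =>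
    ((inferInstance : (P d j).IsPrime).mem_or_mem h).elim (EE_not j) (PhEE_not j g)
  refine mem_P_of hv ?_
  intro z T u hu hne
  rw [map_mul, ev_Ph, EE, map_mul, map_mul, map_prod, map_prod] at hne
  simp only [mul_ne_zero_iff, Finset.prod_ne_zero_iff, Finset.mem_univ, true_imp_iff, ev_sX] at hne
  obtain ⟨⟨hb, hs⟩, hb', hs'⟩ := hne
  rw [bb_pt] at hb
  rw [ev_bb] at hb'
  simp only [mul_ne_zero_iff] at hb'
  rw [ev_Ph]
  obtain ⟨z', T', u', h1, h2⟩ := chart_surj hd (actY g (pt z T u)) (actT g (co z u)) hb'.1.1.1.1 hb'.1.1.1.2 hb'.1.1.2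
    hb'.1.2 hb'.2
  have hT' : ∏ i, T' i ≠ 0 := by
    rw [← bb_pt z' T' u' 0, h1, ev_bb]
    simp only [mul_ne_zero_iff]; exact hb'
  have h0 : vec (pt z T u) 0 1 ≠ 0 := by
    have : vec (pt z T u) 0 1 = T 0 := by simp [vec, pt, vecs]
    rw [this]; rw [Finset.prod_ne_zero_iff] at hb; exact hb 0 (Finset.mem_univ _)
  have key : ∀ n (i : Fin 9), (i : ℕ) = n → (i : ℕ) < j → u' i = 0 := by
    intro n
    induction n using Nat.strong_induction_on with
    | _ n ih =>
      intro i hi hij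
      have hc := cross g _ (co z u) h0 i (fun k hk => tval_zero hd hu hb k (lt_trans hk hij))
      rw [tval_zero hd hu hb i hij, zero_mul] at hc
      have ht := (mul_eq_zero.mp hc.symm).resolve_left (hs i)
      have hr := rel hd z' T' u' i (fun k hk => ih k (by rw [← hi]; exact hk) k rfl (lt_trans hk hij))
      rw [h1, h2, ht, zero_mul] at hr
      rcases mul_eq_zero.mp hr.symm with h | h
      · exact (mul_eq_zero.mp h).resolve_left (hs' i)
      · exact absurd h (mR_ne hT' i)
  rw [← h1, ← h2]
  exact mem_P.mp hw z' T' u' fun i hi => key i i rfl hi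

lemma crossR (hd : 6 ≤ d) (g : Fin 4 → ℂ) (j : Fin 9) :
    tX d j * Ph d g (sX d j) - sX d j * Ph d g (tX d j) ∈ P d j := by
  refine mem_P_of (bb_not j) ?_
  intro z T u hu hb
  rw [bb_pt] at hb
  have h0 : vec (pt z T u) 0 1 ≠ 0 := by
    have : vec (pt z T u) 0 1 = T 0 := by simp [vec, pt, vecs]
    rw [this]; rw [Finset.prod_ne_zero_iff] at hb; exact hb 0 (Finset.mem_univ _)
  have hc := cross g _ (co z u) h0 j (fun k hk => tval_zero hd hu hb k hk)
  simp only [map_sub, map_mul, ev_Ph, ev_sX, ev_tX]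
  rw [hc, sub_self]

lemma gloA (hd : 6 ≤ d) (j : Fin 9) (g : Fin 4 → ℂ) {w : R d} (hw : w ∈ P d (j + 1)) :
    ∃ N : ℕ, ∃ Y, Ph d g (bb d) ^ N * (sX d j * w) - tX d j * Y ∈ P d j := by
  obtain ⟨N, Y, h⟩ := locA hd j (Ph_P hd _ (ginv g) hw)
  refine ⟨N, Ph d g Y, ?_⟩
  have h1 := Ph_P hd _ g h
  simp only [map_sub, map_mul, map_pow, Ph_inv] at h1
  have h2 : Ph d g (sX d j) * (Ph d g (bb d) ^ N * (sX d j * w) - tX d j * Ph d g Y) ∈ P d j := by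
    have := (P d j).sub_mem (Ideal.mul_mem_left _ (sX d j) h1) (Ideal.mul_mem_left _ (Ph d g Y) (crossR hd g j))
    convert this using 1
    ring
  exact ((inferInstance : (P d j).IsPrime).mem_or_mem h2).resolve_left (PhsX_not _ _ _)

lemma gloB (hd : 6 ≤ d) (j : Fin 9) (g : Fin 4 → ℂ) :
    ∃ N : ℕ, ∃ Y ∈ P d (j + 1), Ph d g (bb d) ^ N * tX d j - sX d j * Y ∈ P d j := by
  obtain ⟨N, Y, hY, h⟩ := locB hd j
  refine ⟨N, Ph d g Y, Ph_P hd _ g hY, ?_⟩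
  have h1 := Ph_P hd _ g h
  simp only [map_sub, map_mul, map_pow] at h1
  have h2 : Ph d g (sX d j) * (Ph d g (bb d) ^ N * tX d j - sX d j * Ph d g Y) ∈ P d j := by
    have := (P d j).add_mem (Ideal.mul_mem_left _ (sX d j) h1) (Ideal.mul_mem_left _ (Ph d g (bb d) ^ N) (crossR hd g j))
    convert this using 1
    ring
  exact ((inferInstance : (P d j).IsPrime).mem_or_mem h2).resolve_left (PhsX_not _ _ _)

end TT
end Mod10

section Mod11
namespace TT
open MvPolynomial
variable {d : ℕ}

def kk : I → Fin 5 := Sum.elim (fun kj => kj.1.castSucc) (fun _ => 4)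
def wt : I → (Fin 5 → ℕ) := fun i => Pi.single (kk i) 1

def psi (y : I → ℂ) (τ : Sg d → ℂ) : R d →+* MvPolynomial (Fin 5) ℂ :=
  eval₂Hom ((C : ℂ →+* _).comp (eval τ)) (fun i => X (kk i) * C (y i))

lemma weight_apply (e : I →₀ ℕ) (k : Fin 5) :
    Finsupp.weight wt e k = ∑ i, if kk i = k then e i else 0 := by
  rw [Finsupp.weight_apply, Finsupp.sum_fintype _ _ (by simp), Finset.sum_apply]
  refine Finset.sum_congr rfl fun i _ => ?_
  simp only [wt, Pi.smul_apply, Pi.single_apply, smul_eq_mul, eq_comm (a := k)]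
  split_ifs <;> simp

lemma coeff_psi (y : I → ℂ) (τ : Sg d → ℂ) (m : Fin 5 → ℕ) (f : R d) :
    coeff (Finsupp.equivFunOnFinite.symm m) (psi y τ f) = ev y τ (weightedHomogeneousComponent wt m f) := by
  classical
  induction f using MvPolynomial.induction_on' with
  | add p q hp hq => simp only [map_add, coeff_add, hp, hq]
  | monomial e c =>
    have h1 : psi y τ (monomial e c) = monomial (Finsupp.equivFunOnFinite.symm (Finsupp.weight wt e))
        (ev y τ (monomial e c)) := by
      simp only [psi, ev, coe_eval₂Hom, eval₂_monomial, RingHom.comp_apply]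
      rw [Finsupp.prod_fintype _ _ (by simp), Finsupp.prod_fintype _ _ (by simp)]
      simp only [mul_pow, Finset.prod_mul_distrib]
      have h2 : ∏ i, (X (kk i) : MvPolynomial (Fin 5) ℂ) ^ e i =
          monomial (Finsupp.equivFunOnFinite.symm (Finsupp.weight wt e)) 1 := by
        simp only [X_pow_eq_monomial]
        rw [← monomial_sum_one]
        congr 2
        ext k
        rw [Finsupp.finsetSum_apply]
        simp only [Finsupp.equivFunOnFinite_symm_apply_apply, weight_apply, Finsupp.single_apply]
      rw [h2]
      simp only [← map_pow, ← map_prod]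
      rw [mul_comm (monomial _ _), ← mul_assoc, ← map_mul, C_mul_monomial, mul_one]
    rw [h1, coeff_monomial]
    have hm := isWeightedHomogeneous_monomial wt e c rfl
    by_cases h : Finsupp.weight wt e = m
    · rw [if_pos (by rw [h]), ← h, hm.weightedHomogeneousComponent_same]
    · rw [if_neg (by simpa using h), hm.weightedHomogeneousComponent_ne _ (Ne.symm h), map_zero]

lemma pt_scale (z : Z9 d → ℂ) (T t : Fin 5 → ℂ) (u : Fin 9 → ℂ) (i : I) :
    pt z (t * T) u i = t (kk i) * pt z T u i := by
  rcases i with ⟨k, j⟩ | i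
  · fin_cases k <;> fin_cases j <;> simp [pt, vecs, kk] <;> ring_nf <;> rfl
  · fin_cases i <;> simp [pt, kk] ; ring_nf

lemma P_homog (j : ℕ) : HomogI wt (P d j) := by
  intro f hf m
  rw [mem_P] at hf ⊢
  intro z T u hu
  rw [← coeff_psi]
  have : psi (pt z T u) (co z u) f = 0 := by
    apply MvPolynomial.funext
    intro t
    rw [map_zero, ← hf z (t * T) u hu]
    have : (eval t).comp (psi (pt z T u) (co z u)) = ev (pt z (t * T) u) (co z u) := by
      apply MvPolynomial.ringHom_ext
      · intro r; simp [psi, ev]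
      · intro i; simp [psi, ev, pt_scale]
    rw [← this]; rfl
  rw [this, coeff_zero]

lemma finite_weight (m : Fin 5 → ℕ) : {e : I →₀ ℕ | Finsupp.weight wt e = m}.Finite := by
  have : {e : I →₀ ℕ | Finsupp.weight wt e = m} ⊆ Set.Iic (Finsupp.equivFunOnFinite.symm fun i => m (kk i)) := by
    intro e he
    simp only [Set.mem_setOf_eq] at he
    intro i
    rw [← he]
    simp only [Finsupp.equivFunOnFinite_symm_apply_apply, weight_apply]
    calc e i = if kk i = kk i then e i else 0 := by simp
      _ ≤ _ := Finset.single_le_sum (f := fun i' => if kk i' = kk i then e i' else 0) (by simp) (Finset.mem_univ i)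
  exact (Set.finite_Iic _).subset this

lemma W_finite (m : Fin 5 → ℕ) : Module.Finite (A d) (weightedHomogeneousSubmodule (A d) wt m) := by
  rw [weightedHomogeneousSubmodule_eq_finsupp_supported]
  have : Finite {e : I →₀ ℕ | Finsupp.weight wt e = m} := finite_weight m
  exact Module.Finite.of_basis (basisRestrictSupport (A d) {e : I →₀ ℕ | Finsupp.weight wt e = m})

lemma W_rank (m : Fin 5 → ℕ) : Module.finrank (A d) (weightedHomogeneousSubmodule (A d) wt m) =
    Nat.card {e : I →₀ ℕ | Finsupp.weight wt e = m} := by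
  rw [weightedHomogeneousSubmodule_eq_finsupp_supported]
  exact Module.finrank_eq_nat_card_basis (basisRestrictSupport (A d) {e : I →₀ ℕ | Finsupp.weight wt e = m})

def dS : Fin 9 → Fin 5 → ℕ := ![0, 0, 0, 0, ![0,1,0,0,0], ![0,2,2,0,0], ![0,2,3,0,0], ![0,2,2,4,0], ![0,2,2,5,0]]
def dT (d : ℕ) : Fin 9 → Fin 5 → ℕ := ![![1,1,0,0,0], ![1,0,1,0,0], ![1,0,0,1,0], ![0,d,0,0,1], ![1,d-1,0,0,1],
  ![2,0,d,0,1], ![3,0,d-1,0,1], ![4,0,0,d,1], ![5,0,0,d-1,1]]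

lemma IsWH.eval {σ : Type} {B : Type} [CommRing B] {n : ℕ} {w : σ → (Fin 5 → ℕ)} {F : MvPolynomial (Fin 3) (MvPolynomial σ B)}
    (hF : F.IsHomogeneous n) {c ω : Fin 5 → ℕ} (hc : ∀ m, IsWeightedHomogeneous w (coeff m F) c)
    {v : Fin 3 → MvPolynomial σ B} (hv : ∀ i, IsWeightedHomogeneous w (v i) ω) :
    IsWeightedHomogeneous w (eval v F) (c + n • ω) := by
  rw [eval_eq']
  refine IsWeightedHomogeneous.sum _ _ _ fun m hm => ?_
  refine (hc m).mul ?_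
  have := IsWeightedHomogeneous.prod Finset.univ (fun i => v i ^ m i) (fun i => m i • ω) (fun i _ => (hv i).pow _)
  convert this
  rw [← Finset.sum_smul]
  congr 1
  have h := hF (mem_support_iff.mp hm)
  rw [← h, Finsupp.weight_apply, Finsupp.sum_fintype _ _ (by simp)]
  simp

lemma wh (i : I) : IsWeightedHomogeneous wt (X i : R d) (wt i) := isWeightedHomogeneous_X _ _ _

abbrev FX (d : ℕ) : MvPolynomial (Fin 3) (R d) := Fc X (fun i => C (X i))

lemma FX_coeff (m : Fin 3 →₀ ℕ) : IsWeightedHomogeneous wt (coeff m (FX d)) (Pi.single 4 1) := by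
  classical
  have h1 : ∀ (f : E d → A d), IsWeightedHomogeneous wt (coeff m (form fun e => (C (f e) : R d))) 0 := by
    intro f
    simp only [form, coeff_sum, coeff_monomial]
    refine IsWeightedHomogeneous.sum _ _ _ fun e _ => ?_
    split_ifs
    · exact isWeightedHomogeneous_C _ _
    · exact isWeightedHomogeneous_zero _ _ _
  simp only [FX, Fc, coeff_add, coeff_smul, smul_eq_mul]
  have a := (wh (d := d) (Sum.inr 0)).mul (h1 fun e => X (Sum.inl e))
  have b := (wh (d := d) (Sum.inr 1)).mul (h1 fun e => X (Sum.inr e))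
  rw [add_zero] at a b
  exact a.add b

lemma wh_evalF (k : Fin 4) : IsWeightedHomogeneous wt (eval (vec X k) (FX d)) (Pi.single 4 1 + d • Pi.single k.castSucc 1) :=
  IsWH.eval (Fc_homog _ _) FX_coeff (fun i => wh (Sum.inl (k, i)))

lemma wh_DDF (k : Fin 4) : IsWeightedHomogeneous wt (DD (FX d) (vec X k) (wv (vec X 0)))
    (Pi.single 0 1 + (Pi.single 4 1 + (d - 1) • Pi.single k.castSucc 1)) := by
  unfold DD
  refine IsWeightedHomogeneous.sum _ _ _ fun i _ => IsWeightedHomogeneous.mul ?_ (IsWH.eval (Fc_homog _ _).pderiv ?_ (fun i => wh (Sum.inl (k, i))))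
  · fin_cases i
    · exact wh (Sum.inl (0, 1))
    · exact (wh (Sum.inl (0, 0))).neg
    · exact isWeightedHomogeneous_zero _ _ _
  · intro m
    rw [coeff_pderiv]
    have := (FX_coeff (d := d) (m + Finsupp.single i 1)).mul (isWeightedHomogeneous_C wt ((m i + 1 : ℕ) : A d))
    rw [add_zero] at this
    have e : (C ((m i + 1 : ℕ) : A d) : R d) = m i + 1 := by rw [map_natCast]; push_cast; rfl
    rw [e] at this
    exact this

lemma wh_cr (k l : Fin 4) : IsWeightedHomogeneous wt (cr (vec X k) (vec X l) : R d)
    (Pi.single k.castSucc 1 + Pi.single l.castSucc 1) :=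
  ((wh (Sum.inl (k, 2))).mul (wh (Sum.inl (l, 0)))).sub ((wh (Sum.inl (k, 0))).mul (wh (Sum.inl (l, 2))))

lemma wh_dot (k l : Fin 4) : IsWeightedHomogeneous wt (dot (vec X k) (vec X l) : R d)
    (Pi.single k.castSucc 1 + Pi.single l.castSucc 1) :=
  (((wh (Sum.inl (k, 0))).mul (wh (Sum.inl (l, 0)))).add ((wh (Sum.inl (k, 1))).mul (wh (Sum.inl (l, 1))))).add
    ((wh (Sum.inl (k, 2))).mul (wh (Sum.inl (l, 2))))

lemma wh_s (j : Fin 9) : IsWeightedHomogeneous wt (sX d j) (dS j) := by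
  have h1 : IsWeightedHomogeneous wt (1 : R d) 0 := isWeightedHomogeneous_one _ _
  fin_cases j
  · exact h1
  · exact h1
  · exact h1
  · exact h1
  · exact cast (by congr 1; decide) (wh (d := d) (Sum.inl (1, 2)))
  · exact cast (by congr 1; decide) ((wh_cr (d := d) 1 2).pow 2)
  · exact cast (by congr 1; decide) ((wh (d := d) (Sum.inl (2, 2))).mul ((wh_cr (d := d) 1 2).pow 2))
  · exact cast (by congr 1; decide) (((wh_cr (d := d) 1 3).pow 2).mul ((wh_cr (d := d) 2 3).pow 2))
  · exact cast (by congr 1; decide) ((wh (d := d) (Sum.inl (3, 2))).mul (((wh_cr (d := d) 1 3).pow 2).mul ((wh_cr (d := d) 2 3).pow 2)))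

lemma wh_t (hd : 6 ≤ d) (j : Fin 9) : IsWeightedHomogeneous wt (tX d j) (dT d j) := by
  fin_cases j
  · exact cast (by congr 1; funext i; fin_cases i <;> simp [dT]) (wh_dot (d := d) 0 1)
  · exact cast (by congr 1; funext i; fin_cases i <;> simp [dT]) (wh_dot (d := d) 0 2)
  · exact cast (by congr 1; funext i; fin_cases i <;> simp [dT]) (wh_dot (d := d) 0 3)
  · exact cast (by congr 1; funext i; fin_cases i <;> simp [dT]) (wh_evalF (d := d) 1)
  · exact cast (by congr 1; funext i; fin_cases i <;> simp [dT]) (wh_DDF (d := d) 1)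
  · exact cast (by congr 1; funext i; fin_cases i <;> simp [dT, wt, kk]) ((wh_evalF (d := d) 2).mul ((wh (d := d) (Sum.inl (0, 1))).pow 2))
  · exact cast (by congr 1; funext i; fin_cases i <;> simp [dT, wt, kk]) ((wh_DDF (d := d) 2).mul ((wh (d := d) (Sum.inl (0, 1))).pow 2))
  · exact cast (by congr 1; funext i; fin_cases i <;> simp [dT, wt, kk]) ((wh_evalF (d := d) 3).mul ((wh (d := d) (Sum.inl (0, 1))).pow 4))
  · exact cast (by congr 1; funext i; fin_cases i <;> simp [dT, wt, kk]) ((wh_DDF (d := d) 3).mul ((wh (d := d) (Sum.inl (0, 1))).pow 4))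

end TT
end Mod11

section Mod12
namespace TT
open MvPolynomial
variable {d : ℕ}

def bg (g : Fin 4 → ℂ) : MvPolynomial I ℂ :=
  actY (fun i => C (g i)) X (Sum.inl (0, 1)) * actY (fun i => C (g i)) X (Sum.inl (1, 2)) *
  actY (fun i => C (g i)) X (Sum.inl (2, 2)) * actY (fun i => C (g i)) X (Sum.inl (3, 2)) *
  actY (fun i => C (g i)) X (Sum.inr 0)

lemma Ph_bb (g : Fin 4 → ℂ) : Ph d g (bb d) = MvPolynomial.map (C : ℂ →+* A d) (bg g) := by
  have h : ∀ i, MvPolynomial.map (C : ℂ →+* A d) (actY (fun i => C (g i)) X i) =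
    actY (fun i => C (C (g i))) X i := by
    intro i
    rw [actY_map]
    congr 1 <;> funext i <;> simp
  simp [Ph, bb, bg, h]

lemma eval_bg (g : Fin 4 → ℂ) (y : I → ℂ) : eval y (bg g) =
    actY g y (Sum.inl (0, 1)) * actY g y (Sum.inl (1, 2)) *
  actY g y (Sum.inl (2, 2)) * actY g y (Sum.inl (3, 2)) * actY g y (Sum.inr 0) := by
  have h : ∀ i, eval y (actY (fun i => C (g i)) X i) = actY g y i := by
    intro i
    rw [actY_map]
    congr 1 <;> funext i <;> simp
  simp [bg, h]

lemma bg_ne (y : I → ℂ) (h : ∀ k : Fin 4, vec y k ≠ 0) (hl : y (Sum.inr 0) ≠ 0 ∨ y (Sum.inr 1) ≠ 0) :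
    ∃ g, eval y (bg g) ≠ 0 := by
  have key : ∀ i : I, (i = Sum.inl (0,1) ∨ i = Sum.inl (1,2) ∨ i = Sum.inl (2,2) ∨ i = Sum.inl (3,2) ∨ i = Sum.inr 0) →
      (actY (X : Fin 4 → MvPolynomial (Fin 4) ℂ) (fun i => C (y i)) i) ≠ 0 := by
    intro i hi h0
    have h1 : ∀ g : Fin 4 → ℂ, actY g y i = 0 := by
      intro g
      have := congrArg (eval g) h0
      rw [actY_map, map_zero] at this
      rw [← this]
      congr 1 <;> funext i <;> simp
    have a0 := h1 0
    have a1 := h1 (Pi.single 0 1)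
    have a2 := h1 (Pi.single 1 1)
    have a3 := h1 (Pi.single 2 1)
    have a4 := h1 (Pi.single 3 1)
    rcases hi with rfl | rfl | rfl | rfl | rfl
    · apply h 0
      simp [actY, actl, actp] at a0 a1 a2 a3 a4
      simp [a0] at a1 a2 a3
      funext i; fin_cases i
      exacts [a3, a0, a2]
    · apply h 1
      simp [actY, actl, actp] at a0 a1 a2 a3 a4
      simp [a0] at a1 a2 a3
      funext i; fin_cases i
      exacts [a1, a2, a0]
    · apply h 2
      simp [actY, actl, actp] at a0 a1 a2 a3 a4
      simp [a0] at a1 a2 a3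
      funext i; fin_cases i
      exacts [a1, a2, a0]
    · apply h 3
      simp [actY, actl, actp] at a0 a1 a2 a3 a4
      simp [a0] at a1 a2 a3
      funext i; fin_cases i
      exacts [a1, a2, a0]
    · simp [actY] at a0 a4
      simp [a0] at a4
      rcases hl with hl | hl
      · exact hl a0
      · exact hl a4
  by_contra hcon
  push Not at hcon
  have hne := mul_ne_zero (mul_ne_zero (mul_ne_zero (mul_ne_zero (key _ (Or.inl rfl)) (key _ (Or.inr (Or.inl rfl))))
    (key _ (Or.inr (Or.inr (Or.inl rfl))))) (key _ (Or.inr (Or.inr (Or.inr (Or.inl rfl))))))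
    (key _ (Or.inr (Or.inr (Or.inr (Or.inr rfl)))))
  apply hne
  apply MvPolynomial.funext
  intro g
  have hc := hcon g
  rw [eval_bg] at hc
  have h : ∀ i, eval g (actY (X : Fin 4 → MvPolynomial (Fin 4) ℂ) (fun i => C (y i)) i) = actY g y i := by
    intro i
    rw [actY_map]
    congr 1 <;> funext i <;> simp
  simp only [map_mul, h, map_zero]
  exact hc

/-- a choice of one coordinate in each block -/
def mon (f : (Fin 4 → Fin 3) × Fin 2) : MvPolynomial I ℂ := (∏ k, X (Sum.inl (k, f.1 k))) * X (Sum.inr f.2)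

lemma unif {ι B : Type} [Finite ι] [CommRing B] (J : Ideal B) (p : ι → B) (h : ∀ f, ∃ N, p f ^ N ∈ J) :
    ∃ N, ∀ f, p f ^ N ∈ J := by
  have := Fintype.ofFinite ι
  choose N hN using h
  refine ⟨Finset.univ.sup N, fun f => ?_⟩
  exact Ideal.mem_of_dvd J (pow_dvd_pow _ (Finset.le_sup (Finset.mem_univ f))) (hN f)

lemma mon_mem (J : Ideal (MvPolynomial I ℂ)) (hJ : ∀ g, ∃ N, bg g ^ N ∈ J) : ∃ N, ∀ f, mon f ^ N ∈ J := by
  have h1 : ∀ f, ∃ N, mon f ^ N ∈ J := by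
    intro f
    have : mon f ∈ J.radical := by
      rw [← vanishingIdeal_zeroLocus_eq_radical (K := ℂ), mem_vanishingIdeal_iff]
      intro y hy
      rw [mem_zeroLocus_iff] at hy
      by_contra hne
      have hne' : eval y (mon f) ≠ 0 := by simpa [aeval_eq_eval] using hne
      simp only [mon, map_mul, map_prod, eval_X, mul_ne_zero_iff, Finset.prod_ne_zero_iff, Finset.mem_univ,
        true_imp_iff] at hne'
      obtain ⟨g, hg⟩ := bg_ne y (fun k h => hne'.1 k (congrFun h (f.1 k))) (by
        rcases f with ⟨f1, f2⟩
        fin_cases f2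
        · exact Or.inl hne'.2
        · exact Or.inr hne'.2)
      obtain ⟨N, hN⟩ := hJ g
      have := hy _ hN
      simp only [map_pow, aeval_eq_eval] at this
      exact pow_ne_zero N hg this
    exact this
  exact unif J mon h1

lemma weight_inl (e : I →₀ ℕ) (k : Fin 4) : Finsupp.weight wt e k.castSucc =
    e (Sum.inl (k, 0)) + e (Sum.inl (k, 1)) + e (Sum.inl (k, 2)) := by
  have h4 : ∀ k : Fin 4, ¬ (4 : Fin 5) = k.castSucc := by decide
  rw [weight_apply, Fintype.sum_sum_type, Fintype.sum_prod_type, Finset.sum_eq_single k]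
  · simp [kk, Fin.sum_univ_three, h4]
  · intro b _ hb
    simp [kk, hb]
  · simp

lemma weight_inr (e : I →₀ ℕ) : Finsupp.weight wt e 4 = e (Sum.inr 0) + e (Sum.inr 1) := by
  have h4 : ∀ k : Fin 4, ¬ k.castSucc = (4 : Fin 5) := by decide
  rw [weight_apply, Fintype.sum_sum_type, Fintype.sum_prod_type]
  simp [kk, h4]

lemma irr (J : Ideal (R d)) (hJ : ∀ g, ∃ N, Ph d g (bb d) ^ N ∈ J) :
    ∃ M : Fin 5 → ℕ, ∀ n ≥ M, ∀ y, IsWeightedHomogeneous wt y n → y ∈ J := by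
  obtain ⟨N, hN⟩ := mon_mem (J.comap (MvPolynomial.map (C : ℂ →+* A d))) (fun g => by
    obtain ⟨N, h⟩ := hJ g
    refine ⟨N, ?_⟩
    rw [Ideal.mem_comap, map_pow, ← Ph_bb]; exact h)
  refine ⟨fun _ => 3 * N, fun n hn y hy => ?_⟩
  rw [y.as_sum]
  refine J.sum_mem fun e he => ?_
  have hw : Finsupp.weight wt e = n := hy (mem_support_iff.mp he)
  have hk : ∀ k : Fin 4, ∃ i : Fin 3, N ≤ e (Sum.inl (k, i)) := by
    intro k
    have h4 : 3 * N ≤ n k.castSucc := hn k.castSucc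
    rw [← hw, weight_inl] at h4
    by_contra hcon
    push Not at hcon
    have h0 := hcon 0
    have h1 := hcon 1
    have h2 := hcon 2
    omega
  have hk2 : ∃ i : Fin 2, N ≤ e (Sum.inr i) := by
    have h4 : 3 * N ≤ n 4 := hn 4
    rw [← hw, weight_inr] at h4
    by_contra hcon
    push Not at hcon
    have h0 := hcon 0
    have h2 := hcon 1
    omega
  choose f1 hf1 using hk
  obtain ⟨f2, hf2⟩ := hk2
  have h := hN (f1, f2)
  rw [Ideal.mem_comap] at h
  refine Ideal.mem_of_dvd J ?_ h
  have h3 : MvPolynomial.map (C : ℂ →+* A d) (mon (f1, f2) ^ N) =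
     monomial (∑ k, Finsupp.single (Sum.inl (k, f1 k)) N + Finsupp.single (Sum.inr f2) N) 1 := by
    simp only [mon, map_pow, map_mul, map_prod, map_X, mul_pow]
    rw [← Finset.prod_pow]
    simp only [X_pow_eq_monomial]
    rw [← monomial_sum_one, monomial_mul, one_mul]
  rw [h3, monomial_dvd_monomial]
  refine ⟨Or.inr ?_, one_dvd _⟩
  intro i
  rw [Finsupp.add_apply, Finsupp.finsetSum_apply]
  rcases i with ⟨k, i⟩ | i
  · rw [Finset.sum_eq_single k]
    · simp [Finsupp.single_apply]
      split_ifs with hh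
      · rw [← hh]; exact hf1 k
      · exact Nat.zero_le _
    · intro b _ hb
      rw [Finsupp.single_apply, if_neg]
      simp [hb]
    · simp
  · simp [Finsupp.single_apply]
    split_ifs with hh
    · rw [← hh]; exact hf2
    · exact Nat.zero_le _

theorem stage (hd : 6 ≤ d) (j : Fin 9) : ∃ M : Fin 5 → ℕ, ∀ n ≥ M,
    hilb wt (P d j) (n + dT d j) = hilb wt (P d (j + 1)) (n + dT d j) + hilb wt (P d j) (n + dS j) := by
  refine hilb_step W_finite (P_mono j) (P_homog _) (P_homog _) (wh_s j) (wh_t hd j) (sX_not j j) (tX_not hd j) ?_ ?_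
  · intro f hf
    let J : Ideal (R d) :=
      { carrier := {y | ∃ z, y * (sX d j * f) - tX d j * z ∈ P d j}
        zero_mem' := ⟨0, by simp⟩
        add_mem' := by
          rintro a b ⟨z, hz⟩ ⟨z', hz'⟩
          refine ⟨z + z', ?_⟩
          convert (P d j).add_mem hz hz' using 1; ring
        smul_mem' := by
          rintro c a ⟨z, hz⟩
          refine ⟨c * z, ?_⟩
          convert (P d j).mul_mem_left c hz using 1; rw [smul_eq_mul]; ring }
    exact irr J (fun g => gloA hd j g hf)
  · let J : Ideal (R d) :=
      { carrier := {y | ∃ z ∈ P d (j + 1), y * tX d j - sX d j * z ∈ P d j}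
        zero_mem' := ⟨0, by simp⟩
        add_mem' := by
          rintro a b ⟨z, h, hz⟩ ⟨z', h', hz'⟩
          refine ⟨z + z', (P d (j + 1)).add_mem h h', ?_⟩
          convert (P d j).add_mem hz hz' using 1; ring
        smul_mem' := by
          rintro c a ⟨z, h, hz⟩
          refine ⟨c * z, (P d (j + 1)).mul_mem_left c h, ?_⟩
          convert (P d j).mul_mem_left c hz using 1; rw [smul_eq_mul]; ring }
    exact irr J (fun g => gloB hd j g)

end TT
end Mod12

section Mod13
namespace TT
open MvPolynomial

abbrev Q5 := MvPolynomial (Fin 5) ℚ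

/-- polynomials of degree `< n` -/
def lowDeg (n : ℕ) : Submodule ℚ Q5 := restrictSupport ℚ {m : Fin 5 →₀ ℕ | m.degree < n}

lemma lowDeg_mono {a b : ℕ} (h : a ≤ b) : lowDeg a ≤ lowDeg b :=
  restrictSupport_mono ℚ (fun m (hm : m.degree < a) => lt_of_lt_of_le hm h)

lemma lowDeg_mul {f g : Q5} {a b : ℕ} (hf : f ∈ lowDeg a) (hg : g ∈ lowDeg (b+1)) : f * g ∈ lowDeg (a + b) := by
  rw [lowDeg, mem_restrictSupport_iff] at *
  intro m hm
  obtain ⟨x, hx, y, hy, rfl⟩ := Finset.mem_add.mp (support_mul f g hm)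
  have h1 : x.degree < a := hf hx
  have h2 : y.degree < b + 1 := hg hy
  have : (x + y).degree = x.degree + y.degree := by simp
  show (x+y).degree < a + b
  omega

lemma lowDeg_X (i : Fin 5) : (X i : Q5) ∈ lowDeg 2 := by
  rw [lowDeg, mem_restrictSupport_iff]
  intro m hm
  rw [support_X] at hm
  simp at hm; subst hm; simp

lemma lowDeg_C (c : ℚ) : (C c : Q5) ∈ lowDeg 1 := by
  rw [lowDeg, mem_restrictSupport_iff]
  intro m hm
  have := support_monomial_subset hm
  simp at this; subst this; simp

lemma lowDeg_zero {f : Q5} (hf : f ∈ lowDeg 0) : f = 0 := by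
  rw [lowDeg, mem_restrictSupport_iff] at hf
  rw [← support_eq_empty, Finset.eq_empty_iff_forall_notMem]
  intro m hm
  exact absurd (hf hm) (by simp)

def sub5 (v : Fin 5 → ℚ) : Q5 →ₐ[ℚ] Q5 := aeval (fun i => X i - C (v i))
def Dl (v : Fin 5 → ℚ) (f : Q5) : Q5 := f - sub5 v f
def Dd (v : Fin 5 → ℚ) : Derivation ℚ Q5 Q5 := mkDerivation ℚ (fun i => C (v i))

lemma Dl_X (v) (f : Q5) (i) : Dl v (f * X i) = Dl v f * X i + C (v i) * f - C (v i) * Dl v f := by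
  simp [Dl, sub5]; ring
lemma Dd_X' (v) (i) : Dd v (X i) = C (v i) := mkDerivation_X _ _ _
lemma Dd_X (v) (f : Q5) (i) : Dd v (f * X i) = Dd v f * X i + C (v i) * f := by
  rw [Derivation.leibniz, Dd_X']; simp; ring


lemma Dl_mon (v) (k : ℕ) : ∀ (m : Fin 5 →₀ ℕ), m.degree = k → Dl v (monomial m 1) ∈ lowDeg k ∧
    ∀ n, k ≤ n + 1 → Dl v (monomial m 1) - Dd v (monomial m 1) ∈ lowDeg n := by
  induction k with
  | zero =>
    intro m hm
    have : m = 0 := (Finsupp.degree_eq_zero_iff m).mp hm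
    subst this
    have h1 : (monomial (0 : Fin 5 →₀ ℕ) (1 : ℚ)) = 1 := rfl
    simp [Dl, h1]
  | succ k ih =>
    intro m hm
    obtain ⟨i, hi⟩ : ∃ i, m i ≠ 0 := by
      by_contra! h
      have : m = 0 := by ext i; simp [h]
      simp [this] at hm
    obtain ⟨m', rfl⟩ : ∃ m', m = m' + Finsupp.single i 1 :=
      ⟨m - Finsupp.single i 1, by
        rw [tsub_add_cancel_of_le]
        simpa [Finsupp.single_le_iff] using Nat.one_le_iff_ne_zero.mpr hi⟩
    have hm' : m'.degree = k := by simpa using hm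
    obtain ⟨h1, h2⟩ := ih m' hm'
    have e : (monomial (m' + Finsupp.single i 1) (1:ℚ)) = monomial m' 1 * X i := by
      simp [X, monomial_mul]
    have hmm : (monomial m' (1:ℚ)) ∈ lowDeg (k+1) := by
      rw [lowDeg, mem_restrictSupport_iff]
      intro x hx
      have := support_monomial_subset hx
      simp at this; subst this
      show x.degree < _
      omega
    have hC : ∀ {f : Q5} {a}, f ∈ lowDeg a → C (v i) * f ∈ lowDeg a := by
      intro f a hf
      rw [← smul_eq_C_mul]; exact Submodule.smul_mem _ _ hf
    rw [e, Dl_X, Dd_X]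
    constructor
    · exact Submodule.sub_mem _ (Submodule.add_mem _ (lowDeg_mul h1 (lowDeg_X i)) (hC hmm))
        (hC (lowDeg_mono (Nat.le_succ _) h1))
    · intro n hn
      have : Dl v (monomial m' 1) * X i + C (v i) * monomial m' 1 - C (v i) * Dl v (monomial m' 1) -
          (Dd v (monomial m' 1) * X i + C (v i) * monomial m' 1) =
          (Dl v (monomial m' 1) - Dd v (monomial m' 1)) * X i - C (v i) * Dl v (monomial m' 1) := by ring
      rw [this]
      refine Submodule.sub_mem _ ?_ (hC (lowDeg_mono (by omega) h1))
      rcases n with _ | n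
      · obtain rfl : k = 0 := by omega
        have : m' = 0 := (Finsupp.degree_eq_zero_iff m').mp hm'
        subst this
        have h1 : (monomial (0 : Fin 5 →₀ ℕ) (1 : ℚ)) = 1 := rfl
        simp [Dl, h1]
      · exact lowDeg_mul (h2 n (by omega)) (lowDeg_X i)

lemma Dl_low (v) {n : ℕ} {f : Q5} (hf : f ∈ lowDeg (n+1)) : Dl v f ∈ lowDeg n ∧
    ∀ k, n ≤ k + 1 → Dl v f - Dd v f ∈ lowDeg k := by
  have hs : ∀ g : Q5, Dl v g = ((LinearMap.id : Q5 →ₗ[ℚ] Q5) - (sub5 v).toLinearMap) g := fun g => rfl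
  rw [f.as_sum]
  rw [lowDeg, mem_restrictSupport_iff] at hf
  have hmon : ∀ m ∈ f.support, monomial m (coeff m f) = coeff m f • (monomial m 1) := by
    intro m _; simp [smul_monomial]
  rw [Finset.sum_congr rfl hmon]
  constructor
  · rw [hs, map_sum]
    refine Submodule.sum_mem _ fun m hm => ?_
    rw [map_smul, ← hs]
    exact Submodule.smul_mem _ _ (lowDeg_mono (Nat.lt_succ_iff.mp (hf hm)) (Dl_mon v _ m rfl).1)
  · intro k hk
    rw [hs, map_sum, map_sum, ← Finset.sum_sub_distrib]
    refine Submodule.sum_mem _ fun m hm => ?_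
    rw [map_smul, Derivation.map_smul, ← smul_sub, ← hs]
    exact Submodule.smul_mem _ _ ((Dl_mon v _ m rfl).2 k ((Nat.lt_succ_iff.mp (hf hm)).trans hk))

lemma Dl_sub (v) (f g : Q5) : Dl v (f - g) = Dl v f - Dl v g := by
  simp [Dl]; ring

/-- `a` has leading form `b` in degree `n`. -/
def Lead (n : ℕ) (a b : Q5) : Prop := a - b ∈ lowDeg n ∧ b ∈ lowDeg (n+1)

lemma Lead.step {n} {a b : Q5} (h : Lead (n+1) a b) (v) : Lead n (Dl v a) (Dd v b) := by
  have h2 := Dl_low v h.2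
  have h1 := (Dl_low v h.1).1
  have h3 := h2.2 n (by omega)
  constructor
  · rw [Dl_sub] at h1
    have : Dl v a - Dd v b = (Dl v a - Dl v b) + (Dl v b - Dd v b) := by ring
    rw [this]; exact Submodule.add_mem _ h1 h3
  · have := Submodule.sub_mem _ h2.1 (lowDeg_mono (Nat.le_succ n) h3)
    simpa using this

lemma Lead.mul {n n'} {a b a' b' : Q5} (h : Lead n a b) (h' : Lead n' a' b') : Lead (n+n') (a*a') (b*b') := by
  refine ⟨?_, ?_⟩
  · have e : a * a' - b * b' = (a - b) * (a' - b') + (a - b) * b' + (a' - b') * b := by ring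
    rw [e]
    refine Submodule.add_mem _ (Submodule.add_mem _ ?_ (lowDeg_mul h.1 h'.2)) ?_
    · exact lowDeg_mul h.1 (lowDeg_mono (Nat.le_succ _) h'.1)
    · rw [add_comm n]; exact lowDeg_mul h'.1 h.2
  · have := lowDeg_mul h.2 h'.2
    exact lowDeg_mono (by omega) this

lemma Lead.lin (i : Fin 5) (c : ℚ) : Lead 1 (X i + C c) (X i) := by
  refine ⟨?_, lowDeg_X i⟩
  simpa using lowDeg_C c

lemma Lead.cst (c : ℚ) : Lead 0 (C c) (C c) := by
  refine ⟨by simp, lowDeg_C c⟩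

end TT
end Mod13

section Mod14
namespace TT
open MvPolynomial
variable {d : ℕ}

/-- the classes -/
def vv (d : ℕ) (j : Fin 9) : Fin 5 → ℚ := fun i => (dT d j i : ℚ) - (dS j i : ℚ)

def q1 (e : Q5) : Q5 :=
  ((((2 : ℕ) : Q5)))*X 0^2*X 1^1*X 2^2*X 3^2*X 4^1 +
  ((((2 : ℕ) : Q5)))*X 0^1*X 1^2*X 2^2*X 3^2*X 4^1

def q2 (e : Q5) : Q5 :=
  ((((4 : ℕ) : Q5)))*X 0^2*X 1^1*X 2^1*X 3^2*X 4^1 +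
  ((((4 : ℕ) : Q5)))*X 0^1*X 1^2*X 2^1*X 3^2*X 4^1 +
  ((((4 : ℕ) : Q5)))*X 0^1*X 1^1*X 2^2*X 3^2*X 4^1 +
  ((((2 : ℕ) : Q5)))*X 1^2*X 2^2*X 3^2*X 4^1

def q3 (e : Q5) : Q5 :=
  ((((8 : ℕ) : Q5)))*X 0^2*X 1^1*X 2^1*X 3^1*X 4^1 +
  ((((8 : ℕ) : Q5)))*X 0^1*X 1^2*X 2^1*X 3^1*X 4^1 +
  ((((8 : ℕ) : Q5)))*X 0^1*X 1^1*X 2^2*X 3^1*X 4^1 +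
  ((((8 : ℕ) : Q5)))*X 0^1*X 1^1*X 2^1*X 3^2*X 4^1 +
  ((((4 : ℕ) : Q5)))*X 1^2*X 2^2*X 3^1*X 4^1 +
  ((((4 : ℕ) : Q5)))*X 1^2*X 2^1*X 3^2*X 4^1 +
  ((((4 : ℕ) : Q5)))*X 1^1*X 2^2*X 3^2*X 4^1

def q4 (e : Q5) : Q5 :=
  ((((8 : ℕ) : Q5)))*X 0^2*X 1^1*X 2^1*X 3^1 +
  ((((8 : ℕ) : Q5))*e^1)*X 0^2*X 2^1*X 3^1*X 4^1 +
  ((((8 : ℕ) : Q5)))*X 0^1*X 1^2*X 2^1*X 3^1 +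
  ((((8 : ℕ) : Q5)))*X 0^1*X 1^1*X 2^2*X 3^1 +
  ((((8 : ℕ) : Q5)))*X 0^1*X 1^1*X 2^1*X 3^2 +
  ((((16 : ℕ) : Q5))*e^1)*X 0^1*X 1^1*X 2^1*X 3^1*X 4^1 +
  ((((8 : ℕ) : Q5))*e^1)*X 0^1*X 2^2*X 3^1*X 4^1 +
  ((((8 : ℕ) : Q5))*e^1)*X 0^1*X 2^1*X 3^2*X 4^1 +
  ((((4 : ℕ) : Q5)))*X 1^2*X 2^2*X 3^1 +
  ((((4 : ℕ) : Q5)))*X 1^2*X 2^1*X 3^2 +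
  ((((4 : ℕ) : Q5)))*X 1^1*X 2^2*X 3^2 +
  ((((8 : ℕ) : Q5))*e^1)*X 1^1*X 2^2*X 3^1*X 4^1 +
  ((((8 : ℕ) : Q5))*e^1)*X 1^1*X 2^1*X 3^2*X 4^1 +
  ((((4 : ℕ) : Q5))*e^1)*X 2^2*X 3^2*X 4^1

def q5 (e : Q5) : Q5 :=
  ((((16 : ℕ) : Q5))*e^1 + (-((16 : ℕ) : Q5)))*X 0^2*X 2^1*X 3^1 +
  ((((32 : ℕ) : Q5))*e^1 + (-((16 : ℕ) : Q5)))*X 0^1*X 1^1*X 2^1*X 3^1 +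
  ((((16 : ℕ) : Q5))*e^1 + (-((16 : ℕ) : Q5)))*X 0^1*X 2^2*X 3^1 +
  ((((16 : ℕ) : Q5))*e^1 + (-((16 : ℕ) : Q5)))*X 0^1*X 2^1*X 3^2 +
  ((((16 : ℕ) : Q5))*e^2 + (-((16 : ℕ) : Q5))*e^1)*X 0^1*X 2^1*X 3^1*X 4^1 +
  ((((8 : ℕ) : Q5)))*X 1^2*X 2^1*X 3^1 +
  ((((16 : ℕ) : Q5))*e^1 + (-((8 : ℕ) : Q5)))*X 1^1*X 2^2*X 3^1 +
  ((((16 : ℕ) : Q5))*e^1 + (-((8 : ℕ) : Q5)))*X 1^1*X 2^1*X 3^2 +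
  ((((16 : ℕ) : Q5))*e^1)*X 1^1*X 2^1*X 3^1*X 4^1 +
  ((((8 : ℕ) : Q5))*e^1 + (-((8 : ℕ) : Q5)))*X 2^2*X 3^2 +
  ((((8 : ℕ) : Q5))*e^2 + (-((8 : ℕ) : Q5))*e^1)*X 2^2*X 3^1*X 4^1 +
  ((((8 : ℕ) : Q5))*e^2 + (-((8 : ℕ) : Q5))*e^1)*X 2^1*X 3^2*X 4^1

def q6 (e : Q5) : Q5 :=
  ((((16 : ℕ) : Q5))*e^2 + (-((48 : ℕ) : Q5))*e^1 + (((32 : ℕ) : Q5)))*X 0^2*X 3^1 +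
  ((((32 : ℕ) : Q5))*e^2 + (-((80 : ℕ) : Q5))*e^1 + (((32 : ℕ) : Q5)))*X 0^1*X 1^1*X 3^1 +
  ((((48 : ℕ) : Q5))*e^2 + (-((112 : ℕ) : Q5))*e^1 + (((32 : ℕ) : Q5)))*X 0^1*X 2^1*X 3^1 +
  ((((16 : ℕ) : Q5))*e^2 + (-((48 : ℕ) : Q5))*e^1 + (((32 : ℕ) : Q5)))*X 0^1*X 3^2 +
  ((((16 : ℕ) : Q5))*e^3 + (-((48 : ℕ) : Q5))*e^2 + (((32 : ℕ) : Q5))*e^1)*X 0^1*X 3^1*X 4^1 +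
  ((((8 : ℕ) : Q5))*e^1 + (-((16 : ℕ) : Q5)))*X 1^2*X 3^1 +
  ((((32 : ℕ) : Q5))*e^2 + (-((32 : ℕ) : Q5)))*X 1^1*X 2^1*X 3^1 +
  ((((16 : ℕ) : Q5))*e^2 + (-((40 : ℕ) : Q5))*e^1 + (((16 : ℕ) : Q5)))*X 1^1*X 3^2 +
  ((((16 : ℕ) : Q5))*e^2 + (-((32 : ℕ) : Q5))*e^1)*X 1^1*X 3^1*X 4^1 +
  ((((8 : ℕ) : Q5))*e^2 + (-((8 : ℕ) : Q5))*e^1 + (-((16 : ℕ) : Q5)))*X 2^2*X 3^1 +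
  ((((24 : ℕ) : Q5))*e^2 + (-((56 : ℕ) : Q5))*e^1 + (((16 : ℕ) : Q5)))*X 2^1*X 3^2 +
  ((((16 : ℕ) : Q5))*e^3 + (-((16 : ℕ) : Q5))*e^2 + (-((32 : ℕ) : Q5))*e^1)*X 2^1*X 3^1*X 4^1 +
  ((((8 : ℕ) : Q5))*e^3 + (-((24 : ℕ) : Q5))*e^2 + (((16 : ℕ) : Q5))*e^1)*X 3^2*X 4^1

def q7 (e : Q5) : Q5 :=
  ((((64 : ℕ) : Q5))*e^3 + (-((320 : ℕ) : Q5))*e^2 + (((384 : ℕ) : Q5))*e^1)*X 0^1*X 3^1 +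
  ((((32 : ℕ) : Q5))*e^3 + (-((16 : ℕ) : Q5))*e^2 + (-((336 : ℕ) : Q5))*e^1 + (((288 : ℕ) : Q5)))*X 1^1*X 3^1 +
  ((((32 : ℕ) : Q5))*e^3 + (-((16 : ℕ) : Q5))*e^2 + (-((336 : ℕ) : Q5))*e^1 + (((288 : ℕ) : Q5)))*X 2^1*X 3^1 +
  ((((32 : ℕ) : Q5))*e^3 + (-((160 : ℕ) : Q5))*e^2 + (((192 : ℕ) : Q5))*e^1)*X 3^2 +
  ((((16 : ℕ) : Q5))*e^4 + (-((32 : ℕ) : Q5))*e^3 + (-((144 : ℕ) : Q5))*e^2 + (((288 : ℕ) : Q5))*e^1)*X 3^1*X 4^1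

def q8 (e : Q5) : Q5 :=
  ((((64 : ℕ) : Q5))*e^4 + (-((576 : ℕ) : Q5))*e^3 + (((1664 : ℕ) : Q5))*e^2 + (-((1536 : ℕ) : Q5))*e^1)*X 0^1 +
  ((((32 : ℕ) : Q5))*e^4 + (-((144 : ℕ) : Q5))*e^3 + (-((272 : ℕ) : Q5))*e^2 + (((1632 : ℕ) : Q5))*e^1 + (-((1152 : ℕ) : Q5)))*X 1^1 +
  ((((32 : ℕ) : Q5))*e^4 + (-((144 : ℕ) : Q5))*e^3 + (-((272 : ℕ) : Q5))*e^2 + (((1632 : ℕ) : Q5))*e^1 + (-((1152 : ℕ) : Q5)))*X 2^1 +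
  ((((80 : ℕ) : Q5))*e^4 + (-((480 : ℕ) : Q5))*e^3 + (((304 : ℕ) : Q5))*e^2 + (((1632 : ℕ) : Q5))*e^1 + (-((1152 : ℕ) : Q5)))*X 3^1 +
  ((((16 : ℕ) : Q5))*e^5 + (-((96 : ℕ) : Q5))*e^4 + (-((16 : ℕ) : Q5))*e^3 + (((864 : ℕ) : Q5))*e^2 + (-((1152 : ℕ) : Q5))*e^1)*X 4^1

def q9 (e : Q5) : Q5 :=
  ((((96 : ℕ) : Q5))*e^5 + (-((864 : ℕ) : Q5))*e^4 + (((864 : ℕ) : Q5))*e^3 + (((10080 : ℕ) : Q5))*e^2 + (-((26304 : ℕ) : Q5))*e^1 + (((11520 : ℕ) : Q5)))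


def q0 : Q5 := X 0 ^ 2 * X 1 ^ 2 * X 2 ^ 2 * X 3 ^ 2 * X 4

def Vv (e : Q5) : Fin 9 → Fin 5 → Q5 := ![![1,1,0,0,0],![1,0,1,0,0],![1,0,0,1,0],![0,e,0,0,1],![1,e-2,0,0,1],
  ![2,-2,e-2,0,1],![3,-2,e-4,0,1],![4,-2,-2,e-4,1],![5,-2,-2,e-6,1]]

lemma vv_eq (hd : 1 ≤ d) (j i) : C (vv d j i) = Vv (C (d:ℚ)) j i := by
  have c1 : (C (1:ℚ) : Q5) = 1 := map_one C
  have c2 : (C (2:ℚ) : Q5) = 2 := map_ofNat C 2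
  have c3 : (C (3:ℚ) : Q5) = 3 := map_ofNat C 3
  have c4 : (C (4:ℚ) : Q5) = 4 := map_ofNat C 4
  have c5 : (C (5:ℚ) : Q5) = 5 := map_ofNat C 5
  obtain ⟨d, rfl⟩ : ∃ k, d = k + 1 := ⟨d - 1, by omega⟩
  fin_cases j <;> fin_cases i <;> simp [vv, Vv, dT, dS] <;> (try simp only [c1,c2,c3,c4,c5]) <;> ring

lemma Dd_e (v) (c : ℚ) : Dd v (C c) = 0 := by
  rw [← algebraMap_eq]; exact Derivation.map_algebraMap _ _
lemma Dd_neg (v) (f : Q5) : Dd v (-f) = - Dd v f := by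
  exact map_neg _ _

lemma Dq0 (hd : 1 ≤ d) : Dd (vv d 0) (q0) = q1 (C (d:ℚ)) := by
  simp only [q0, q1, map_add, Derivation.leibniz, Derivation.leibniz_pow, Dd_X', Dd_e, Derivation.map_natCast, Dd_neg, Derivation.map_one_eq_zero,
    vv_eq hd, smul_eq_mul, nsmul_eq_mul]
  simp [Vv]
  ring

lemma Dq1 (hd : 1 ≤ d) : Dd (vv d 1) (q1 (C (d:ℚ))) = q2 (C (d:ℚ)) := by
  simp only [q1, q2, map_add, Derivation.leibniz, Derivation.leibniz_pow, Dd_X', Dd_e, Derivation.map_natCast, Dd_neg, Derivation.map_one_eq_zero,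
    vv_eq hd, smul_eq_mul, nsmul_eq_mul]
  simp [Vv]
  ring

lemma Dq2 (hd : 1 ≤ d) : Dd (vv d 2) (q2 (C (d:ℚ))) = q3 (C (d:ℚ)) := by
  simp only [q2, q3, map_add, Derivation.leibniz, Derivation.leibniz_pow, Dd_X', Dd_e, Derivation.map_natCast, Dd_neg, Derivation.map_one_eq_zero,
    vv_eq hd, smul_eq_mul, nsmul_eq_mul]
  simp [Vv]
  ring

lemma Dq3 (hd : 1 ≤ d) : Dd (vv d 3) (q3 (C (d:ℚ))) = q4 (C (d:ℚ)) := by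
  simp only [q3, q4, map_add, Derivation.leibniz, Derivation.leibniz_pow, Dd_X', Dd_e, Derivation.map_natCast, Dd_neg, Derivation.map_one_eq_zero,
    vv_eq hd, smul_eq_mul, nsmul_eq_mul]
  simp [Vv]
  ring

lemma Dq4 (hd : 1 ≤ d) : Dd (vv d 4) (q4 (C (d:ℚ))) = q5 (C (d:ℚ)) := by
  simp only [q4, q5, map_add, Derivation.leibniz, Derivation.leibniz_pow, Dd_X', Dd_e, Derivation.map_natCast, Dd_neg, Derivation.map_one_eq_zero,
    vv_eq hd, smul_eq_mul, nsmul_eq_mul]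
  simp [Vv]
  ring

lemma Dq5 (hd : 1 ≤ d) : Dd (vv d 5) (q5 (C (d:ℚ))) = q6 (C (d:ℚ)) := by
  simp only [q5, q6, map_add, Derivation.leibniz, Derivation.leibniz_pow, Dd_X', Dd_e, Derivation.map_natCast, Dd_neg, Derivation.map_one_eq_zero,
    vv_eq hd, smul_eq_mul, nsmul_eq_mul]
  simp [Vv]
  ring

lemma Dq6 (hd : 1 ≤ d) : Dd (vv d 6) (q6 (C (d:ℚ))) = q7 (C (d:ℚ)) := by
  simp only [q6, q7, map_add, Derivation.leibniz, Derivation.leibniz_pow, Dd_X', Dd_e, Derivation.map_natCast, Dd_neg, Derivation.map_one_eq_zero,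
    vv_eq hd, smul_eq_mul, nsmul_eq_mul]
  simp [Vv]
  ring

lemma Dq7 (hd : 1 ≤ d) : Dd (vv d 7) (q7 (C (d:ℚ))) = q8 (C (d:ℚ)) := by
  simp only [q7, q8, map_add, Derivation.leibniz, Derivation.leibniz_pow, Dd_X', Dd_e, Derivation.map_natCast, Dd_neg, Derivation.map_one_eq_zero,
    vv_eq hd, smul_eq_mul, nsmul_eq_mul]
  simp [Vv]
  ring

lemma Dq8 (hd : 1 ≤ d) : Dd (vv d 8) (q8 (C (d:ℚ))) = q9 (C (d:ℚ)) := by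
  simp only [q8, q9, map_add, Derivation.leibniz, Derivation.leibniz_pow, Dd_X', Dd_e, Derivation.map_natCast, Dd_neg, Derivation.map_one_eq_zero,
    vv_eq hd, smul_eq_mul, nsmul_eq_mul]
  simp [Vv]
  ring

end TT
end Mod14

section Mod15
namespace TT
open MvPolynomial
variable {d : ℕ}

def pp (d : ℕ) : ℕ → Q5
  | 0 => C (1/16) * ((X 0 + C 1) * (X 0 + C 2) * ((X 1 + C 1) * (X 1 + C 2)) * ((X 2 + C 1) * (X 2 + C 2)) *
      ((X 3 + C 1) * (X 3 + C 2)) * (X 4 + C 1))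
  | (j+1) => if h : j < 9 then Dl (vv d ⟨j, h⟩) (pp d j) else 0

lemma pp_succ (j : Fin 9) : pp d (j + 1) = Dl (vv d j) (pp d j) := by
  simp [pp]

lemma pp_lead : Lead 9 (pp d 0) (C (1/16) * q0) := by
  have := (Lead.cst (1/16)).mul (((((Lead.lin 0 1).mul (Lead.lin 0 2)).mul ((Lead.lin 1 1).mul (Lead.lin 1 2))).mul
    ((Lead.lin 2 1).mul (Lead.lin 2 2))).mul ((Lead.lin 3 1).mul (Lead.lin 3 2)) |>.mul (Lead.lin 4 1))
  have e : q0 = (X 0 * X 0 * (X 1 * X 1) * (X 2 * X 2) * (X 3 * X 3) * X 4) := by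
    rw [q0]; ring
  rw [e]
  exact this

lemma Dd_C (v) (c : ℚ) (f : Q5) : Dd v (C c * f) = C c * Dd v f := by
  rw [Derivation.leibniz, Dd_e]; simp

lemma pp_nine (hd : 1 ≤ d) : pp d 9 = C (1/16) * q9 (C (d:ℚ)) := by
  have h := pp_lead (d := d)
  have h1 := h.step (vv d 0)
  rw [Dd_C, Dq0 hd, ← show pp d 1 = Dl (vv d 0) (pp d 0) from pp_succ 0] at h1
  have h2 := h1.step (vv d 1)
  rw [Dd_C, Dq1 hd, ← show pp d 2 = Dl (vv d 1) (pp d 1) from pp_succ 1] at h2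
  have h3 := h2.step (vv d 2)
  rw [Dd_C, Dq2 hd, ← show pp d 3 = Dl (vv d 2) (pp d 2) from pp_succ 2] at h3
  have h4 := h3.step (vv d 3)
  rw [Dd_C, Dq3 hd, ← show pp d 4 = Dl (vv d 3) (pp d 3) from pp_succ 3] at h4
  have h5 := h4.step (vv d 4)
  rw [Dd_C, Dq4 hd, ← show pp d 5 = Dl (vv d 4) (pp d 4) from pp_succ 4] at h5
  have h6 := h5.step (vv d 5)
  rw [Dd_C, Dq5 hd, ← show pp d 6 = Dl (vv d 5) (pp d 5) from pp_succ 5] at h6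
  have h7 := h6.step (vv d 6)
  rw [Dd_C, Dq6 hd, ← show pp d 7 = Dl (vv d 6) (pp d 6) from pp_succ 6] at h7
  have h8 := h7.step (vv d 7)
  rw [Dd_C, Dq7 hd, ← show pp d 8 = Dl (vv d 7) (pp d 7) from pp_succ 7] at h8
  have h9 := h8.step (vv d 8)
  rw [Dd_C, Dq8 hd, ← show pp d 9 = Dl (vv d 8) (pp d 8) from pp_succ 8] at h9
  exact sub_eq_zero.mp (lowDeg_zero h9.1)

/-- six times the count -/
def TN (d : ℕ) : ℕ := (d-3)*(d-4)*(d-5)*(d^2+3*d-2)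

lemma pp_eval (hd : 5 ≤ d) (x : Fin 5 → ℚ) : eval x (pp d 9) = 6 * TN d := by
  obtain ⟨e, rfl⟩ : ∃ e, d = e + 5 := ⟨d - 5, by omega⟩
  rw [pp_nine (by omega), TN]
  have : (e+5)^2+3*(e+5)-2 = (e+5)^2+3*e+13 := by omega
  rw [this]
  have h2 : e + 5 - 3 = e + 2 := by omega
  have h3 : e + 5 - 4 = e + 1 := by omega
  rw [h2, h3]
  simp [q9]
  ring

lemma Dl_eval (v x) (f : Q5) : eval x (Dl v f) = eval x f - eval (fun i => x i - v i) f := by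
  have : eval x (sub5 v f) = eval (fun i => x i - v i) f := by
    rw [sub5, ← aeval_eq_eval, ← AlgHom.comp_apply, comp_aeval]
    simp [aeval_eq_eval]
  simp [Dl, this]

lemma card_tuple (k n : ℕ) : Nat.card {f : Fin (k+1) → ℕ // ∑ i, f i = n} = (n+k).choose k := by
  have := Finset.card_finsuppAntidiag_nat_eq_choose (s := (Finset.univ : Finset (Fin (k+1)))) n
  simp only [Finset.card_univ, Fintype.card_fin] at this
  rw [show k + 1 + n - 1 = n + k by omega, Nat.choose_symm_add] at this
  rw [← this, ← Fintype.card_coe, ← Nat.card_eq_fintype_card]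
  refine Nat.card_congr ((Finsupp.equivFunOnFinite.symm.subtypeEquiv ?_))
  intro f
  simp [Finset.mem_finsuppAntidiag]

lemma card_mon (m : Fin 5 → ℕ) : (Nat.card {e : I →₀ ℕ | Finsupp.weight wt e = m} : ℚ) =
    eval (fun i => (m i : ℚ)) (pp d 0) := by
  have h3 : ∀ n : ℕ, Nat.card {f : Fin 3 → ℕ // f 0 + f 1 + f 2 = n} = (n+2).choose 2 := by
    intro n
    rw [← card_tuple]; simp [Fin.sum_univ_three]
  have h2 : ∀ n : ℕ, Nat.card {f : Fin 2 → ℕ // f 0 + f 1 = n} = n + 1 := by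
    intro n
    have := card_tuple 1 n
    simpa [Fin.sum_univ_two] using this
  let eq : {e : I →₀ ℕ | Finsupp.weight wt e = m} ≃
    ((k : Fin 4) → {f : Fin 3 → ℕ // f 0 + f 1 + f 2 = m k.castSucc}) × {f : Fin 2 → ℕ // f 0 + f 1 = m 4} :=
    { toFun := fun e => (fun k => ⟨fun i => e.1 (Sum.inl (k,i)), by
          rw [← weight_inl]; exact congrFun e.2 _⟩, ⟨fun i => e.1 (Sum.inr i), by
          rw [← weight_inr]; exact congrFun e.2 _⟩)
      invFun := fun p => ⟨Finsupp.equivFunOnFinite.symm (Sum.elim (fun q => (p.1 q.1).1 q.2) p.2.1), by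
        funext k
        refine Fin.lastCases ?_ (fun k => ?_) k
        · exact (weight_inr _).trans p.2.2
        · rw [weight_inl]; exact (p.1 k).2⟩
      left_inv := by
        intro e; ext i; rcases i with i | i <;> rfl
      right_inv := by
        intro p; rfl }
  rw [Nat.card_congr eq, Nat.card_prod, Nat.card_pi]
  simp only [h3, h2]
  have hc : ∀ n : ℕ, ((n+2).choose 2 : ℚ) = (n+1)*(n+2)/2 := by
    intro n
    rw [Nat.cast_choose_two]; push_cast; ring
  simp [Fin.prod_univ_four, hc, pp]
  ring

lemma hilb_zero (hd : 6 ≤ d) (m) : ((hilb wt (P d 0) m : ℤ) : ℚ) = eval (fun i => (m i : ℚ)) (pp d 0) := by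
  rw [← card_mon (d := d), P_zero hd, hilb, W_rank]
  have : grP wt (⊥ : Ideal (R d)) m = ⊥ := by
    rw [eq_bot_iff]
    intro x hx
    exact hx.1
  have h : Module.finrank (A d) (grP wt (⊥ : Ideal (R d)) m) = 0 := by
    rw [this]; simp
  rw [show Module.finrank (A d) (grP wt (⊥ : Ideal (R d)) m) = 0 from h]
  simp

lemma hilb_pp (hd : 6 ≤ d) (j : ℕ) (hj : j ≤ 9) : ∃ M : Fin 5 → ℕ, ∀ m ≥ M,
    ((hilb wt (P d j) m : ℤ) : ℚ) = eval (fun i => (m i : ℚ)) (pp d j) := by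
  induction j with
  | zero => exact ⟨0, fun m _ => hilb_zero hd m⟩
  | succ j ih =>
    obtain ⟨M, hM⟩ := ih (by omega)
    obtain ⟨M', hM'⟩ := stage hd ⟨j, by omega⟩
    refine ⟨M + M' + dT d ⟨j, by omega⟩, fun m hm => ?_⟩
    obtain ⟨n, rfl⟩ : ∃ n, m = n + dT d ⟨j, by omega⟩ := by
      refine ⟨m - dT d ⟨j, by omega⟩, ?_⟩
      rw [tsub_add_cancel_of_le]
      exact le_trans (le_add_of_nonneg_left (by simp)) hm
    have hn : M + M' ≤ n := by
      intro i; have := hm i; simp at this; simpa using this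
    have h1 := hM' n (le_trans (by simp) hn)
    have h2 := hM (n + dT d ⟨j, by omega⟩) (le_trans (le_trans (by simp) hn) (by simp))
    have h3 := hM (n + dS ⟨j, by omega⟩) (le_trans (le_trans (by simp) hn) (by simp))
    have h4 := pp_succ (d := d) ⟨j, by omega⟩
    simp only at h1 h4
    have h5 : hilb wt (P d (j+1)) (n + dT d ⟨j, by omega⟩) = hilb wt (P d j) (n + dT d ⟨j, by omega⟩) -
      hilb wt (P d j) (n + dS ⟨j, by omega⟩) := by
      rw [h1]; ring
    rw [h5, h4, Dl_eval]
    push_cast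
    rw [h2, h3]
    congr 2
    congr 1
    funext i
    simp [vv]
    ring

theorem hilb_nine (hd : 6 ≤ d) : ∃ M : Fin 5 → ℕ, ∀ m ≥ M, hilb wt (P d 9) m = 6 * TN d := by
  obtain ⟨M, hM⟩ := hilb_pp hd 9 le_rfl
  refine ⟨M, fun m hm => ?_⟩
  have := hM m hm
  rw [pp_eval (by omega)] at this
  exact_mod_cast this

end TT
end Mod15

section Mod16
namespace TT
open MvPolynomial
variable {d : ℕ}

abbrev B9 (d : ℕ) : Type := MvPolynomial (Z9 d) ℂ

/-- the chart map -/
def eta (d : ℕ) : A d →ₐ[ℂ] B9 d := aeval (co X 0)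
def theta (d : ℕ) : R d →+* B9 d := eval₂Hom (eta d).toRingHom (pt X 1 0)

lemma eval_eta (z : Z9 d → ℂ) (a : A d) : eval z (eta d a) = eval (co z 0) a := by
  have : (eval z).comp (eta d).toRingHom = eval (co z 0) := by
    apply MvPolynomial.ringHom_ext
    · intro r; simp [eta]
    · intro i
      simp only [eta, RingHom.comp_apply, AlgHom.toRingHom_eq_coe, RingHom.coe_coe, aeval_X, eval_X]
      rw [co_map]
      congr 1 <;> funext i <;> simp
  rw [← this]; rfl

lemma eval_theta (z : Z9 d → ℂ) (f : R d) : eval z (theta d f) = ev (pt z 1 0) (co z 0) f := by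
  have : (eval z).comp (theta d) = ev (pt z 1 0) (co z 0) := by
    apply MvPolynomial.ringHom_ext
    · intro r
      simp only [theta, ev, RingHom.comp_apply, coe_eval₂Hom, eval₂_C]
      exact eval_eta z r
    · intro i
      simp only [theta, ev, RingHom.comp_apply, coe_eval₂Hom, eval₂_X]
      rw [pt_map]
      congr 1 <;> funext i <;> simp
  rw [← this]; rfl

lemma eval_psi (z : Z9 d → ℂ) (t : Fin 5 → ℂ) (f : R d) :
    eval t (psi (pt z 1 0) (co z 0) f) = ev (pt z t 0) (co z 0) f := by
  have : (eval t).comp (psi (pt z 1 0) (co z 0)) = ev (pt z t 0) (co z 0) := by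
    apply MvPolynomial.ringHom_ext
    · intro r; simp [psi, ev]
    · intro i
      have := pt_scale z 1 t 0 i
      rw [mul_one] at this
      simp [psi, ev, this]
  rw [← this]; rfl

lemma psi_homog (z : Z9 d → ℂ) {f : R d} {m} (hf : IsWeightedHomogeneous wt f m) :
    psi (pt z 1 0) (co z 0) f = monomial (Finsupp.equivFunOnFinite.symm m) (eval z (theta d f)) := by
  classical
  ext n
  obtain ⟨n, rfl⟩ := Finsupp.equivFunOnFinite.symm.surjective n
  rw [coeff_psi, coeff_monomial]
  split_ifs with h
  · rw [← Finsupp.equivFunOnFinite.symm.injective h, hf.weightedHomogeneousComponent_same, eval_theta]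
  · rw [hf.weightedHomogeneousComponent_ne _ (fun h' => h (by rw [h'])), map_zero]

lemma theta_zero {f : R d} {m} (hf : IsWeightedHomogeneous wt f m) : theta d f = 0 ↔ f ∈ P d 9 := by
  rw [mem_P]
  constructor
  · intro h z T u hu
    have : u = 0 := by funext i; exact hu i i.2
    rw [this, ← eval_psi, psi_homog z hf, h]; simp
  · intro h
    apply MvPolynomial.funext
    intro z
    rw [eval_theta, h z 1 0 (fun _ _ => rfl), map_zero]

lemma theta_surj (hd : 6 ≤ d) (y : B9 d) : ∃ N : ℕ, ∃ Y : R d, IsWeightedHomogeneous wt Y (fun _ => N) ∧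
    theta d Y = y := by
  obtain ⟨N, Y, h⟩ := lift_K hd (rename Sum.inl y)
  refine ⟨N, weightedHomogeneousComponent wt (fun _ => N) Y, weightedHomogeneousComponent_isWeightedHomogeneous _ _, ?_⟩
  apply MvPolynomial.funext
  intro z
  rw [eval_theta, ← coeff_psi]
  have h1 : psi (pt z 1 0) (co z 0) Y = monomial (Finsupp.equivFunOnFinite.symm (fun _ => N)) (eval z y) := by
    apply MvPolynomial.funext
    intro t
    rw [eval_psi, h, eval_monomial, Finsupp.prod_fintype _ _ (by simp)]
    simp only [Finsupp.equivFunOnFinite_symm_apply_apply, Finset.prod_pow]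
    rw [mul_comm, evK, eval_rename]
    rfl
  rw [h1, coeff_monomial, if_pos rfl]

lemma bb_homog : IsWeightedHomogeneous wt (bb d) (fun _ => 1) := by
  have h := ((((isWeightedHomogeneous_X (A d) wt (Sum.inl (0,1))).mul (isWeightedHomogeneous_X (A d) wt (Sum.inl (1,2)))).mul
    (isWeightedHomogeneous_X (A d) wt (Sum.inl (2,2)))).mul (isWeightedHomogeneous_X (A d) wt (Sum.inl (3,2)))).mul
    (isWeightedHomogeneous_X (A d) wt (Sum.inr 0))
  have e : (fun _ => 1 : Fin 5 → ℕ) = wt (Sum.inl (0, 1)) + wt (Sum.inl (1, 2)) + wt (Sum.inl (2, 2)) +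
      wt (Sum.inl (3, 2)) + wt (Sum.inr 0) := by
    funext i
    fin_cases i <;> simp [wt, kk, Pi.single_apply] <;> decide
  rw [e]; exact h

lemma theta_bb : theta d (bb d) = 1 := by
  apply MvPolynomial.funext
  intro z
  rw [eval_theta, bb_pt]; simp

lemma theta_surj' (hd : 6 ≤ d) (y : B9 d) : ∃ N : ℕ, ∀ n ≥ N, ∃ Y : R d, IsWeightedHomogeneous wt Y (fun _ => n) ∧
    theta d Y = y := by
  obtain ⟨N, Y, h1, h2⟩ := theta_surj hd y
  refine ⟨N, fun n hn => ⟨Y * bb d ^ (n - N), ?_, ?_⟩⟩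
  · convert h1.mul (bb_homog.pow (n - N)) using 1
    funext i; simp; omega
  · rw [map_mul, map_pow, theta_bb, h2]; simp

lemma TN_pos (hd : 6 ≤ d) : 0 < TN d := by
  unfold TN
  have : 0 < d^2 + 3 * d - 2 := by have : 0 < d^2 := by positivity
                                   omega
  have h3 : 0 < d - 3 := by omega
  have h4 : 0 < d - 4 := by omega
  have h5 : 0 < d - 5 := by omega
  positivity

section
variable {A B : Type} [CommRing A] [IsDomain A] [AddCommGroup B] [Module A B]

lemma finrank_union (M : ℕ → Submodule A B) (hf : ∀ n, Module.Finite A (M n)) (k n0 : ℕ)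
    (hr : ∀ n ≥ n0, Module.finrank A (M n) = k) (hu : ∀ y, ∃ N, ∀ n ≥ N, y ∈ M n) : Module.finrank A B = k := by
  have h1 : Module.rank A B ≤ k := by
    apply rank_le
    intro s hs
    have : ∃ N, ∀ n ≥ N, ∀ y ∈ s, y ∈ M n := by
      choose N hN using hu
      refine ⟨s.sup N, fun n hn y hy => hN y n (le_trans (Finset.le_sup hy) hn)⟩
    obtain ⟨N, hN⟩ := this
    rw [← hr (max N n0) (le_max_right _ _)]
    have hN := hN (max N n0) (le_max_left _ _)
    have hs' : LinearIndependent A (fun i : s => (⟨i.1, hN i.1 i.2⟩ : M (max N n0))) := by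
      apply LinearIndependent.of_comp (M (max N n0)).subtype
      exact hs
    have := hs'.fintype_card_le_finrank
    simpa using this
  have h2 : (k : Cardinal) ≤ Module.rank A B := by
    rw [← hr n0 le_rfl, Module.finrank_eq_rank]
    exact Submodule.rank_le _
  exact Module.finrank_eq_of_rank_eq (le_antisymm h1 h2)
end

theorem eta_finrank (hd : 6 ≤ d) :
    @Module.finrank (A d) (B9 d) _ _ (eta d).toRingHom.toModule = 6 * TN d := by
  letI := (eta d).toRingHom.toModule
  let th : R d →ₗ[A d] B9 d :=
    { toFun := theta d, map_add' := map_add _, map_smul' := by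
        intro a x
        rw [MvPolynomial.smul_eq_C_mul, map_mul]
        simp only [theta, coe_eval₂Hom, eval₂_C]
        rfl }
  obtain ⟨M, hM⟩ := hilb_nine hd
  haveI : ∀ m, Module.Finite (A d) (weightedHomogeneousSubmodule (A d) wt m) := W_finite
  apply finrank_union (fun n => (weightedHomogeneousSubmodule (A d) wt (fun _ => n)).map th) _ _ (∑ i, M i)
  · intro n hn
    have h1 := rk_map th (weightedHomogeneousSubmodule (A d) wt (fun _ => n))
    have h2 := hM (fun _ => n) (fun i => le_trans (Finset.single_le_sum (f := M) (fun _ _ => Nat.zero_le _) (Finset.mem_univ i)) hn)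
    have h3 : (weightedHomogeneousSubmodule (A d) wt (fun _ => n) ⊓ LinearMap.ker th : Submodule (A d) (R d)) =
        grP wt (P d 9) (fun _ => n) := by
      ext f
      simp only [grP, Submodule.mem_inf, LinearMap.mem_ker, Submodule.restrictScalars_mem, mem_weightedHomogeneousSubmodule]
      rw [and_comm]
      refine and_congr_left fun hf => ?_
      exact theta_zero hf
    rw [h3] at h1
    unfold hilb at h2
    have h4 : (Module.finrank (A d) (weightedHomogeneousSubmodule (A d) wt (fun _ => n)) : ℤ) -
      Module.finrank (A d) (grP wt (P d 9) (fun _ => n)) = 6 * TN d := h2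
    zify
    rw [← h4, ← h1]
    push_cast
    ring
  · intro y
    obtain ⟨N, hN⟩ := theta_surj' hd y
    refine ⟨N, fun n hn => ?_⟩
    obtain ⟨Y, h1, h2⟩ := hN n hn
    exact ⟨Y, h1, h2⟩
  · intro n
    exact Module.Finite.map _ _

theorem eta_inj (hd : 6 ≤ d) : Function.Injective (eta d) := by
  rw [injective_iff_map_eq_zero]
  intro a ha
  by_contra h0
  have h := eta_finrank hd
  letI := (eta d).toRingHom.toModule
  have h1 : Module.finrank (A d) (B9 d) = 0 := by
    apply Module.finrank_eq_of_rank_eq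
    rw [Nat.cast_zero, rank_eq_zero_iff]
    intro x
    refine ⟨a, h0, ?_⟩
    show eta d a * x = 0
    rw [ha, zero_mul]
  have h2 : Module.finrank (A d) (B9 d) = 6 * TN d := h
  have := TN_pos hd
  omega

theorem fibre_count (hd : 6 ≤ d) (D : B9 d) (hD : D ≠ 0) : ∃ Q : A d, Q ≠ 0 ∧ ∀ τ : Sg d → ℂ, eval τ Q ≠ 0 →
    {z : Z9 d → ℂ | co z 0 = τ}.Finite ∧ {z : Z9 d → ℂ | co z 0 = τ}.ncard = 6 * TN d ∧
    ∀ z : Z9 d → ℂ, co z 0 = τ → eval z D ≠ 0 := by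
  have := TN_pos hd
  obtain ⟨Q, h1, h2⟩ := spread (eta d) (eta_inj hd) (by omega) (eta_finrank hd) D hD
  refine ⟨Q, h1, fun τ hτ => ?_⟩
  have h3 := h2 τ hτ
  simp only [eval_eta, eval_X, ← funext_iff] at h3
  exact h3

end TT
end Mod16

section Mod17
namespace TT
open MvPolynomial

section rows
variable {S S' : Type} [CommRing S] [CommRing S'] {d : ℕ}

def rowV (a b x : S) : E d → S := fun m => (restr a b (monomial m.1 1)).eval x
def rowD (a b x : S) : E d → S := fun m => (restr a b (monomial m.1 1)).derivative.eval x
def rowC (a b : S) (k : ℕ) : E d → S := fun m => (restr a b (monomial m.1 1)).coeff k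

lemma restr_form (a b : S) (H : E d → S) :
    restr a b (form H) = ∑ m : E d, Polynomial.C (H m) * restr a b (monomial m.1 1) := by
  rw [form, map_sum]
  refine Finset.sum_congr rfl fun m _ => ?_
  have : monomial m.1 (H m) = H m • monomial m.1 (1:S) := by simp [smul_monomial]
  rw [this, map_smul, Polynomial.smul_eq_C_mul]

lemma rowV_sum (a b x : S) (H : E d → S) : ∑ m, rowV a b x m * H m = (restr a b (form H)).eval x := by
  rw [restr_form, Polynomial.eval_finsetSum]
  refine Finset.sum_congr rfl fun m _ => ?_
  simp [rowV, mul_comm]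
lemma rowD_sum (a b x : S) (H : E d → S) : ∑ m, rowD a b x m * H m = (restr a b (form H)).derivative.eval x := by
  rw [restr_form, Polynomial.derivative_sum, Polynomial.eval_finsetSum]
  refine Finset.sum_congr rfl fun m _ => ?_
  simp [rowD, mul_comm]
lemma rowC_sum (a b : S) (k) (H : E d → S) : ∑ m, rowC a b k m * H m = (restr a b (form H)).coeff k := by
  rw [restr_form, Polynomial.finsetSum_coeff]
  refine Finset.sum_congr rfl fun m _ => ?_
  simp [rowC, mul_comm]

lemma rowV_map (φ : S →+* S') (a b x : S) (m : E d) : φ (rowV a b x m) = rowV (φ a) (φ b) (φ x) m := by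
  rw [rowV, rowV, ← Polynomial.eval_map_apply, restr_map]; simp
lemma rowD_map (φ : S →+* S') (a b x : S) (m : E d) : φ (rowD a b x m) = rowD (φ a) (φ b) (φ x) m := by
  rw [rowD, rowD, ← Polynomial.eval_map_apply, ← Polynomial.derivative_map, restr_map]; simp
lemma rowC_map (φ : S →+* S') (a b : S) (k) (m : E d) : φ (rowC a b k m) = rowC (φ a) (φ b) k m := by
  rw [rowC, rowC, ← Polynomial.coeff_map, restr_map]; simp
end rows

variable {d : ℕ}

theorem linNonDom' {E Z ρ : Type} [Fintype E] [Fintype Z] [Fintype ρ] (M : ρ → E → MvPolynomial Z ℂ)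
    (hr : Fintype.card Z + 1 < Fintype.card ρ) : ∃ Q : MvPolynomial (E ⊕ E) ℂ, Q ≠ 0 ∧
      ∀ (F G : E → ℂ) (c : ℂ) (z : Z → ℂ),
        (∀ v : ρ → ℂ, ∃ H : E → ℂ, ∀ i, ∑ m, eval z (M i m) * H m = v i) →
        (∀ i, ∑ m, eval z (M i m) * (F + c • G) m = 0) → eval (Sum.elim F G) Q = 0 := by
  let e := Fintype.equivFin ρ
  obtain ⟨Q, h1, h2⟩ := linNonDom (Matrix.of (fun i m => M (e.symm i) m)) hr
  refine ⟨Q, h1, fun F G c z hs h0 => h2 F G c z ?_ ?_⟩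
  · intro v
    obtain ⟨H, hH⟩ := hs (v ∘ e)
    refine ⟨H, ?_⟩
    funext i
    have := hH (e.symm i)
    simpa [Matrix.mulVec, dotProduct] using this
  · funext i
    have := h0 (e.symm i)
    simpa [Matrix.mulVec, dotProduct] using this

lemma sq_dvd_iff (p : Polynomial ℂ) (x : ℂ) : (Polynomial.X - Polynomial.C x)^2 ∣ p ↔
    p.eval x = 0 ∧ p.derivative.eval x = 0 := by
  by_cases hp : p = 0
  · simp [hp]
  rw [← Polynomial.le_rootMultiplicity_iff hp]
  exact Polynomial.one_lt_rootMultiplicity_iff_isRoot hp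

lemma prod_sq_dvd {k : ℕ} (x : Fin k → ℂ) (hx : Function.Injective x) (p : Polynomial ℂ)
    (h : ∀ i, (Polynomial.X - Polynomial.C (x i))^2 ∣ p) :
    ∏ i, (Polynomial.X - Polynomial.C (x i))^2 ∣ p := by
  apply Finset.prod_dvd_of_coprime
  · intro i _ j _ hij
    apply IsCoprime.pow
    exact Polynomial.pairwise_coprime_X_sub_C hx hij
  · intro i _
    exact h i

lemma eq_zero_of_sq_dvd {k : ℕ} (x : Fin k → ℂ) (hx : Function.Injective x) (p : Polynomial ℂ)
    (h : ∀ i, (Polynomial.X - Polynomial.C (x i))^2 ∣ p) (hp : p.natDegree < 2 * k) : p = 0 := by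
  refine Polynomial.eq_zero_of_dvd_of_natDegree_lt (prod_sq_dvd x hx p h) ?_
  rw [Polynomial.natDegree_prod _ _ (fun i _ => pow_ne_zero _ (Polynomial.X_sub_C_ne_zero _))]
  simpa [mul_comm] using hp

/-- interpolation -/
lemma hermite {k : ℕ} (x : Fin k → ℂ) (hx : Function.Injective x) (α β : Fin k → ℂ) :
    ∃ p : Polynomial ℂ, p ∈ Polynomial.degreeLT ℂ (2*k) ∧ (∀ i, p.eval (x i) = α i) ∧
      ∀ i, p.derivative.eval (x i) = β i := by
  let L : Polynomial.degreeLT ℂ (2*k) →ₗ[ℂ] (Fin k → ℂ) × (Fin k → ℂ) :=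
    { toFun := fun p => (fun i => p.1.eval (x i), fun i => p.1.derivative.eval (x i))
      map_add' := by intro p q; ext i <;> simp
      map_smul' := by intro c p; ext i <;> simp }
  have hinj : Function.Injective L := by
    rw [injective_iff_map_eq_zero]
    rintro ⟨p, hp⟩ h
    have h1 : ∀ i, p.eval (x i) = 0 := fun i => congrFun (congrArg Prod.fst h) i
    have h2 : ∀ i, p.derivative.eval (x i) = 0 := fun i => congrFun (congrArg Prod.snd h) i
    have h3 := prod_sq_dvd x hx p (fun i => (sq_dvd_iff p _).mpr ⟨h1 i, h2 i⟩)
    ext1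
    show p = 0
    refine Polynomial.eq_zero_of_dvd_of_degree_lt h3 ?_
    rw [Polynomial.degree_prod]
    rw [Polynomial.mem_degreeLT] at hp
    simpa [mul_comm] using hp
  have hfr : Module.finrank ℂ (Polynomial.degreeLT ℂ (2*k)) = Module.finrank ℂ ((Fin k → ℂ) × (Fin k → ℂ)) := by
    rw [(Polynomial.degreeLTEquiv ℂ (2*k)).finrank_eq]
    simp; ring
  haveI : FiniteDimensional ℂ (Polynomial.degreeLT ℂ (2*k)) := (Polynomial.degreeLTEquiv ℂ (2*k)).symm.finiteDimensional
  have hs := (LinearMap.injective_iff_surjective_of_finrank_eq_finrank hfr).mp hinj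
  obtain ⟨⟨p, hp⟩, h⟩ := hs (α, β)
  exact ⟨p, hp, fun i => congrFun (congrArg Prod.fst h) i, fun i => congrFun (congrArg Prod.snd h) i⟩

/-- form from a univariate polynomial -/
def hom1 (d : ℕ) (p : Polynomial ℂ) : MvPolynomial (Fin 3) ℂ :=
  ∑ i ∈ Finset.range (d+1), C (p.coeff i) * X 0 ^ i * X 2 ^ (d - i)

lemma hom1_homog (p) : (hom1 d p).IsHomogeneous d := by
  apply IsHomogeneous.sum
  intro i hi
  have := Finset.mem_range.mp hi
  have h := ((isHomogeneous_C (Fin 3) (p.coeff i)).mul (isHomogeneous_X_pow (0 : Fin 3) i)).mul (isHomogeneous_X_pow (R := ℂ) (2 : Fin 3) (d-i))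
  convert h using 1; omega

lemma restr_hom1 (a b : ℂ) {p : Polynomial ℂ} (hp : p.natDegree ≤ d) : restr a b (hom1 d p) = p := by
  conv_rhs => rw [p.as_sum_range' (d+1) (by omega)]
  simp only [hom1, map_sum]
  refine Finset.sum_congr rfl fun i _ => ?_
  simp [restr, ← Polynomial.C_mul_X_pow_eq_monomial]

/-- two polynomials on two lines -/
lemma exists_form (hd : 1 ≤ d) (a b : ℂ) {r s : Polynomial ℂ} (hr : r.natDegree ≤ d) (hs : s.natDegree ≤ d - 1) :
    ∃ H : E d → ℂ, ∀ a' b', restr a' b' (form H) =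
      r + (Polynomial.C (a' - a) * Polynomial.X + Polynomial.C (b' - b)) * s := by
  let F : MvPolynomial (Fin 3) ℂ := hom1 d r + (X 1 - C a * X 0 - C b * X 2) * hom1 (d-1) s
  have h1 : (X 1 - C a * X 0 - C b * X 2 : MvPolynomial (Fin 3) ℂ).IsHomogeneous 1 := by
    refine ((isHomogeneous_X _ _).sub ?_).sub ?_
    · exact (isHomogeneous_C_mul_X _ _)
    · exact (isHomogeneous_C_mul_X _ _)
  have hF : F.IsHomogeneous d := by
    refine (hom1_homog r).add ?_
    have := h1.mul (hom1_homog (d := d - 1) s)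
    convert this using 1; omega
  refine ⟨fun m => coeff m.1 F, fun a' b' => ?_⟩
  rw [form_coeff hF, map_add, map_mul, restr_hom1 _ _ hr, restr_hom1 _ _ hs]
  congr 2
  simp [restr]
  ring

lemma form_pencil (F G : E d → ℂ) (c : ℂ) : form (F + c • G) = form F + c • form G := by
  rw [form_add, form_smul]

lemma noLine (hd : 3 ≤ d) : ∃ Q : A d, Q ≠ 0 ∧ ∀ (F G : E d → ℂ) (c a b : ℂ),
    restr a b (form F + c • form G) = 0 → eval (Sum.elim F G) Q = 0 := by
  obtain ⟨Q, h1, h2⟩ := linNonDom' (E := E d) (Z := Fin 2) (ρ := Fin (d+1))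
    (fun i => rowC (X 0) (X 1) i) (by simp; omega)
  refine ⟨Q, h1, fun F G c a b h => h2 F G c ![a, b] ?_ ?_⟩
  · intro v
    obtain ⟨H, hH⟩ := exists_form (d := d) (by omega) a b (r := ∑ i : Fin (d+1), Polynomial.C (v i) * Polynomial.X ^ (i:ℕ)) (s := 0)
      (by
        apply Polynomial.natDegree_sum_le_of_forall_le
        intro i _
        exact (Polynomial.natDegree_C_mul_X_pow_le _ _).trans (by omega)) (by simp)
    refine ⟨H, fun i => ?_⟩
    simp only [rowC_map, eval_X]
    rw [rowC_sum]
    simp only [Matrix.cons_val_zero, Matrix.cons_val_one]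
    rw [hH]
    simp [Polynomial.coeff_C_mul, Polynomial.coeff_X_pow, Fin.val_inj]
  · intro i
    simp only [rowC_map, eval_X]
    rw [rowC_sum, form_pencil]
    simp only [Matrix.cons_val_zero, Matrix.cons_val_one]
    rw [h, Polynomial.coeff_zero]

lemma degLT {p : Polynomial ℂ} {n m : ℕ} (hp : p ∈ Polynomial.degreeLT ℂ n) (h : n ≤ m + 1) : p.natDegree ≤ m := by
  rw [Polynomial.mem_degreeLT] at hp
  by_cases h0 : p = 0
  · simp [h0]
  have := (Polynomial.natDegree_lt_iff_degree_lt h0).mpr hp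
  omega

lemma sameLine (hd : 7 ≤ d) : ∃ Q : A d, Q ≠ 0 ∧ ∀ (F G : E d → ℂ) (c a b : ℂ) (x : Fin 4 → ℂ), Function.Injective x →
    (∀ i, (Polynomial.X - Polynomial.C (x i))^2 ∣ restr a b (form F + c • form G)) → eval (Sum.elim F G) Q = 0 := by
  obtain ⟨Q, h1, h2⟩ := linNonDom' (E := E d) (Z := Fin 2 ⊕ Fin 4) (ρ := Fin 4 ⊕ Fin 4)
    (Sum.elim (fun i => rowV (X (Sum.inl 0)) (X (Sum.inl 1)) (X (Sum.inr i)))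
      (fun i => rowD (X (Sum.inl 0)) (X (Sum.inl 1)) (X (Sum.inr i)))) (by simp)
  refine ⟨Q, h1, fun F G c a b x hx h => h2 F G c (Sum.elim ![a, b] x) ?_ ?_⟩
  · intro v
    obtain ⟨r, hr, hr1, hr2⟩ := hermite x hx (fun i => v (Sum.inl i)) (fun i => v (Sum.inr i))
    obtain ⟨H, hH⟩ := exists_form (d := d) (by omega) a b (r := r) (s := 0) (degLT hr (by omega)) (by simp)
    refine ⟨H, fun i => ?_⟩
    rcases i with i | i
    · simp only [Sum.elim_inl, rowV_map, eval_X]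
      rw [rowV_sum, hH]
      simp [hr1]
    · simp only [Sum.elim_inr, rowD_map, eval_X]
      rw [rowD_sum, hH]
      simp [hr2]
  · intro i
    rcases i with i | i
    · simp only [Sum.elim_inl, rowV_map, eval_X]
      rw [rowV_sum, form_pencil]
      exact ((sq_dvd_iff _ _).mp (h i)).1
    · simp only [Sum.elim_inr, rowD_map, eval_X]
      rw [rowD_sum, form_pencil]
      exact ((sq_dvd_iff _ _).mp (h i)).2

lemma twoLines (hd : 6 ≤ d) {Z : Type} [Fintype Z] {k : ℕ} (hk : k ≤ 3) (hZ : Fintype.card Z + 1 < 6 + 2 * k)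
    (a b a' b' : MvPolynomial Z ℂ) (x : Fin 3 → MvPolynomial Z ℂ) (x' : Fin k → MvPolynomial Z ℂ) :
    ∃ Q : A d, Q ≠ 0 ∧ ∀ (F G : E d → ℂ) (c : ℂ) (z : Z → ℂ), Function.Injective (fun i => eval z (x i)) →
    Function.Injective (fun i => eval z (x' i)) →
    (∀ j, (eval z a' - eval z a) * eval z (x' j) + (eval z b' - eval z b) ≠ 0) →
    (∀ i, (Polynomial.X - Polynomial.C (eval z (x i)))^2 ∣ restr (eval z a) (eval z b) (form F + c • form G)) →
    (∀ i, (Polynomial.X - Polynomial.C (eval z (x' i)))^2 ∣ restr (eval z a') (eval z b') (form F + c • form G)) →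
     eval (Sum.elim F G) Q = 0 := by
  obtain ⟨Q, h1, h2⟩ := linNonDom' (E := E d) (Z := Z) (ρ := (Fin 3 ⊕ Fin 3) ⊕ (Fin k ⊕ Fin k))
    (Sum.elim (Sum.elim (fun i => rowV a b (x i)) (fun i => rowD a b (x i)))
      (Sum.elim (fun i => rowV a' b' (x' i)) (fun i => rowD a' b' (x' i)))) (by simp; omega)
  refine ⟨Q, h1, fun F G c z hx hx' hκ h h' => h2 F G c z ?_ ?_⟩
  · intro v
    obtain ⟨r, hr, hr1, hr2⟩ := hermite _ hx (fun i => v (Sum.inl (Sum.inl i))) (fun i => v (Sum.inl (Sum.inr i)))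
    obtain ⟨s, hs, hs1, hs2⟩ := hermite _ hx'
      (fun i => (v (Sum.inr (Sum.inl i)) - r.eval (eval z (x' i))) / ((eval z a' - eval z a) * eval z (x' i) + (eval z b' - eval z b)))
      (fun i => (v (Sum.inr (Sum.inr i)) - r.derivative.eval (eval z (x' i)) - (eval z a' - eval z a) *
        ((v (Sum.inr (Sum.inl i)) - r.eval (eval z (x' i))) / ((eval z a' - eval z a) * eval z (x' i) + (eval z b' - eval z b))))
        / ((eval z a' - eval z a) * eval z (x' i) + (eval z b' - eval z b)))
    obtain ⟨H, hH⟩ := exists_form (d := d) (by omega) (eval z a) (eval z b) (r := r) (s := s) (degLT hr (by omega))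
      (degLT hs (by omega))
    refine ⟨H, fun i => ?_⟩
    rcases i with (i | i) | (i | i)
    · simp only [Sum.elim_inl, rowV_map]
      rw [rowV_sum, hH]
      simp [hr1]
    · simp only [Sum.elim_inl, Sum.elim_inr, rowD_map]
      rw [rowD_sum, hH]
      simp [hr2]
    · simp only [Sum.elim_inl, Sum.elim_inr, rowV_map]
      rw [rowV_sum, hH]
      have := hκ i
      simp only [Polynomial.eval_add, Polynomial.eval_mul, Polynomial.eval_C, Polynomial.eval_X, hs1]
      have e : ∀ r v κ : ℂ, κ ≠ 0 → r + κ * ((v - r) / κ) = v := by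
        intro r v κ hκ; field_simp; ring
      exact (congrArg₂ (· + ·) rfl (by ring)).trans (e _ _ _ this)
    · simp only [Sum.elim_inr, rowD_map]
      rw [rowD_sum, hH]
      have := hκ i
      have hs2' := hs2 i
      rw [← hs1 i] at hs2'
      simp only [Polynomial.derivative_add, Polynomial.derivative_mul, Polynomial.derivative_C, Polynomial.derivative_X,
        Polynomial.eval_add, Polynomial.eval_mul, Polynomial.eval_C, Polynomial.eval_X, Polynomial.eval_zero, Polynomial.eval_one]
      rw [eq_div_iff this] at hs2'
      linear_combination hs2'
  · intro i
    rcases i with (i | i) | (i | i)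
    · simp only [Sum.elim_inl, rowV_map]
      rw [rowV_sum, form_pencil]
      exact ((sq_dvd_iff _ _).mp (h i)).1
    · simp only [Sum.elim_inl, Sum.elim_inr, rowD_map]
      rw [rowD_sum, form_pencil]
      exact ((sq_dvd_iff _ _).mp (h i)).2
    · simp only [Sum.elim_inl, Sum.elim_inr, rowV_map]
      rw [rowV_sum, form_pencil]
      exact ((sq_dvd_iff _ _).mp (h' i)).1
    · simp only [Sum.elim_inr, rowD_map]
      rw [rowD_sum, form_pencil]
      exact ((sq_dvd_iff _ _).mp (h' i)).2

/-- a tritangent line in the chart -/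
def Conf (F G : E d → ℂ) (c a b : ℂ) (x : Fin 3 → ℂ) : Prop :=
  Function.Injective x ∧ ∀ i, (Polynomial.X - Polynomial.C (x i))^2 ∣ restr a b (form F + c • form G)

lemma Conf.perm {F G : E d → ℂ} {c a b : ℂ} {x : Fin 3 → ℂ} (h : Conf F G c a b x) (σ : Equiv.Perm (Fin 3)) :
    Conf F G c a b (x ∘ σ) := ⟨h.1.comp σ.injective, fun i => h.2 (σ i)⟩

theorem conf_unique (hd : 6 ≤ d) : ∃ Q : A d, Q ≠ 0 ∧ ∀ (F G : E d → ℂ), eval (Sum.elim F G) Q ≠ 0 →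
    ∀ c a b x a' b' x', Conf F G c a b x → Conf F G c a' b' x' → a = a' ∧ b = b' ∧ Set.range x = Set.range x' := by
  obtain ⟨Q0, q0, h0⟩ := noLine (d := d) (by omega)
  obtain ⟨Q1, q1, h1⟩ : ∃ Q : A d, Q ≠ 0 ∧ ∀ (F G : E d → ℂ) (c a b : ℂ) (x : Fin 4 → ℂ), Function.Injective x →
    (∀ i, (Polynomial.X - Polynomial.C (x i))^2 ∣ restr a b (form F + c • form G)) → eval (Sum.elim F G) Q = 0 := by
    by_cases h7 : 7 ≤ d
    · exact sameLine h7
    · refine ⟨Q0, q0, fun F G c a b x hx h => h0 F G c a b ?_⟩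
      apply eq_zero_of_sq_dvd x hx _ h
      have : (form F + c • form G).IsHomogeneous d := by rw [← form_pencil]; exact form_homog _
      have := restr_degree this a b
      omega
  obtain ⟨Q2, q2, h2⟩ := twoLines hd (Z := Fin 4 ⊕ (Fin 3 ⊕ Fin 3)) (k := 3) le_rfl (by simp)
    (X (Sum.inl 0)) (X (Sum.inl 1)) (X (Sum.inl 2)) (X (Sum.inl 3)) (fun i => X (Sum.inr (Sum.inl i)))
    (fun i => X (Sum.inr (Sum.inr i)))
  obtain ⟨Q3, q3, h3⟩ := twoLines hd (Z := Fin 3 ⊕ (Fin 3 ⊕ Fin 2)) (k := 2) (by norm_num) (by simp)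
    (X (Sum.inl 0)) (X (Sum.inl 1)) (X (Sum.inl 2))
    ((X (Sum.inl 0) - X (Sum.inl 2)) * X (Sum.inr (Sum.inl 0)) + X (Sum.inl 1)) (fun i => X (Sum.inr (Sum.inl i)))
    (fun i => X (Sum.inr (Sum.inr i)))
  refine ⟨Q1 * Q2 * Q3, mul_ne_zero (mul_ne_zero q1 q2) q3, ?_⟩
  intro F G hQ c a b x a' b' x' hc hc'
  simp only [map_mul, mul_ne_zero_iff] at hQ
  obtain ⟨⟨n1, n2⟩, n3⟩ := hQ
  have good2 : ∀ a b x a' b' x', Conf F G c a b x → Conf F G c a' b' x' →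
      (∀ j, (a' - a) * x' j + (b' - b) ≠ 0) → False := by
    intro a b x a' b' x' hc hc' hκ
    apply n2
    apply h2 F G c (Sum.elim ![a, b, a', b'] (Sum.elim x x'))
    · simpa using hc.1
    · simpa using hc'.1
    · intro j; simpa using hκ j
    · intro j; simpa using hc.2 j
    · intro j; simpa using hc'.2 j
  have good3 : ∀ a b x a' b' x', Conf F G c a b x → Conf F G c a' b' x' → (a ≠ a' ∨ b ≠ b') →
      (a' - a) * x 0 + (b' - b) = 0 → x 0 = x' 0 → False := by
    intro a b x a' b' x' hc hc' hab hκ hx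
    have hb : b' = (a - a') * x 0 + b := by linear_combination hκ
    have haa : a' - a ≠ 0 := by
      intro h
      rw [h] at hκ
      rcases hab with h' | h'
      · exact h' (by linear_combination -h)
      · exact h' (by linear_combination -hκ)
    apply n3
    apply h3 F G c (Sum.elim ![a, b, a'] (Sum.elim x (fun i => x' i.succ)))
    · simpa using hc.1
    · have := hc'.1.comp (Fin.succ_injective _); simpa [Function.comp_def] using this
    · intro j
      simp only [eval_X, Sum.elim_inl, Sum.elim_inr, map_add, map_mul, map_sub, Matrix.cons_val]
      have : (a' - a) * x' j.succ + ((a - a') * x 0 + b - b) = (a' - a) * (x' j.succ - x' 0) := by rw [hx]; ring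
      rw [this]
      refine mul_ne_zero haa (sub_ne_zero.mpr fun h => ?_)
      exact absurd (hc'.1 h) (Fin.succ_ne_zero j)
    · intro j; simpa using hc.2 j
    · intro j; 
      have := hc'.2 j.succ
      rw [hb] at this
      simpa using this
  have hab : a = a' ∧ b = b' := by
    by_contra hne
    have hne : a ≠ a' ∨ b ≠ b' := by tauto
    have ⟨j, hj⟩ : ∃ j, (a' - a) * x' j + (b' - b) = 0 := by
      by_contra! h
      exact good2 a b x a' b' x' hc hc' h
    have ⟨i, hi⟩ : ∃ i, (a - a') * x i + (b - b') = 0 := by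
      by_contra! h
      exact good2 a' b' x' a b x hc' hc h
    have haa : a' - a ≠ 0 := by
      intro h
      rw [h] at hj
      rcases hne with h' | h'
      · exact h' (by linear_combination -h)
      · exact h' (by linear_combination -hj)
    have hx : x i = x' j := by
      apply mul_left_cancel₀ haa
      linear_combination -hi - hj
    apply good3 a b (x ∘ Equiv.swap 0 i) a' b' (x' ∘ Equiv.swap 0 j) (hc.perm _) (hc'.perm _) hne
    · simp; linear_combination -hi
    · simpa using hx
  obtain ⟨rfl, rfl⟩ := hab
  refine ⟨rfl, rfl, ?_⟩
  have key : ∀ x x' : Fin 3 → ℂ, Conf F G c a b x → Conf F G c a b x' → Set.range x' ⊆ Set.range x := by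
    rintro x x' hc hc' _ ⟨j, rfl⟩
    by_contra hj
    apply n1
    refine h1 F G c a b (Fin.cons (x' j) x) ?_ ?_
    · rw [Fin.cons_injective_iff]; exact ⟨hj, hc.1⟩
    · intro i
      refine Fin.cases ?_ (fun i => ?_) i
      · exact hc'.2 j
      · exact hc.2 i
  exact (key x' x hc' hc).antisymm (key x x' hc hc')

end TT
end Mod17

section Mod18
namespace TT
open MvPolynomial
variable {d : ℕ}

lemma nestP_zero (x : Fin 3 → ℂ) (B : Polynomial ℂ) : nestP x 0 B =
    (∏ i, (Polynomial.X - Polynomial.C (x i)) ^ 2) * B := by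
  simp only [nestP, Fin.prod_univ_three, Pi.zero_apply, map_zero]
  ring

lemma conf_of (hd : 6 ≤ d) (z : Z9 d → ℂ) (F G : E d → ℂ) (h : co z 0 = Sum.elim F G)
    (hx : Function.Injective (px z)) : Conf F G (pc z) (pa z) (pb z) (px z) := by
  have hF : Fco z 0 = F := by
    funext m; exact congrFun h (Sum.inl m)
  have hG : pG z = G := by
    funext m; exact congrFun h (Sum.inr m)
  refine ⟨hx, fun i => ?_⟩
  have := restr_Fco hd z 0
  rw [hF, hG] at this
  rw [this, nest, nestP_zero]
  exact Dvd.dvd.mul_right (Finset.dvd_prod_of_mem (fun i => (Polynomial.X - Polynomial.C (px z i)) ^ 2) (Finset.mem_univ i)) _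

lemma of_conf (hd : 6 ≤ d) (F G : E d → ℂ) (c a b : ℂ) (x : Fin 3 → ℂ) (h : Conf F G c a b x) :
    ∃ z : Z9 d → ℂ, co z 0 = Sum.elim F G ∧ pc z = c ∧ pa z = a ∧ pb z = b ∧ px z = x := by
  obtain ⟨B, hB⟩ := prod_sq_dvd x h.1 _ h.2
  have hm : (∏ i, (Polynomial.X - Polynomial.C (x i)) ^ 2).Monic :=
    Polynomial.monic_prod_of_monic _ _ fun i _ => (Polynomial.monic_X_sub_C _).pow 2
  have hdeg : (∏ i, (Polynomial.X - Polynomial.C (x i)) ^ 2).natDegree = 6 := by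
    rw [Polynomial.natDegree_prod_of_monic _ _ fun i _ => (Polynomial.monic_X_sub_C _).pow 2]
    simp [Polynomial.natDegree_pow]
  have hBd : B.natDegree < d - 5 := by
    by_cases hB0 : B = 0
    · simp [hB0]; omega
    have hh : (form F + c • form G).IsHomogeneous d := by rw [← form_pencil]; exact form_homog _
    have := restr_degree hh a b
    rw [hB, hm.natDegree_mul' hB0, hdeg] at this
    omega
  let z : Z9 d → ℂ := Sum.elim ![a, b, c, x 0, x 1, x 2] (Sum.elim (fun k => B.coeff k) (Sum.elim (fun m => F m.1) G))
  have hx : px z = x := by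
    funext i; fin_cases i <;> rfl
  have hBz : Bpoly z = B := by
    conv_rhs => rw [B.as_sum_range_C_mul_X_pow' hBd]
    rw [Bpoly, Finset.sum_range]
    rfl
  refine ⟨z, ?_, rfl, rfl, rfl, hx⟩
  have : Fco z 0 = F := by
    apply Fco_unique
    · rw [nest, nestP_zero, hx, hBz]
      exact hB
    · intro m; rfl
  rw [co, this]
  rfl

lemma co_inj (hd : 6 ≤ d) (z z' : Z9 d → ℂ) (h : co z 0 = co z' 0) (hc : pc z = pc z') (ha : pa z = pa z')
    (hb : pb z = pb z') (hx : px z = px z') : z = z' := by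
  have hF : Fco z 0 = Fco z' 0 := by
    funext m; exact congrFun h (Sum.inl m)
  have hG : pG z = pG z' := by
    funext m; exact congrFun h (Sum.inr m)
  have hB : Bpoly z = Bpoly z' := by
    have h1 := restr_Fco hd z 0
    rw [hF, hG, hc, ha, hb, restr_Fco hd z' 0, nest, nest, nestP_zero, nestP_zero, hx] at h1
    have hm : (∏ i, (Polynomial.X - Polynomial.C (px z' i)) ^ 2).Monic :=
      Polynomial.monic_prod_of_monic _ _ fun i _ => (Polynomial.monic_X_sub_C _).pow 2
    exact (mul_left_cancel₀ hm.ne_zero h1).symm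
  have hco : ∀ (z : Z9 d → ℂ) (k : Fin (d-5)), (Bpoly z).coeff k = z (Sum.inr (Sum.inl k)) := by
    intro z k
    simp [Bpoly, Polynomial.coeff_C_mul, Polynomial.coeff_X_pow, Fin.val_inj]
  funext i
  rcases i with i | i | i | i
  · fin_cases i
    · exact ha
    · exact hb
    · exact hc
    · exact congrFun hx 0
    · exact congrFun hx 1
    · exact congrFun hx 2
  · rw [← hco z, ← hco z', hB]
  · have := congrFun hF i.1
    simpa [Fco, nonpure, i.2] using this
  · exact congrFun hG i

def Members (F G : E d → ℂ) : Set ℂ := {c | ∃ a b x, Conf F G c a b x}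

def ChartCount (d N : ℕ) : Prop := ∃ Q : A d, Q ≠ 0 ∧ ∀ F G : E d → ℂ, eval (Sum.elim F G) Q ≠ 0 →
  (Members F G).Finite ∧ (Members F G).ncard = N

theorem chart_low (h3 : 3 ≤ d) (h5 : d ≤ 5) : ChartCount d 0 := by
  obtain ⟨Q, q, h⟩ := noLine (d := d) h3
  refine ⟨Q, q, fun F G hQ => ?_⟩
  have : Members F G = ∅ := by
    ext c
    simp only [Members, Set.mem_ofPred_eq, Set.mem_empty_iff_false, iff_false]
    rintro ⟨a, b, x, hc⟩
    apply hQ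
    apply h F G c a b
    apply eq_zero_of_sq_dvd x hc.1 _ hc.2
    have hh : (form F + c • form G).IsHomogeneous d := by rw [← form_pencil]; exact form_homog _
    have := restr_degree hh a b
    omega
  rw [this]
  simp

lemma exists_perm (x y : Fin 3 → ℂ) (hx : Function.Injective x) (hy : Function.Injective y)
    (h : Set.range x = Set.range y) : ∃ σ : Equiv.Perm (Fin 3), y = x ∘ σ := by
  refine ⟨(Equiv.ofInjective y hy).trans ((Equiv.setCongr h.symm).trans (Equiv.ofInjective x hx).symm), ?_⟩
  funext i
  have := Equiv.apply_ofInjective_symm hx ((Equiv.setCongr h.symm) (Equiv.ofInjective y hy i))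
  simpa using this.symm

lemma inj3 (x : Fin 3 → ℂ) (h01 : x 0 ≠ x 1) (h02 : x 0 ≠ x 2) (h12 : x 1 ≠ x 2) : Function.Injective x := by
  intro i j hij
  fin_cases i <;> fin_cases j
  · rfl
  · exact absurd hij h01
  · exact absurd hij h02
  · exact absurd hij.symm h01
  · rfl
  · exact absurd hij h12
  · exact absurd hij.symm h02
  · exact absurd hij.symm h12
  · rfl

theorem chart_high (hd : 6 ≤ d) : ChartCount d (TN d) := by
  let D : B9 d := (X (Sum.inl 3) - X (Sum.inl 4)) * (X (Sum.inl 3) - X (Sum.inl 5)) * (X (Sum.inl 4) - X (Sum.inl 5))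
  have hD : D ≠ 0 := by
    have : ∀ i j : Z9 d, i ≠ j → (X i - X j : B9 d) ≠ 0 := by
      intro i j hij h
      exact hij (X_injective (sub_eq_zero.mp h))
    refine mul_ne_zero (mul_ne_zero (this _ _ ?_) (this _ _ ?_)) (this _ _ ?_) <;> simp
  obtain ⟨Q1, q1, h1⟩ := fibre_count hd D hD
  obtain ⟨Q2, q2, h2⟩ := conf_unique hd
  refine ⟨Q1 * Q2, mul_ne_zero q1 q2, fun F G hQ => ?_⟩
  rw [map_mul, mul_ne_zero_iff] at hQ
  obtain ⟨f1, f2, f3⟩ := h1 _ hQ.1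
  have u := h2 F G hQ.2
  have hxi : ∀ z : Z9 d → ℂ, co z 0 = Sum.elim F G → Function.Injective (px z) := by
    intro z hz
    have h := f3 z hz
    simp only [D, map_mul, map_sub, eval_X, mul_ne_zero_iff, sub_ne_zero] at h
    obtain ⟨⟨h34, h35⟩, h45⟩ := h
    have e0 : px z 0 = z (Sum.inl 3) := rfl
    have e1 : px z 1 = z (Sum.inl 4) := rfl
    have e2 : px z 2 = z (Sum.inl 5) := rfl
    exact inj3 _ (by rwa [e0, e1]) (by rwa [e0, e2]) (by rwa [e1, e2])
  set S := {z : Z9 d → ℂ | co z 0 = Sum.elim F G} with hS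
  choose! a b x hc using (fun c (hc : c ∈ Members F G) => hc)
  have hz : ∀ p : Members F G × Equiv.Perm (Fin 3), ∃ z : Z9 d → ℂ, co z 0 = Sum.elim F G ∧ pc z = p.1.1 ∧ pa z = a p.1.1 ∧
    pb z = b p.1.1 ∧ px z = x p.1.1 ∘ p.2 := fun p => of_conf hd F G _ _ _ _ ((hc p.1.1 p.1.2).perm p.2)
  choose ζ z1 z2 z3 z4 z5 using hz
  let f : Members F G × Equiv.Perm (Fin 3) → S := fun p => ⟨ζ p, z1 p⟩
  have hf : Function.Bijective f := by
    constructor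
    · rintro p p' h
      have h : ζ p = ζ p' := congrArg Subtype.val h
      have e1 : p.1 = p'.1 := by
        apply Subtype.ext
        rw [← z2 p, ← z2 p', h]
      have e2 : p.2 = p'.2 := by
        have := z5 p
        rw [h, z5 p', e1] at this
        ext i
        have := congrFun this i
        simp only [Function.comp_apply] at this
        rw [(hc _ p'.1.2).1 this]
      exact Prod.ext e1 e2
    · rintro ⟨z, hz⟩
      have hcz := conf_of hd z F G hz (hxi z hz)
      have hm : pc z ∈ Members F G := ⟨_, _, _, hcz⟩
      obtain ⟨ea, eb, er⟩ := u _ _ _ _ _ _ _ (hc _ hm) hcz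
      obtain ⟨σ, hσ⟩ := exists_perm _ _ (hc _ hm).1 hcz.1 er
      refine ⟨(⟨pc z, hm⟩, σ), Subtype.ext ?_⟩
      apply co_inj hd
      · rw [z1]; exact hz.symm
      · rw [z2]
      · rw [z3]; exact ea
      · rw [z4]; exact eb
      · rw [z5]; exact hσ.symm
  have hcard := Nat.card_congr (Equiv.ofBijective f hf)
  rw [Nat.card_prod, Nat.card_coe_set_eq, Nat.card_coe_set_eq, f2] at hcard
  have h6 : Nat.card (Equiv.Perm (Fin 3)) = 6 := by
    rw [Nat.card_eq_fintype_card, Fintype.card_perm]; rfl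
  rw [h6] at hcard
  have hn : (Members F G).ncard = TN d := by omega
  exact ⟨Set.finite_of_ncard_pos (by rw [hn]; exact TN_pos hd), hn⟩

end TT
end Mod18

section Mod19
namespace TT
open MvPolynomial
variable {d : ℕ}

lemma contact_iff (H : MvPolynomial (Fin 3) ℂ) (v w : Fin 3 → ℂ) :
    ContactLE H v w 2 ↔ eval v H = 0 ∧ DD H v w = 0 := by
  have h0 : ∀ H : MvPolynomial (Fin 3) ℂ, (linePoly H v w).eval 0 = eval v H := by
    intro H
    induction H using MvPolynomial.induction_on with
    | C c => simp [linePoly]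
    | add p q hp hq => simp only [linePoly] at hp hq ⊢; simp [-Polynomial.X_mul_C, hp, hq]
    | mul_X p i hp => simp only [linePoly] at hp ⊢; simp [-Polynomial.X_mul_C, hp]
  have h1 : ∀ H : MvPolynomial (Fin 3) ℂ, (linePoly H v w).derivative.eval 0 = DD H v w := by
    intro H
    induction H using MvPolynomial.induction_on with
    | C c => simp [linePoly, DD_C]
    | add p q hp hq => simp only [linePoly] at hp hq ⊢; simp [-Polynomial.X_mul_C, hp, hq, DD_add]
    | mul_X p i hp =>
      have h0' := h0 p
      simp only [linePoly] at hp h0' ⊢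
      simp [-Polynomial.X_mul_C, hp, h0', DD_mul, DD_X, Polynomial.derivative_mul]
  have := sq_dvd_iff (linePoly H v w) 0
  rw [h0, h1] at this
  simpa [ContactLE] using this

lemma tri_to_conf {H : MvPolynomial (Fin 3) ℂ} (hH : H.IsHomogeneous d) (p : Fin 3 → Fin 3 → ℂ)
    (h2 : ∀ i, p i 2 ≠ 0) (hcr : ∀ i j, i < j → p i 0 * p j 2 - p i 2 * p j 0 ≠ 0)
    (s t : ℂ) (hu : p 2 = s • p 0 + t • p 1) (he : ∀ i, eval (p i) H = 0)
    (hD : ∀ i, DD H (p i) (p 0) = 0 ∧ DD H (p i) (p 1) = 0) :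
    ∃ a b x, Function.Injective x ∧ ∀ i : Fin 3, (Polynomial.X - Polynomial.C (x i))^2 ∣ restr a b H := by
  set Δ := p 0 0 * p 1 2 - p 0 2 * p 1 0 with hΔ
  have hne : Δ ≠ 0 := hcr 0 1 (by decide)
  set a := (p 0 1 * p 1 2 - p 0 2 * p 1 1) / Δ with ha
  set b := (p 0 0 * p 1 1 - p 0 1 * p 1 0) / Δ with hb
  have ha' : a * Δ = p 0 1 * p 1 2 - p 0 2 * p 1 1 := by rw [ha]; field_simp
  have hb' : b * Δ = p 0 0 * p 1 1 - p 0 1 * p 1 0 := by rw [hb]; field_simp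
  have l0 : a * p 0 0 + b * p 0 2 = p 0 1 := by
    apply mul_right_cancel₀ hne
    linear_combination p 0 0 * ha' + p 0 2 * hb' - p 0 1 * hΔ
  have l1 : a * p 1 0 + b * p 1 2 = p 1 1 := by
    apply mul_right_cancel₀ hne
    linear_combination p 1 0 * ha' + p 1 2 * hb' - p 1 1 * hΔ
  have l2 : a * p 2 0 + b * p 2 2 = p 2 1 := by
    rw [hu]; simp; linear_combination s * l0 + t * l1
  have l : ∀ i, a * p i 0 + b * p i 2 = p i 1 := by
    intro i; fin_cases i
    · exact l0
    · exact l1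
    · exact l2
  have hw : Δ • (![1, a, 0] : Fin 3 → ℂ) = p 1 2 • p 0 + (-p 0 2) • p 1 := by
    funext i
    fin_cases i
    · simp; linear_combination hΔ
    · simp; linear_combination ha'
    · simp; ring
  refine ⟨a, b, fun i => p i 0 / p i 2, ?_, ?_⟩
  · have key : ∀ i j, i < j → p i 0 / p i 2 ≠ p j 0 / p j 2 := by
      intro i j hij h
      have := hcr i j hij
      rw [div_eq_div_iff (h2 i) (h2 j)] at h
      exact this (by linear_combination h)
    exact inj3 _ (key 0 1 (by decide)) (key 0 2 (by decide)) (key 1 2 (by decide))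
  · intro i
    have hp : (![p i 0 / p i 2, a * (p i 0 / p i 2) + b, 1] : Fin 3 → ℂ) = (p i 2)⁻¹ • p i := by
      have := h2 i
      funext j
      fin_cases j
      · simp; field_simp
      · simp [← l i]; field_simp
      · simp; field_simp
    rw [sq_dvd_iff, restr_eval, restr_deriv, hp]
    refine ⟨by rw [eval_scale hH, he i, mul_zero], ?_⟩
    rw [DD_scale hH]
    have := DD_w_smul H Δ (p i) ![1, a, 0]
    rw [hw, DD_w_add, DD_w_smul, DD_w_smul, (hD i).1, (hD i).2] at this
    have : DD H (p i) ![1, a, 0] = 0 := by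
      simpa [hne] using this.symm
    rw [this, mul_zero]

lemma act_pt (g : Fin 4 → ℂ) (H : MvPolynomial (Fin 3) ℂ) (p q : Fin 3 → ℂ) :
    eval (actp g p) (bind₁ (subL g) H) = eval p H ∧ DD (bind₁ (subL g) H) (actp g p) (actp g q) = DD H p q := by
  apply DD_subst
  · exact subL_eval g p
  · intro i
    rw [subL_DD]
    fin_cases i <;> simp [omg, actp]; ring

/-- conditions generic in g -/
def Gen (c : (Fin 4 → ℂ) → Prop) : Prop := ∃ P : MvPolynomial (Fin 4) ℂ, P ≠ 0 ∧ ∀ g, eval g P ≠ 0 → c g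

lemma Gen.and {c c' : (Fin 4 → ℂ) → Prop} (h : Gen c) (h' : Gen c') : Gen (fun g => c g ∧ c' g) := by
  obtain ⟨P, p, hP⟩ := h
  obtain ⟨P', p', hP'⟩ := h'
  refine ⟨P * P', mul_ne_zero p p', fun g hg => ?_⟩
  rw [map_mul, mul_ne_zero_iff] at hg
  exact ⟨hP g hg.1, hP' g hg.2⟩

lemma Gen.all {ι : Type*} (s : Finset ι) {c : ι → (Fin 4 → ℂ) → Prop} (h : ∀ i ∈ s, Gen (c i)) :
    Gen (fun g => ∀ i ∈ s, c i g) := by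
  classical
  induction s using Finset.induction_on with
  | empty => exact ⟨1, one_ne_zero, by simp⟩
  | insert i s hi ih =>
    have := (h i (by simp)).and (ih fun j hj => h j (by simp [hj]))
    simpa using this

lemma Gen.exists {c : (Fin 4 → ℂ) → Prop} (h : Gen c) : ∃ g, c g := by
  obtain ⟨P, p, hP⟩ := h
  by_contra! h
  apply p
  apply MvPolynomial.funext
  intro g
  by_contra h'
  exact h g (hP g (by simpa using h'))

lemma Gen.mk (P : MvPolynomial (Fin 4) ℂ) {c : (Fin 4 → ℂ) → Prop} (h : ∃ g, eval g P ≠ 0)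
    (hc : ∀ g, eval g P ≠ 0 → c g) : Gen c := by
  refine ⟨P, ?_, hc⟩
  rintro rfl
  simp at h

lemma gen_p2 (p : Fin 3 → ℂ) (hp : p ≠ 0) : Gen (fun g => actp g p 2 ≠ 0) := by
  refine Gen.mk (C (p 2) + X 0 * C (p 0) + X 1 * C (p 1)) ?_ (fun g hg => by simpa [actp] using hg)
  by_contra! h
  apply hp
  have e2 : p 2 = 0 := by simpa using h 0
  have e0 : p 0 = 0 := by simpa [e2] using h ![1, 0, 0, 0]
  have e1 : p 1 = 0 := by simpa [e2] using h ![0, 1, 0, 0]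
  funext i; fin_cases i
  · exact e0
  · exact e1
  · exact e2

lemma gen_y (y : Fin 2 → ℂ) (hy : y ≠ 0) : Gen (fun g => y 0 + g 3 * y 1 ≠ 0) := by
  refine Gen.mk (C (y 0) + X 3 * C (y 1)) ?_ (fun g hg => by simpa using hg)
  by_contra! h
  apply hy
  have e0 : y 0 = 0 := by simpa using h 0
  have e1 : y 1 = 0 := by simpa [e0] using h ![0, 0, 0, 1]
  funext i; fin_cases i
  · exact e0
  · exact e1

lemma gen_cr (v w : Fin 3 → ℂ) (h : LinearIndependent ℂ ![v, w]) :
    Gen (fun g => actp g v 0 * actp g w 2 - actp g v 2 * actp g w 0 ≠ 0) := by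
  refine Gen.mk ((C (v 0) + X 2 * C (v 1)) * (C (w 2) + X 0 * C (w 0) + X 1 * C (w 1)) -
    (C (v 2) + X 0 * C (v 0) + X 1 * C (v 1)) * (C (w 0) + X 2 * C (w 1))) ?_ (fun g hg => by simpa [actp] using hg)
  rw [← crossProduct_ne_zero_iff_linearIndependent] at h
  by_contra! h'
  apply h
  have e0 : v 0 * w 2 - v 2 * w 0 = 0 := by simpa using h' 0
  have e1 : (v 0 + v 1) * w 2 - v 2 * (w 0 + w 1) = 0 := by simpa using h' ![0, 0, 1, 0]
  have e2 : v 0 * (w 2 + w 1) - (v 2 + v 1) * w 0 = 0 := by simpa using h' ![0, 1, 0, 0]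
  rw [cross_apply]
  funext i; fin_cases i
  · simp; linear_combination e1 - e0
  · simp; linear_combination -e0
  · simp; linear_combination e2 - e0

lemma eval_aeval_act (g : Fin 4 → ℂ) (τ : Sg d → ℂ) (Q : A d) :
    eval g (aeval (actT (X : Fin 4 → MvPolynomial (Fin 4) ℂ) (fun m => C (τ m))) Q) = eval (actT g τ) Q := by
  induction Q using MvPolynomial.induction_on with
  | C c => simp
  | add p q hp hq => rw [map_add, map_add, hp, hq, map_add]
  | mul_X p i hp =>
    rw [map_mul, map_mul, hp, map_mul, aeval_X, eval_X, actT_map]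
    congr 2
    · funext i; simp
    · funext i; simp

lemma gen_Q (Q : A d) (τ : Sg d → ℂ) (h : eval τ Q ≠ 0) : Gen (fun g => eval (actT g τ) Q ≠ 0) := by
  have key : ∀ g, eval g (aeval (actT (X : Fin 4 → MvPolynomial (Fin 4) ℂ) (fun m => C (τ m))) Q) = eval (actT g τ) Q := by
    intro g
    exact eval_aeval_act g τ Q
  refine Gen.mk _ ⟨0, ?_⟩ (fun g hg => by rwa [key] at hg)
  rw [key]
  have : actT 0 τ = τ := by
    have h1 := actT_inv (0 : Fin 4 → ℂ) (actT 0 τ)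
    have hg : ginv (0 : Fin 4 → ℂ) = 0 := by funext i; fin_cases i <;> simp [ginv]
    have h2 := actT_inv (0 : Fin 4 → ℂ) τ
    have hid : ∀ F : MvPolynomial (Fin 3) ℂ, bind₁ (subL (0 : Fin 4 → ℂ)) F = F := by
      intro F
      have : subL (0 : Fin 4 → ℂ) = X := by
        funext i; fin_cases i <;> simp [subL]
      rw [this, bind₁_X_left]; rfl
    funext m
    rcases m with m | m
    · simp [actT, hid, coeff_form]
    · simp [actT, hid, coeff_form]
  rwa [this]

end TT
end Mod19

section Mod20
namespace TT
open MvPolynomial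
variable {d : ℕ}

lemma li_ne {v w : Fin 3 → ℂ} (h : LinearIndependent ℂ ![v, w]) : v ≠ 0 ∧ w ≠ 0 :=
  ⟨h.ne_zero 0, h.ne_zero 1⟩

lemma pen_alg (f g' : MvPolynomial (Fin 3) ℂ) (y0 y1 t : ℂ) (hy : y0 + t * y1 ≠ 0) :
    f + (y1 / (y0 + t * y1)) • (g' - t • f) = (y0 + t * y1)⁻¹ • (y0 • f + y1 • g') := by
  have h : (y0 + t * y1) • (f + (y1 / (y0 + t * y1)) • (g' - t • f)) = y0 • f + y1 • g' := by
    rw [smul_add, smul_smul, mul_div_cancel₀ _ hy]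
    module
  rw [← h, smul_smul, inv_mul_cancel₀ hy, one_smul]

lemma pen_act (F G : E d → ℂ) (g : Fin 4 → ℂ) (y0 y1 : ℂ) (hy : y0 + g 3 * y1 ≠ 0) :
    form (fun m => actT g (Sum.elim F G) (Sum.inl m)) + (y1 / (y0 + g 3 * y1)) •
      form (fun m => actT g (Sum.elim F G) (Sum.inr m)) =
      (y0 + g 3 * y1)⁻¹ • bind₁ (subL g) (y0 • form F + y1 • form G) := by
  rw [form_actT_inl, form_actT_inr]
  simp only [Sum.elim_inl, Sum.elim_inr]
  rw [map_sub, map_smul, map_add, map_smul, map_smul]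
  exact pen_alg _ _ _ _ _ hy

lemma move (F G : E d → ℂ) (c : Projectivization ℂ (Fin 2 → ℂ)) (hc : c ∈ tritangentMembers (form F) (form G)) :
    Gen (fun g => c.rep 0 + g 3 * c.rep 1 ≠ 0 ∧ c.rep 1 / (c.rep 0 + g 3 * c.rep 1) ∈
      Members (fun m => actT g (Sum.elim F G) (Sum.inl m)) (fun m => actT g (Sum.elim F G) (Sum.inr m))) := by
  obtain ⟨v, w, u, hvw, hu, hvu, hwu, cv, cw, cu⟩ := hc
  rw [contact_iff] at cv cw cu
  obtain ⟨s, t, rfl⟩ := Submodule.mem_span_pair.mp hu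
  set H := pencilMember (form F) (form G) c with hHdef
  have hH : H.IsHomogeneous d := by
    rw [hHdef, pencilMember, ← form_smul, ← form_smul, ← form_add]; exact form_homog _
  have evv : DD H v v = 0 := by rw [DD_euler hH, cv.1, mul_zero]
  have eww : DD H w w = 0 := by rw [DD_euler hH, cw.1, mul_zero]
  set u := s • v + t • w with hudef
  have euw : DD H u w = 0 := by
    have h1 : DD H u u = 0 := by rw [DD_euler hH, cu.1, mul_zero]
    have ht : t ≠ 0 := by
      rintro rfl
      have := (LinearIndependent.pair_iff.mp hvu) (-s) 1 (by simp [hudef])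
      simp at this
    nth_rewrite 2 [hudef] at h1
    rw [DD_w_add, DD_w_smul, DD_w_smul, cu.2] at h1
    simpa [ht] using h1
  have hg := ((gen_y c.rep c.rep_nonzero).and (((gen_p2 v (li_ne hvw).1).and (gen_p2 w (li_ne hvw).2)).and
    (gen_p2 u (li_ne hvu).2))).and (((gen_cr v w hvw).and (gen_cr v u hvu)).and (gen_cr w u hwu))
  obtain ⟨P, hP, hPg⟩ := hg
  refine ⟨P, hP, fun g hgP => ?_⟩
  obtain ⟨⟨hy, ⟨hv2, hw2⟩, hu2⟩, ⟨h01, h02⟩, h12⟩ := hPg g hgP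
  refine ⟨hy, ?_⟩
  obtain ⟨a, b, x, hx, hdvd⟩ := tri_to_conf (bind_homog g hH) ![actp g v, actp g w, actp g u]
    (by intro i; fin_cases i
        · exact hv2
        · exact hw2
        · exact hu2)
    (by intro i j hij; fin_cases i <;> fin_cases j
        · exact absurd hij (by decide)
        · exact h01
        · exact h02
        · exact absurd hij (by decide)
        · exact absurd hij (by decide)
        · exact h12
        · exact absurd hij (by decide)
        · exact absurd hij (by decide)
        · exact absurd hij (by decide))
    s t
    (by
      change actp g u = s • actp g v + t • actp g w
      funext i; fin_cases i <;> simp [actp, hudef] <;> ring)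
    (by intro i; fin_cases i
        · exact (act_pt g H v v).1.trans cv.1
        · exact (act_pt g H w v).1.trans cw.1
        · exact (act_pt g H u v).1.trans cu.1)
    (by intro i; fin_cases i
        · exact ⟨(act_pt g H v v).2.trans evv, (act_pt g H v w).2.trans cv.2⟩
        · exact ⟨(act_pt g H w v).2.trans cw.2, (act_pt g H w w).2.trans eww⟩
        · exact ⟨(act_pt g H u v).2.trans cu.2, (act_pt g H u w).2.trans euw⟩)
  refine ⟨a, b, x, hx, fun i => ?_⟩
  have hHH : form (fun m => actT g (Sum.elim F G) (Sum.inl m)) + (c.rep 1 / (c.rep 0 + g 3 * c.rep 1)) •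
      form (fun m => actT g (Sum.elim F G) (Sum.inr m)) = (c.rep 0 + g 3 * c.rep 1)⁻¹ • bind₁ (subL g) H := by
    exact pen_act F G g _ _ hy
  rw [hHH, map_smul]
  rw [Polynomial.smul_eq_C_mul]; exact (hdvd i).mul_left _

lemma upper {N : ℕ} (Q : A d) (hQ : ∀ F G : E d → ℂ, eval (Sum.elim F G) Q ≠ 0 →
    (Members F G).Finite ∧ (Members F G).ncard = N) (F G : E d → ℂ) (h : eval (Sum.elim F G) Q ≠ 0)
    (W : Finset (Projectivization ℂ (Fin 2 → ℂ))) (hW : ∀ c ∈ W, c ∈ tritangentMembers (form F) (form G)) :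
    W.card ≤ N := by
  obtain ⟨g, hg, hgQ⟩ := ((Gen.all W (fun c hc => move F G c (hW c hc))).and (gen_Q Q _ h)).exists
  have e : Sum.elim (fun m => actT g (Sum.elim F G) (Sum.inl m)) (fun m => actT g (Sum.elim F G) (Sum.inr m)) =
      actT g (Sum.elim F G) := by funext m; rcases m with m | m <;> rfl
  obtain ⟨h1, h2⟩ := hQ (fun m => actT g (Sum.elim F G) (Sum.inl m)) (fun m => actT g (Sum.elim F G) (Sum.inr m))
    (by rw [e]; exact hgQ)
  rw [← h2, ← Set.ncard_coe_finset]
  refine Set.ncard_le_ncard_of_injOn (fun c => c.rep 1 / (c.rep 0 + g 3 * c.rep 1)) ?_ ?_ h1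
  · intro c hc; exact (hg c hc).2
  · intro c hc c' hc' hcc
    have n := (hg c hc).1
    have n' := (hg c' hc').1
    simp only at hcc
    rw [div_eq_div_iff n n'] at hcc
    rw [← c.mk_rep, ← c'.mk_rep, Projectivization.mk_eq_mk_iff']
    refine ⟨(c.rep 0 + g 3 * c.rep 1) / (c'.rep 0 + g 3 * c'.rep 1), ?_⟩
    funext i
    fin_cases i
    · simp
      rw [div_mul_eq_mul_div, div_eq_iff n']
      linear_combination g 3 * hcc
    · simp
      rw [div_mul_eq_mul_div, div_eq_iff n']
      linear_combination -hcc

lemma pt_pair {x y a b : ℂ} (h : x ≠ y) : LinearIndependent ℂ ![(![x, a * x + b, 1] : Fin 3 → ℂ), ![y, a * y + b, 1]] := by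
  rw [LinearIndependent.pair_iff]
  intro s t hst
  have h0 := congrFun hst 0
  have h2 := congrFun hst 2
  simp at h0 h2
  have hs : s * (x - y) = 0 := by linear_combination h0 - y * h2
  have hs : s = 0 := by simpa [sub_ne_zero.mpr h] using hs
  refine ⟨hs, ?_⟩
  simpa [hs] using h2

lemma lower (F G : E d → ℂ) (c : ℂ) (hc : c ∈ Members F G) (h0 : (![1, c] : Fin 2 → ℂ) ≠ 0) :
    Projectivization.mk ℂ ![1, c] h0 ∈ tritangentMembers (form F) (form G) := by
  obtain ⟨a, b, x, hx, hdvd⟩ := hc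
  obtain ⟨l, hl⟩ := Projectivization.exists_smul_eq_mk_rep ℂ ![1, c] h0
  have hM : pencilMember (form F) (form G) (Projectivization.mk ℂ ![1, c] h0) = (l : ℂ) • (form F + c • form G) := by
    rw [pencilMember, ← hl]
    simp [Units.smul_def, smul_add, smul_smul]
  set H := form F + c • form G with hHdef
  have hH : H.IsHomogeneous d := by rw [hHdef, ← form_pencil]; exact form_homog _
  have key : ∀ i j, ContactLE ((l : ℂ) • H) ![x i, a * x i + b, 1] ![x j, a * x j + b, 1] 2 := by
    intro i j
    have h := (sq_dvd_iff _ _).mp (hdvd i)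
    rw [restr_eval, restr_deriv] at h
    rw [contact_iff, DD_smul, smul_eval, h.1, mul_zero]
    refine ⟨rfl, ?_⟩
    have e : (![x j, a * x j + b, 1] : Fin 3 → ℂ) = ![x i, a * x i + b, 1] + (x j - x i) • ![1, a, 0] := by
      funext k; fin_cases k <;> simp; ring
    rw [e, DD_w_add, DD_w_smul, h.2, DD_euler hH, h.1]
    simp
  have d01 : x 0 ≠ x 1 := hx.ne (by decide)
  refine ⟨![x 0, a * x 0 + b, 1], ![x 1, a * x 1 + b, 1], ![x 2, a * x 2 + b, 1], pt_pair d01, ?_,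
    pt_pair (hx.ne (by decide)), pt_pair (hx.ne (by decide)), ?_, ?_, ?_⟩
  · rw [Submodule.mem_span_pair]
    have := sub_ne_zero.mpr d01
    refine ⟨(x 2 - x 1) / (x 0 - x 1), (x 0 - x 2) / (x 0 - x 1), ?_⟩
    funext k
    fin_cases k
    · simp; field_simp; ring
    · simp; field_simp; ring
    · simp; field_simp; ring
  · rw [hM]; exact key 0 1
  · rw [hM]; exact key 1 0
  · rw [hM]; exact key 2 0

theorem count_eq (hd : 1 ≤ d) {N : ℕ} (h : ChartCount d N) : TritangentCountEq d N := by
  obtain ⟨Q, hQ0, hQ⟩ := h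
  have ev : ∀ F G : MvPolynomial (Fin 3) ℂ, eval (coeffs2 F G) (rename (Sum.map Subtype.val Subtype.val) Q) =
      eval (Sum.elim (fun m : E d => coeff m.1 F) (fun m : E d => coeff m.1 G)) Q := by
    intro F G
    rw [eval_rename]
    congr 2
    funext m
    rcases m with m | m <;> rfl
  refine ⟨rename (Sum.map Subtype.val Subtype.val) Q, ?_, ?_⟩
  · let m0 : E d := ⟨Finsupp.single 0 d, by rw [mem_E]; simp⟩
    let m1 : E d := ⟨Finsupp.single 1 d, by rw [mem_E]; simp⟩
    have hm : m0 ≠ m1 := by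
      intro h
      have := DFunLike.congr_fun (congrArg Subtype.val h) 0
      simp [m0, m1] at this
      omega
    let D : A d := X (Sum.inl m0) * X (Sum.inr m1) - X (Sum.inl m1) * X (Sum.inr m0)
    have hD : D ≠ 0 := by
      intro h
      have := congrArg (eval (Sum.elim (fun m => if m = m0 then 1 else 0) (fun m => if m = m1 then 1 else 0))) h
      simp [D, hm, hm.symm] at this
    have : ∃ τ, eval τ (Q * D) ≠ 0 := by
      by_contra! h
      exact mul_ne_zero hQ0 hD (MvPolynomial.funext fun τ => by simpa using h τ)
    obtain ⟨τ, hτ⟩ := this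
    rw [map_mul, mul_ne_zero_iff] at hτ
    refine ⟨form (fun m : E d => τ (Sum.inl m)), form (fun m : E d => τ (Sum.inr m)), form_homog _, form_homog _, ?_, ?_⟩
    · rw [LinearIndependent.pair_iff]
      intro s t hst
      have h1 := congrArg (coeff m0.1) hst
      have h2 := congrArg (coeff m1.1) hst
      simp only [coeff_add, coeff_smul, coeff_form, coeff_zero, smul_eq_mul] at h1 h2
      have hd := hτ.2
      simp only [D, map_sub, map_mul, eval_X] at hd
      constructor
      · apply (mul_eq_zero.mp _).resolve_right hd
        linear_combination τ (Sum.inr m1) * h1 - τ (Sum.inr m0) * h2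
      · apply (mul_eq_zero.mp _).resolve_right hd
        linear_combination τ (Sum.inl m0) * h2 - τ (Sum.inl m1) * h1
    · rw [ev]
      simp only [coeff_form]
      convert hτ.1 using 3
      funext m; rcases m with m | m <;> rfl
  · intro F G hF hG _ hne
    rw [ev] at hne
    rw [← form_coeff hF, ← form_coeff hG]
    have hN := hQ _ _ hne
    have up := upper Q hQ _ _ hne
    generalize (fun m : E d => coeff m.1 F) = f at *
    generalize (fun m : E d => coeff m.1 G) = g at *
    have hfin : (tritangentMembers (form f) (form g)).Finite := by
      by_contra hinf
      obtain ⟨t, ht, htf, htc⟩ := Set.Infinite.exists_subset_ncard_eq hinf (N + 1)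
      have := up htf.toFinset (fun c hc => ht (by simpa using hc))
      rw [← Set.ncard_eq_toFinset_card _ htf, htc] at this
      omega
    refine ⟨hfin, le_antisymm ?_ ?_⟩
    · rw [Set.ncard_eq_toFinset_card _ hfin]
      exact up _ (fun c hc => by simpa using hc)
    · rw [← hN.2]
      have h0 : ∀ c : ℂ, (![1, c] : Fin 2 → ℂ) ≠ 0 := fun c h => by simpa using congrFun h 0
      refine Set.ncard_le_ncard_of_injOn (fun c => Projectivization.mk ℂ ![1, c] (h0 c)) ?_ ?_ hfin
      · intro c hc; exact lower f g c hc (h0 c)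
      · intro c _ c' _ hcc
        simp only at hcc
        rw [Projectivization.mk_eq_mk_iff'] at hcc
        obtain ⟨a, ha⟩ := hcc
        have e0 := congrFun ha 0
        have e1 := congrFun ha 1
        simp at e0 e1
        rw [← e1, e0, one_mul]

theorem count_high (hd : 6 ≤ d) : TritangentCountEq d (TN d) := count_eq (by omega) (chart_high hd)
theorem count_low (h3 : 3 ≤ d) (h5 : d ≤ 5) : TritangentCountEq d 0 := count_eq (by omega) (chart_low h3 h5)

theorem TN_cast (hd : 6 ≤ d) : (TN d : ℤ) = (d-3)*(d-4)*(d-5)*(d^2+3*d-2) := by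
  obtain ⟨k, rfl⟩ := Nat.exists_eq_add_of_le hd
  unfold TN
  have h1 : 6 + k - 3 = k + 3 := by omega
  have h2 : 6 + k - 4 = k + 2 := by omega
  have h3 : 6 + k - 5 = k + 1 := by omega
  have h4 : (6 + k)^2 + 3 * (6 + k) - 2 = k^2 + 15 * k + 52 := by
    have : (6 + k)^2 + 3 * (6 + k) = k^2 + 15 * k + 52 + 2 := by ring
    omega
  rw [h1, h2, h3, h4]
  push_cast
  ring

end TT
end Mod20

theorem tritangent_count_recursion (d : ℕ) (hd : 5 ≤ d) :
    ∃ Td Td2 : ℕ, TritangentCountEq d Td ∧ TritangentCountEq (d - 2) Td2 ∧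
      (Td : ℤ) = (Td2 : ℤ) + 10 * (d : ℤ) ^ 4 - 112 * (d : ℤ) ^ 3 + 350 * (d : ℤ) ^ 2
        - 56 * (d : ℤ) - 720 := by
  by_cases h8 : 8 ≤ d
  · refine ⟨_, _, TT.count_high (by omega), TT.count_high (by omega), ?_⟩
    rw [TT.TN_cast (by omega), TT.TN_cast (by omega)]
    push_cast [show 2 ≤ d by omega]
    ring
  · by_cases h6 : 6 ≤ d
    · refine ⟨_, 0, TT.count_high h6, TT.count_low (by omega) (by omega), ?_⟩
      rw [TT.TN_cast h6]
      have : d = 6 ∨ d = 7 := by omega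
      rcases this with rfl | rfl <;> norm_num
    · have : d = 5 := by omega
      subst this
      exact ⟨0, 0, TT.count_low (by omega) (by omega), TT.count_low (by omega) (by omega), by norm_num⟩
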